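/- Let X be a standard Borel space, E a countable Borel equivalence relation on X, and ρ : E → (0,∞) a Borel cocycle. Then exactly one of the following holds: (1) there is a finite-to-one Borel compression of ρ over a finite Borel subequivalence relation of E; (2) there is a ρ-invariant Borel probability measure on X. -/

import Mathlib

open MeasureTheory Set ENNReal

namespace CocycleNadkarni

variable {X : Type*} {Γ : Type*}

/-- The `ρ`-size of `Y` relative to the point `z`: `∑_{y ∈ Y} ρ(y, z)`. -/
noncomputable def eSize (ρ : X → X → ℝ) (Y : Set X) (z : X) : ℝ≥0∞ :=
  ∑' y : Y, ENNReal.ofReal (ρ y z)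

/-- The `ρ`-size of `Y` relative to the set `Z`, computed at the point `z`. -/
noncomputable def relSize (ρ : X → X → ℝ) (Y Z : Set X) (z : X) : ℝ≥0∞ :=
  eSize ρ Y z / eSize ρ Z z

/-- Real-valued `ρ`-size (used for finite sets). -/
noncomputable def rSize (ρ : X → X → ℝ) (Y : Set X) (z : X) : ℝ :=
  ∑' y : Y, ρ y z

/-- `∫_C f dμ^ρ_S`, computed at the point `z`. -/
noncomputable def avgOn (ρ : X → X → ℝ) (f : X → ℝ) (S C : Set X) (z : X) : ℝ :=
  (∑' y : ↥(S ∩ C), f y * ρ y z) / rSize ρ S z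

/-- countable Borel equivalence relation -/
def IsCBER [MeasurableSpace X] (E : X → X → Prop) : Prop :=
  Equivalence E ∧ MeasurableSet {p : X × X | E p.1 p.2} ∧ ∀ x : X, {y | E x y}.Countable

/-- Borel cocycle `ρ : E → (0, ∞)` (as a total function whose values off `E` are irrelevant). -/
def IsCocycle [MeasurableSpace X] (E : X → X → Prop) (ρ : X → X → ℝ) : Prop :=
  Measurable (fun p : X × X => ρ p.1 p.2) ∧
    (∀ ⦃x y : X⦄, E x y → 0 < ρ x y) ∧
    ∀ ⦃x y z : X⦄, E x y → E y z → ρ x z = ρ x y * ρ y z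

/-- Borel cocycle into a group `Γ`. -/
def IsGrpCocycle [MeasurableSpace X] [Group Γ] [MeasurableSpace Γ]
    (E : X → X → Prop) (ρ : X → X → Γ) : Prop :=
  Measurable (fun p : X × X => ρ p.1 p.2) ∧
    ∀ ⦃x y z : X⦄, E x y → E y z → ρ x z = ρ x y * ρ y z

/-- finite Borel subequivalence relation of `E` -/
def IsFinSubequiv [MeasurableSpace X] (E F : X → X → Prop) : Prop :=
  Equivalence F ∧ MeasurableSet {p : X × X | F p.1 p.2} ∧
    (∀ ⦃x y : X⦄, F x y → E x y) ∧ ∀ x : X, {y | F x y}.Finite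

/-- finite Borel subequivalence relation of `E` restricted to `W` (extended by the diagonal). -/
def IsFinSubequivOn [MeasurableSpace X] (E : X → X → Prop) (W : Set X)
    (F : X → X → Prop) : Prop :=
  Equivalence F ∧ MeasurableSet {p : X × X | F p.1 p.2} ∧
    (∀ ⦃x y : X⦄, F x y → x = y ∨ (E x y ∧ x ∈ W ∧ y ∈ W)) ∧ ∀ x : X, {y | F x y}.Finite

/-- `ρ`-invariance of a Borel measure. -/
def IsInvariant [MeasurableSpace X] (E : X → X → Prop) (ρ : X → X → ℝ)
    (μ : Measure X) : Prop :=
  ∀ T : X ≃ᵐ X, (∀ x, E (T x) x) → ∀ B : Set X, MeasurableSet B →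
    μ (T '' B) = ∫⁻ x in B, ENNReal.ofReal (ρ (T x) x) ∂μ

/-- invariance w.r.t. the restriction of `ρ` to a set `R` of pairs, via Borel injections
whose graphs are contained in `R⁻¹`. -/
def IsInvariantRel [MeasurableSpace X] (R : Set (X × X)) (ρ : X → X → ℝ)
    (μ : Measure X) : Prop :=
  ∀ (B : Set X) (T : X → X), MeasurableSet B → Measurable T → Set.InjOn T B →
    (∀ x ∈ B, ((T x, x) : X × X) ∈ R) →
    μ (T '' B) = ∫⁻ x in B, ENNReal.ofReal (ρ (T x) x) ∂μ

/-- a Borel ℕ-coloring of the lacunarity digraph `G^ρ_Z`. -/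
def HasColoring [MeasurableSpace X] (E : X → X → Prop) (ρ : X → X → Γ)
    (Z : Set Γ) : Prop :=
  ∃ c : X → ℕ, Measurable c ∧
    ∀ ⦃x y : X⦄, x ≠ y → E x y → ρ x y ∈ Z → c x ≠ c y

/-- smoothness of the cocycle `ρ` restricted to `E` restricted to `W`. -/
def SmoothOn [MeasurableSpace X] (E : X → X → Prop) (ρ : X → X → ℝ)
    (W : Set X) : Prop :=
  ∃ U : Set ℝ, IsOpen U ∧ (1:ℝ) ∈ U ∧ U ⊆ Set.Ioi 0 ∧
    ∃ c : X → ℕ, Measurable c ∧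
      ∀ ⦃x y : X⦄, x ∈ W → y ∈ W → x ≠ y → E x y → ρ x y ∈ U → c x ≠ c y

/-- smoothness of the cocycle `ρ` on `E`. -/
def Smooth [MeasurableSpace X] (E : X → X → Prop) (ρ : X → X → ℝ) : Prop :=
  SmoothOn E ρ Set.univ

/-- `E`-invariance of a set. -/
def EInvariant (E : X → X → Prop) (B : Set X) : Prop :=
  ∀ ⦃x y : X⦄, E x y → x ∈ B → y ∈ B

/-- a compression of `ρ` over the finite subequivalence relation `F` of `E`. -/
def CompressionOver [MeasurableSpace X] (E F : X → X → Prop) (ρ : X → X → ℝ)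
    (φ : X → X) : Prop :=
  (∀ x, E x (φ x)) ∧
  (∀ x : X, relSize ρ (φ ⁻¹' {y | F y x}) {y | F y x} x ≤ 1) ∧
  (∀ x : X, ∃ y, E x y ∧ relSize ρ (φ ⁻¹' {z | F z y}) {z | F z y} y < 1)

/-- a compression of the quotient of `ρ | E | W` by the finite subequivalence relation given
by the setoid `s`, expressed via representatives. -/
def QuotCompressionOn [MeasurableSpace X] (E : X → X → Prop) (ρ : X → X → ℝ)
    (W : Set X) (s : Setoid X) (φ : Quotient s → Quotient s) : Prop :=
  (∀ ⦃x : X⦄, x ∈ W → ∀ y : X, φ (Quotient.mk s x) = Quotient.mk s y → (E x y ∧ y ∈ W)) ∧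
  (∀ ⦃x : X⦄, x ∈ W →
    relSize ρ {y | y ∈ W ∧ φ (Quotient.mk s y) = Quotient.mk s x} {y | s.r y x} x ≤ 1) ∧
  (∀ ⦃x : X⦄, x ∈ W → ∃ y, y ∈ W ∧ E x y ∧
    relSize ρ {z | z ∈ W ∧ φ (Quotient.mk s z) = Quotient.mk s y} {z | s.r z y} y < 1)


/-- `B` has `ρ`-density at least `ε` relative to `W`. -/
def HasDensityAtLeastOn [MeasurableSpace X] (E : X → X → Prop) (ρ : X → X → ℝ)
    (B W : Set X) (ε : ℝ) : Prop :=
  ∃ F : X → X → Prop, IsFinSubequivOn E W F ∧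
    ∀ x ∈ W, ENNReal.ofReal ε ≤ relSize ρ (B ∩ {y | F y x}) {y | F y x} x

/-- `B` has positive `ρ`-density relative to `W`. -/
def HasPosDensityOn [MeasurableSpace X] (E : X → X → Prop) (ρ : X → X → ℝ)
    (B W : Set X) : Prop :=
  ∃ ε : ℝ, 0 < ε ∧ HasDensityAtLeastOn E ρ B W ε

/-- `B` has σ-positive `ρ`-density relative to `W`. -/
def HasSigmaPosDensityOn [MeasurableSpace X] (E : X → X → Prop) (ρ : X → X → ℝ)
    (B W : Set X) : Prop :=
  ∃ A : ℕ → Set X, (∀ n, MeasurableSet (A n)) ∧ (∀ n, A n ⊆ W) ∧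
    (∀ n, ∀ x ∈ A n, ∀ y ∈ W, E x y → y ∈ A n) ∧ W = ⋃ n, A n ∧
    ∀ n, HasPosDensityOn E ρ (B ∩ A n) (A n)

end CocycleNadkarni

section
set_option linter.unusedSectionVars false
set_option linter.style.haveILetI false
open MeasureTheory Set ENNReal
namespace CocycleNadkarni

/-- A measurable partial function image is contained in a Borel single-valued set. -/
theorem exists_borel_graph {Z X Y : Type*} [MeasurableSpace Z] [StandardBorelSpace Z]
    [MeasurableSpace X] [StandardBorelSpace X] [MeasurableSpace Y] [StandardBorelSpace Y]
    {f : Z → X} {g : Z → Y} (hf : Measurable f) (hg : Measurable g) {D : Set Z}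
    (hD : MeasurableSet D) (hs : ∀ z ∈ D, ∀ z' ∈ D, f z = f z' → g z = g z') :
    ∃ B : Set (X × Y), MeasurableSet B ∧ (∀ x y y', (x, y) ∈ B → (x, y') ∈ B → y = y') ∧
      ∀ z ∈ D, (f z, g z) ∈ B := by
  let _ := upgradeStandardBorel X
  obtain ⟨S, hS, hsep⟩ := exists_seq_separating Y (p := MeasurableSet) MeasurableSet.empty univ
  have h1 : ∀ n, MeasurablySeparable (f '' (D ∩ g ⁻¹' (S n))) (f '' (D ∩ g ⁻¹' (S n)ᶜ)) := by
    intro n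
    apply AnalyticSet.measurablySeparable
    · exact MeasurableSet.analyticSet_image (hD.inter (hg (hS n))) hf
    · exact MeasurableSet.analyticSet_image (hD.inter (hg (hS n).compl)) hf
    · rw [Set.disjoint_left]
      rintro _ ⟨z, ⟨hz, hz2⟩, rfl⟩ ⟨z', ⟨hz', hz2'⟩, he⟩
      apply hz2'
      have := hs z' hz' z hz he
      simp only [mem_preimage] at hz2 ⊢
      rwa [this]
  choose W hW1 hW2 hW3 using h1
  refine ⟨⋂ n, {p : X × Y | p.1 ∈ W n ↔ p.2 ∈ S n}, ?_, ?_, ?_⟩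
  · refine MeasurableSet.iInter fun n => ?_
    have h1 : MeasurableSet {p : X × Y | p.1 ∈ W n} := measurable_fst (hW3 n)
    have h2 : MeasurableSet {p : X × Y | p.2 ∈ S n} := measurable_snd (hS n)
    have : {p : X × Y | p.1 ∈ W n ↔ p.2 ∈ S n} =
      ({p : X × Y | p.1 ∈ W n} ∩ {p : X × Y | p.2 ∈ S n}) ∪
      ({p : X × Y | p.1 ∈ W n}ᶜ ∩ {p : X × Y | p.2 ∈ S n}ᶜ) := by
      ext p; simp; tauto
    rw [this]
    exact (h1.inter h2).union (h1.compl.inter h2.compl)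
  · intro x y y' h h'
    apply hsep y (mem_univ _) y' (mem_univ _)
    intro n
    have a := mem_iInter.1 h n
    have b := mem_iInter.1 h' n
    simp only [mem_ofPred_eq] at a b
    rw [← a, ← b]
  · intro z hz
    refine mem_iInter.2 fun n => ?_
    simp only [mem_ofPred_eq]
    constructor
    · intro h
      by_contra h'
      exact Set.disjoint_left.1 (hW2 n) ⟨z, ⟨hz, h'⟩, rfl⟩ h
    · intro h
      exact hW1 n ⟨z, ⟨hz, h⟩, rfl⟩

/-- covered by countably many Borel graphs -/
def Thin {X Y : Type*} [MeasurableSpace X] [MeasurableSpace Y] (P : Set (X × Y)) : Prop :=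
  ∃ B : ℕ → Set (X × Y), (∀ n, MeasurableSet (B n)) ∧
    (∀ n x y y', (x, y) ∈ B n → (x, y') ∈ B n → y = y') ∧ P ⊆ ⋃ n, B n

theorem Thin.mono {X Y : Type*} [MeasurableSpace X] [MeasurableSpace Y] {P Q : Set (X × Y)}
    (h : Thin P) (hQ : Q ⊆ P) : Thin Q := by
  obtain ⟨B, h1, h2, h3⟩ := h
  exact ⟨B, h1, h2, hQ.trans h3⟩

theorem Thin.iUnion {ι : Type*} [Countable ι] {X Y : Type*} [MeasurableSpace X]
    [MeasurableSpace Y] {P : ι → Set (X × Y)} (h : ∀ i, Thin (P i)) : Thin (⋃ i, P i) := by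
  rcases isEmpty_or_nonempty ι with hι | hι
  · refine ⟨fun _ => ∅, fun _ => MeasurableSet.empty, by simp, by simp⟩
  choose B h1 h2 h3 using h
  obtain ⟨e, he⟩ := exists_surjective_nat ι
  refine ⟨fun n => B (e n.unpair.1) n.unpair.2, fun n => h1 _ _, fun n => h2 _ _, ?_⟩
  refine iUnion_subset fun i => (h3 i).trans (iUnion_subset fun n => ?_)
  obtain ⟨k, hk⟩ := he i
  intro p hp
  refine mem_iUnion.2 ⟨Nat.pair k n, ?_⟩
  simpa [hk] using hp

theorem Thin.of_graph {X Y : Type*} [MeasurableSpace X] [MeasurableSpace Y] {B : Set (X × Y)}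
    (hB : MeasurableSet B) (h : ∀ x y y', (x, y) ∈ B → (x, y') ∈ B → y = y') : Thin B :=
  ⟨fun _ => B, fun _ => hB, fun _ => h, by simp [iUnion_const]⟩

section LN

/-- splitting nodes -/
noncomputable def splitSeq (n : ℕ) : ℕ → Bool := TopologicalSpace.denseSeq (ℕ → Bool) n.unpair.1

theorem splitSeq_dense (k : ℕ) (b : ℕ → Bool) : ∃ n, k ≤ n ∧ ∀ i < k, splitSeq n i = b i := by
  have hU : IsOpen {c : ℕ → Bool | ∀ i < k, c i = b i} := by
    have : {c : ℕ → Bool | ∀ i < k, c i = b i} = ⋂ i ∈ Finset.range k, {c | c i = b i} := by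
      ext c; simp
    rw [this]
    refine isOpen_biInter_finset fun i _ => ?_
    exact (isOpen_discrete ({b i} : Set Bool)).preimage (continuous_apply (A := fun _ : ℕ => Bool) i)
  obtain ⟨i, hi⟩ := (TopologicalSpace.denseRange_denseSeq (ℕ → Bool)).exists_mem_open hU
    ⟨b, fun _ _ => rfl⟩
  refine ⟨Nat.pair i k, Nat.right_le_pair i k, ?_⟩
  intro j hj
  simp only [splitSeq, Nat.unpair_pair]
  exact hi j hj

/-- approximations -/
abbrev Ap (n : ℕ) := ((Fin n → Bool) → (Fin n → ℕ)) × (Fin n → ℕ)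

/-- edges -/
def Ed (m : ℕ) {n : ℕ} (u v : Fin n → Bool) : Prop :=
  (∀ i : Fin n, (i : ℕ) < m → u i = splitSeq m i ∧ v i = splitSeq m i) ∧
  (∀ i : Fin n, (i : ℕ) = m → u i = false ∧ v i = true) ∧
  (∀ i : Fin n, m < (i : ℕ) → u i = v i)

variable {X Y : Type*} [TopologicalSpace X] [MetricSpace Y]

/-- configurations compatible with an approximation -/
def Compat (h : (ℕ → ℕ) → X × Y) (A : Set (X × Y)) {n : ℕ} (a : Ap n)
    (γ : (Fin n → Bool) → (ℕ → ℕ)) : Prop :=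
  (∀ u (i : Fin n), γ u i = a.1 u i) ∧ (∀ u v, (h (γ u)).1 = (h (γ v)).1) ∧
  (∀ u, h (γ u) ∈ A) ∧
  (∀ (m : Fin n) (u v), Ed m u v → 1 / ((a.2 m : ℝ) + 1) ≤ dist (h (γ u)).2 (h (γ v)).2)

/-- one step extensions -/
def ExtAp {n : ℕ} (a : Ap n) (b : Ap (n + 1)) : Prop :=
  (∀ u (i : Fin n), b.1 u i.castSucc = a.1 (fun j => u j.castSucc) i) ∧
  (∀ m : Fin n, b.2 m.castSucc = a.2 m)

def Term (h : (ℕ → ℕ) → X × Y) (A : Set (X × Y)) {n : ℕ} (a : Ap n) : Prop :=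
  ∀ b : Ap (n + 1), ExtAp a b → ∀ γ, ¬ Compat h A b γ

theorem Term.mono {h : (ℕ → ℕ) → X × Y} {A A' : Set (X × Y)} (hA : A' ⊆ A) {n : ℕ} {a : Ap n}
    (ht : Term h A a) : Term h A' a := by
  intro b hb γ hγ
  exact ht b hb γ ⟨hγ.1, hγ.2.1, fun u => hA (hγ.2.2.1 u), hγ.2.2.2⟩

theorem Term.single {h : (ℕ → ℕ) → X × Y} {A : Set (X × Y)} {n : ℕ} {a : Ap n}
    (ht : Term h A a) (γ γ') (hγ : Compat h A a γ) (hγ' : Compat h A a γ')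
    (he : (h (γ (fun i => splitSeq n i))).1 = (h (γ' (fun i => splitSeq n i))).1) :
    (h (γ (fun i => splitSeq n i))).2 = (h (γ' (fun i => splitSeq n i))).2 := by
  by_contra hne
  have hd : 0 < dist (h (γ (fun i => splitSeq n i))).2 (h (γ' (fun i => splitSeq n i))).2 :=
    dist_pos.2 hne
  obtain ⟨N, hN⟩ := exists_nat_one_div_lt hd
  set δ : (Fin (n + 1) → Bool) → (ℕ → ℕ) := fun u =>
    if u (Fin.last n) = false then γ (fun j => u j.castSucc) else γ' (fun j => u j.castSucc) with hδ
  have hx : ∀ u, (h (δ u)).1 = (h (γ (fun i => splitSeq n i))).1 := by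
    intro u
    simp only [hδ]
    split_ifs
    · exact hγ.2.1 _ _
    · rw [he]; exact hγ'.2.1 _ _
  refine ht (fun u i => δ u i, Fin.snoc (α := fun _ => ℕ) a.2 N) ⟨?_, ?_⟩ δ
    ⟨fun u i => rfl, ?_, ?_, ?_⟩
  · intro u i
    simp only [hδ]
    split_ifs
    · exact hγ.1 _ _
    · exact hγ'.1 _ _
  · intro m
    simp
  · intro u v
    rw [hx, hx]
  · intro u
    simp only [hδ]
    split_ifs
    · exact hγ.2.2.1 _
    · exact hγ'.2.2.1 _
  · intro m u v huv
    induction m using Fin.lastCases with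
    | last =>
      simp only [Fin.snoc_last]
      have hu : u (Fin.last n) = false := (huv.2.1 (Fin.last n) rfl).1
      have hv : v (Fin.last n) = true := (huv.2.1 (Fin.last n) rfl).2
      have hu' : (fun j : Fin n => u j.castSucc) = fun i : Fin n => splitSeq n i := by
        funext j; exact (huv.1 j.castSucc (by simp)).1
      have hv' : (fun j : Fin n => v j.castSucc) = fun i : Fin n => splitSeq n i := by
        funext j; exact (huv.1 j.castSucc (by simp)).2
      simp only [hδ, hu, hv, hu', hv']
      simpa using hN.le
    | cast m =>
      simp only [Fin.snoc_castSucc]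
      have hl : u (Fin.last n) = v (Fin.last n) := huv.2.2 _ (by simp)
      have hE : Ed (m : ℕ) (fun j : Fin n => u j.castSucc) (fun j : Fin n => v j.castSucc) := by
        refine ⟨fun i hi => huv.1 i.castSucc (by simpa using hi), fun i hi => huv.2.1 i.castSucc (by simpa using hi),
          fun i hi => huv.2.2 i.castSucc (by simpa using hi)⟩
      simp only [hδ, hl]
      split_ifs
      · exact hγ.2.2.2 m _ _ hE
      · exact hγ'.2.2.2 m _ _ hE

end LN
end CocycleNadkarni
end

section
set_option linter.unusedSectionVars false
set_option linter.style.haveILetI false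
open MeasureTheory Set ENNReal
namespace CocycleNadkarni

section LN2
open Filter Topology
variable {X Y : Type*}

theorem thin_aux_limit [TopologicalSpace X] [T2Space X] [MetricSpace Y]
    (h : (ℕ → ℕ) → X × Y) (hc : Continuous h)
    (hcount : ∀ x, {y | (x, y) ∈ range h}.Countable)
    (A : Set (X × Y)) (a : ∀ n, Ap n) (hext : ∀ n, ExtAp (a n) (a (n + 1)))
    (γ : ∀ n, (Fin n → Bool) → (ℕ → ℕ)) (hγ : ∀ n, Compat h A (a n) (γ n)) : False := by
  set C : (ℕ → Bool) → (ℕ → ℕ) := fun b k => (a (k + 1)).1 (fun i => b i) (Fin.last k) with hC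
  set e : ℕ → ℕ := fun k => (a (k + 1)).2 (Fin.last k) with he
  have hC1 : ∀ b k n (hk : k < n), (a n).1 (fun i => b i) ⟨k, hk⟩ = C b k := by
    intro b k n hk
    induction n, hk using Nat.le_induction with
    | base => rfl
    | succ n hn ih =>
      have hn : k < n := hn
      rw [← ih]
      exact (hext n).1 (fun i => b i) ⟨k, hn⟩
  have he1 : ∀ k n (hk : k < n), (a n).2 ⟨k, hk⟩ = e k := by
    intro k n hk
    induction n, hk using Nat.le_induction with
    | base => rfl
    | succ n hn ih =>
      have hn : k < n := hn
      rw [← ih]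
      exact (hext n).2 ⟨k, hn⟩
  have hlim : ∀ b, Tendsto (fun n => γ n (fun i => b i)) atTop (𝓝 (C b)) := by
    intro b
    rw [tendsto_pi_nhds]
    intro k
    refine tendsto_const_nhds.congr' ?_
    filter_upwards [eventually_gt_atTop k] with n hn
    rw [← hC1 b k n hn]
    exact ((hγ n).1 _ ⟨k, hn⟩).symm
  have hlim2 : ∀ b, Tendsto (fun n => h (γ n (fun i => b i))) atTop (𝓝 (h (C b))) :=
    fun b => (hc.tendsto _).comp (hlim b)
  have hfst : ∀ b b', (h (C b)).1 = (h (C b')).1 := by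
    intro b b'
    refine tendsto_nhds_unique ((continuous_fst.tendsto _).comp (hlim2 b)) ?_
    refine ((continuous_fst.tendsto _).comp (hlim2 b')).congr fun n => ?_
    exact (hγ n).2.1 _ _
  have hCc : Continuous C := by
    refine continuous_pi fun k => ?_
    have h1 : Continuous (fun b : ℕ → Bool => fun i : Fin (k + 1) => b i) :=
      continuous_pi fun i => continuous_apply (A := fun _ : ℕ => Bool) (i : ℕ)
    have h2 : Continuous (fun u : Fin (k + 1) → Bool => (a (k + 1)).1 u (Fin.last k)) :=
      continuous_of_discreteTopology
    exact h2.comp h1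
  set x := (h (C fun _ => false)).1 with hx
  have hS := hcount x
  have : Countable {y | (x, y) ∈ range h} := hS.to_subtype
  have hB := nonempty_interior_of_iUnion_of_closed
    (f := fun y : {y | (x, y) ∈ range h} => {b : ℕ → Bool | (h (C b)).2 = y})
    (fun y => isClosed_eq (continuous_snd.comp (hc.comp hCc)) continuous_const) (by
      rw [eq_univ_iff_forall]
      intro b
      refine mem_iUnion.2 ⟨⟨(h (C b)).2, ⟨C b, ?_⟩⟩, rfl⟩
      exact Prod.ext (show (h (C b)).1 = x from hfst b (fun _ => false)) rfl)
  obtain ⟨y, b, hb⟩ := hB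
  obtain ⟨s, ⟨b', k, rfl⟩, hbs, hsub⟩ := (PiNat.isTopologicalBasis_cylinders
    (fun _ : ℕ => Bool)).exists_subset_of_mem_open hb isOpen_interior
  have hsub := hsub.trans interior_subset
  obtain ⟨n, hkn, hn⟩ := splitSeq_dense k b'
  have hu : ∀ c : Bool, Function.update (splitSeq n) n c ∈ PiNat.cylinder b' k := by
    intro c i hi
    rw [Function.update_of_ne (by omega)]
    exact hn i hi
  have h0 : (h (C (Function.update (splitSeq n) n false))).2 = y := hsub (hu false)
  have h1 : (h (C (Function.update (splitSeq n) n true))).2 = y := hsub (hu true)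
  have hd : 1 / ((e n : ℝ) + 1) ≤ dist (h (C (Function.update (splitSeq n) n false))).2
      (h (C (Function.update (splitSeq n) n true))).2 := by
    refine ge_of_tendsto (((continuous_snd.tendsto _).comp (hlim2 _)).dist
      ((continuous_snd.tendsto _).comp (hlim2 _))) ?_
    filter_upwards [eventually_gt_atTop n] with N hN
    rw [← he1 n N hN]
    refine (hγ N).2.2.2 ⟨n, hN⟩ _ _ ⟨?_, ?_, ?_⟩
    · intro i hi
      have : (i : ℕ) ≠ n := by simp at hi; omega
      simp [Function.update_of_ne this]
    · intro i hi
      simp at hi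
      simp [hi]
    · intro i hi
      have : (i : ℕ) ≠ n := by simp at hi; omega
      simp [Function.update_of_ne this]
  rw [h0, h1, dist_self] at hd
  have : 0 < 1 / ((e n : ℝ) + 1) := by positivity
  linarith

theorem thin_of_countable [TopologicalSpace X] [PolishSpace X] [MeasurableSpace X] [BorelSpace X]
    [MetricSpace Y] [CompleteSpace Y] [SecondCountableTopology Y] [MeasurableSpace Y] [BorelSpace Y]
    {P : Set (X × Y)} (hP : MeasurableSet P) (hcount : ∀ x, {y | (x, y) ∈ P}.Countable) :
    Thin P := by
  by_contra hthin
  have hPa := hP.analyticSet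
  rw [AnalyticSet] at hPa
  rcases hPa with rfl | ⟨h, hc, hr⟩
  · exact hthin ⟨fun _ => ∅, fun _ => MeasurableSet.empty, by simp, by simp⟩
  have hm : Measurable h := hc.measurable
  let Ia := Σ n, Ap n
  classical
  let Ast : Ia → Set (X × Y) := fun a =>
    if ha : ∃ A : Set (X × Y), MeasurableSet A ∧ Thin (P \ A) ∧ Term h A a.2 then ha.choose else univ
  have hAst1 : ∀ a, MeasurableSet (Ast a) := by
    intro a
    simp only [Ast]
    split_ifs with ha
    · exact ha.choose_spec.1
    · exact MeasurableSet.univ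
  have hAst2 : ∀ a, Thin (P \ Ast a) := by
    intro a
    simp only [Ast]
    split_ifs with ha
    · exact ha.choose_spec.2.1
    · exact ⟨fun _ => ∅, fun _ => MeasurableSet.empty, by simp, by simp⟩
  set A1 := ⋂ a, Ast a with hA1
  have hA1m : MeasurableSet A1 := MeasurableSet.iInter hAst1
  have hA1t : Thin (P \ A1) := by
    rw [hA1, sdiff_iInter]
    exact Thin.iUnion hAst2
  have hA1T : ∀ a : Ia, (∃ A : Set (X × Y), MeasurableSet A ∧ Thin (P \ A) ∧ Term h A a.2) →
      Term h A1 a.2 := by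
    intro a ha
    have : Term h (Ast a) a.2 := by
      simp only [Ast, dif_pos ha]
      exact ha.choose_spec.2.2
    exact this.mono (iInter_subset _ a)
  have hB : ∀ a : Ia, Term h A1 a.2 → ∃ B : Set (X × Y), MeasurableSet B ∧
      (∀ x y y', (x, y) ∈ B → (x, y') ∈ B → y = y') ∧
      ∀ γ, Compat h A1 a.2 γ → h (γ (fun i => splitSeq a.1 i)) ∈ B := by
    intro a ha
    have hD : MeasurableSet {γ : (Fin a.1 → Bool) → (ℕ → ℕ) | Compat h A1 a.2 γ} := by
      have hγu : ∀ u, Measurable (fun γ : (Fin a.1 → Bool) → (ℕ → ℕ) => h (γ u)) :=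
        fun u => hm.comp (measurable_pi_apply u)
      simp only [Compat]
      refine MeasurableSet.inter ?_ (MeasurableSet.inter ?_ (MeasurableSet.inter ?_ ?_))
      · refine measurableSet_setOfPred.2 (Measurable.forall fun u => Measurable.forall fun i => ?_)
        refine measurableSet_setOfPred.1 ?_
        exact measurableSet_eq_fun ((measurable_pi_apply (i : ℕ)).comp (measurable_pi_apply u))
          measurable_const
      · refine measurableSet_setOfPred.2 (Measurable.forall fun u => Measurable.forall fun v => ?_)
        refine measurableSet_setOfPred.1 ?_
        exact measurableSet_eq_fun (measurable_fst.comp (hγu u)) (measurable_fst.comp (hγu v))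
      · refine measurableSet_setOfPred.2 (Measurable.forall fun u => ?_)
        exact measurableSet_setOfPred.1 (hγu u hA1m)
      · refine measurableSet_setOfPred.2 (Measurable.forall fun m => Measurable.forall fun u =>
          Measurable.forall fun v => Measurable.imp measurable_const ?_)
        refine measurableSet_setOfPred.1 ?_
        exact measurableSet_le measurable_const ((measurable_snd.comp (hγu u)).dist
          (measurable_snd.comp (hγu v)))
    obtain ⟨B, hB1, hB2, hB3⟩ := exists_borel_graph
      (f := fun γ : (Fin a.1 → Bool) → (ℕ → ℕ) => (h (γ (fun i => splitSeq a.1 i))).1)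
      (g := fun γ : (Fin a.1 → Bool) → (ℕ → ℕ) => (h (γ (fun i => splitSeq a.1 i))).2)
      (measurable_fst.comp (hm.comp (measurable_pi_apply _)))
      (measurable_snd.comp (hm.comp (measurable_pi_apply _))) hD
      (fun γ hγ γ' hγ' he => ha.single γ γ' hγ hγ' he)
    exact ⟨B, hB1, hB2, hB3⟩
  let Bf : Ia → Set (X × Y) := fun a => if ha : Term h A1 a.2 then (hB a ha).choose else ∅
  have hBf1 : ∀ a, MeasurableSet (Bf a) := by
    intro a
    simp only [Bf]
    split_ifs with ha
    · exact (hB a ha).choose_spec.1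
    · exact MeasurableSet.empty
  have hBf2 : ∀ a, Thin (Bf a) := by
    intro a
    refine Thin.of_graph (hBf1 a) ?_
    simp only [Bf]
    split_ifs with ha
    · exact (hB a ha).choose_spec.2.1
    · simp
  have hBf3 : ∀ a : Ia, Term h A1 a.2 → ∀ γ, Compat h A1 a.2 γ →
      h (γ (fun i => splitSeq a.1 i)) ∈ Bf a := by
    intro a ha
    simp only [Bf, dif_pos ha]
    exact (hB a ha).choose_spec.2.2
  set A2 := A1 \ ⋃ a, Bf a with hA2
  have hA2m : MeasurableSet A2 := hA1m.diff (MeasurableSet.iUnion hBf1)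
  have hA2t : Thin (P \ A2) := by
    have h1 := Thin.iUnion (ι := Bool) (P := fun b => if b then P \ A1 else ⋃ a, Bf a) (by
      intro b
      cases b
      · simpa using Thin.iUnion hBf2
      · simpa using hA1t)
    refine h1.mono ?_
    rintro p ⟨hp, hp2⟩
    by_cases h : p ∈ A1
    · refine mem_iUnion.2 ⟨false, ?_⟩
      by_contra h'
      exact hp2 ⟨h, by simpa using h'⟩
    · exact mem_iUnion.2 ⟨true, by simpa using ⟨hp, h⟩⟩
  have hA21 : A2 ⊆ A1 := sdiff_subset
  -- the base
  obtain ⟨p0, hp0, hp0A⟩ : ∃ p ∈ P, p ∈ A2 := by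
    by_contra hcon
    push Not at hcon
    refine hthin (hA2t.mono fun p hp => ⟨hp, hcon p hp⟩)
  rw [← hr] at hp0
  obtain ⟨z0, hz0⟩ := hp0
  have hnot : ∀ n (b : Ap n), (∃ γ, Compat h A2 b γ) → ¬ Term h A1 b := by
    rintro n b ⟨γ, hγ⟩ hb
    have h1 := hBf3 ⟨n, b⟩ hb γ ⟨hγ.1, hγ.2.1, fun u => hA21 (hγ.2.2.1 u), hγ.2.2.2⟩
    exact (hγ.2.2.1 (fun i => splitSeq n i)).2 (mem_iUnion.2 ⟨_, h1⟩)
  have hstep : ∀ n (a : {a : Ap n // ∃ γ, Compat h A2 a γ}),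
      ∃ b : {a : Ap (n + 1) // ∃ γ, Compat h A2 a γ}, ExtAp a.1 b.1 := by
    intro n a
    have h1 := hnot n a.1 a.2
    have h2 : ¬ Term h A2 a.1 := fun h3 => h1 (hA1T ⟨n, a.1⟩ ⟨A2, hA2m, hA2t, h3⟩)
    simp only [Term] at h2
    push Not at h2
    obtain ⟨b, hb, γ, hγ⟩ := h2
    exact ⟨⟨b, γ, hγ⟩, hb⟩
  choose nx hnx using hstep
  let a0 : {a : Ap 0 // ∃ γ, Compat h A2 a γ} :=
    ⟨(fun _ i => i.elim0, fun i => i.elim0), fun _ => z0, fun u i => i.elim0, fun _ _ => rfl,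
      fun _ => hz0 ▸ hp0A, fun m => m.elim0⟩
  let as : ∀ n, {a : Ap n // ∃ γ, Compat h A2 a γ} := fun n => Nat.rec a0 (fun n a => nx n a) n
  refine thin_aux_limit h hc (by rw [hr]; exact hcount) A2 (fun n => (as n).1)
    (fun n => hnx n (as n)) (fun n => (as n).2.choose) (fun n => (as n).2.choose_spec)

/-- Lusin–Novikov for countable Borel equivalence relations. -/
theorem exists_enum [MeasurableSpace X] [StandardBorelSpace X] {E : X → X → Prop} (hE : IsCBER E) :
    ∃ f : ℕ → X → X, (∀ n, Measurable (f n)) ∧ ∀ x y, E x y ↔ ∃ n, f n x = y := by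
  let _ := upgradeStandardBorel X
  let _ := TopologicalSpace.upgradeIsCompletelyMetrizable X
  obtain ⟨B, hB1, hB2, hB3⟩ := thin_of_countable hE.2.1 (P := {p : X × X | E p.1 p.2}) hE.2.2
  set Q : ℕ → Set (X × X) := fun n => B n ∩ {p : X × X | E p.1 p.2} with hQ
  have hQm : ∀ n, MeasurableSet (Q n) := fun n => (hB1 n).inter hE.2.1
  have hinj : ∀ n, InjOn Prod.fst (Q n) := by
    rintro n ⟨x, y⟩ hp ⟨x', y'⟩ hp' he
    simp only at he
    subst he
    rw [hB2 n x y y' hp.1 hp'.1]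
  have hD : ∀ n, MeasurableSet (Prod.fst '' Q n) := fun n =>
    (hQm n).image_of_measurable_injOn measurable_fst (hinj n)
  classical
  let f : ℕ → X → X := fun n x => if hx : ∃ y, (x, y) ∈ Q n then hx.choose else x
  have hf : ∀ n x y, (x, y) ∈ Q n → f n x = y := by
    intro n x y h
    have hx : ∃ y, (x, y) ∈ Q n := ⟨y, h⟩
    simp only [f, dif_pos hx]
    exact hB2 n x _ _ hx.choose_spec.1 h.1
  have hfE : ∀ n x, E x (f n x) := by
    intro n x
    by_cases hx : ∃ y, (x, y) ∈ Q n
    · simp only [f, dif_pos hx]; exact hx.choose_spec.2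
    · simp only [f, dif_neg hx]; exact hE.1.refl x
  refine ⟨f, fun n => ?_, fun x y => ⟨fun h => ?_, ?_⟩⟩
  · intro S hS
    have : f n ⁻¹' S = Prod.fst '' (Q n ∩ Prod.snd ⁻¹' S) ∪ ((Prod.fst '' Q n)ᶜ ∩ S) := by
      ext x
      by_cases hx : ∃ y, (x, y) ∈ Q n
      · obtain ⟨y, hy⟩ := hx
        simp only [mem_preimage, hf n x y hy]
        constructor
        · intro h; exact Or.inl ⟨(x, y), ⟨hy, h⟩, rfl⟩
        · rintro (⟨⟨x', y'⟩, ⟨h1, h2⟩, rfl⟩ | ⟨h1, h2⟩)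
          · have := hB2 n x' y y' hy.1 h1.1
            simp only [mem_preimage] at h2
            rwa [this]
          · exact absurd ⟨(x, y), hy, rfl⟩ h1
      · have : x ∉ Prod.fst '' Q n := by
          rintro ⟨⟨x', y'⟩, h, rfl⟩; exact hx ⟨y', h⟩
        have h2 : x ∉ Prod.fst '' (Q n ∩ Prod.snd ⁻¹' S) := by
          rintro ⟨⟨x', y'⟩, h, rfl⟩; exact hx ⟨y', h.1⟩
        simp only [mem_preimage, f, dif_neg hx, mem_union, mem_inter_iff, mem_compl_iff, this, h2]
        simp
    rw [this]
    refine MeasurableSet.union ?_ ((hD n).compl.inter hS)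
    exact ((hQm n).inter (measurable_snd hS)).image_of_measurable_injOn measurable_fst
      ((hinj n).mono inter_subset_left)
  · obtain ⟨n, hn⟩ := mem_iUnion.1 (hB3 (show (x, y) ∈ {p : X × X | E p.1 p.2} from h))
    exact ⟨n, hf n x y ⟨hn, h⟩⟩
  · rintro ⟨n, rfl⟩; exact hfE n x

end LN2
end CocycleNadkarni
end

section
set_option linter.unusedSectionVars false
set_option linter.style.haveILetI false
open MeasureTheory Set ENNReal
namespace CocycleNadkarni

section FM
variable {X : Type*}

theorem feldman_moore [MeasurableSpace X] [StandardBorelSpace X] {E : X → X → Prop}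
    (hE : IsCBER E) : ∃ G : ℕ → X ≃ᵐ X, ∀ x y, E x y ↔ ∃ n, G n x = y := by
  classical
  obtain ⟨f, hf, hfE⟩ := exists_enum hE
  let _ := upgradeStandardBorel X
  obtain ⟨S, hS, hsep⟩ := exists_seq_separating X (p := MeasurableSet) MeasurableSet.empty univ
  let S' : ℕ × Bool → Set X := fun k => if k.2 then S k.1 else (S k.1)ᶜ
  have hS' : ∀ k, MeasurableSet (S' k) := by
    intro k
    simp only [S']
    split_ifs
    · exact hS _
    · exact (hS _).compl
  let D : ℕ → ℕ → ℕ × Bool → Set X := fun m n k =>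
    {x | f m (f n x) = x} ∩ (S' k ∩ (f n) ⁻¹' (S' k)ᶜ)
  have hD : ∀ m n k, MeasurableSet (D m n k) := fun m n k =>
    (measurableSet_eq_fun ((hf m).comp (hf n)) measurable_id).inter
      ((hS' k).inter (hf n (hS' k).compl))
  let g : ℕ → ℕ → ℕ × Bool → X → X := fun m n k x =>
    if x ∈ D m n k then f n x else if f m x ∈ D m n k ∧ f n (f m x) = x then f m x else x
  have hg : ∀ m n k, Measurable (g m n k) := by
    intro m n k
    refine Measurable.ite (hD m n k) (hf n) (Measurable.ite ?_ (hf m) measurable_id)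
    exact (hf m (hD m n k)).inter (measurableSet_eq_fun ((hf n).comp (hf m)) measurable_id)
  have hinv : ∀ m n k, Function.Involutive (g m n k) := by
    intro m n k x
    by_cases hx : x ∈ D m n k
    · have h1 : g m n k x = f n x := if_pos hx
      have h2 : f n x ∉ D m n k := fun h => hx.2.2 h.2.1
      have h3 : f m (f n x) = x := hx.1
      rw [h1]
      simp only [g]
      rw [if_neg h2, if_pos ⟨by rw [h3]; exact hx, by rw [h3]⟩, h3]
    · by_cases hx2 : f m x ∈ D m n k ∧ f n (f m x) = x
      · have h1 : g m n k x = f m x := by simp only [g]; rw [if_neg hx, if_pos hx2]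
        rw [h1]
        simp only [g]
        rw [if_pos hx2.1, hx2.2]
      · have h1 : g m n k x = x := by simp only [g]; rw [if_neg hx, if_neg hx2]
        rw [h1, h1]
  let T : Option (ℕ × ℕ × (ℕ × Bool)) → X ≃ᵐ X := fun o => match o with
    | none => MeasurableEquiv.refl X
    | some p => MeasurableEquiv.ofInvolutive (g p.1 p.2.1 p.2.2) (hinv _ _ _) (hg _ _ _)
  obtain ⟨e, he⟩ := exists_surjective_nat (Option (ℕ × ℕ × (ℕ × Bool)))
  have hgE : ∀ m n k x, E x (g m n k x) := by
    intro m n k x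
    simp only [g]
    split_ifs
    · exact (hfE _ _).2 ⟨n, rfl⟩
    · exact (hfE _ _).2 ⟨m, rfl⟩
    · exact hE.1.refl x
  refine ⟨fun n => T (e n), fun x y => ⟨fun h => ?_, ?_⟩⟩
  · suffices ∃ o, T o x = y by
      obtain ⟨o, ho⟩ := this
      obtain ⟨n, rfl⟩ := he o
      exact ⟨n, ho⟩
    by_cases hxy : x = y
    · exact ⟨none, hxy⟩
    obtain ⟨n, hn⟩ := (hfE x y).1 h
    obtain ⟨m, hm⟩ := (hfE y x).1 (hE.1.symm h)
    have : ∃ k, x ∈ S' k ∧ y ∉ S' k := by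
      by_contra hcon
      push Not at hcon
      refine hxy (hsep x (mem_univ _) y (mem_univ _) fun k => ⟨fun h => ?_, fun h => ?_⟩)
      · simpa [S'] using hcon (k, true) (by simpa [S'] using h)
      · by_contra h'
        have := hcon (k, false) (by simpa [S'] using h')
        simp [S'] at this
        exact this h
    obtain ⟨k, hk1, hk2⟩ := this
    refine ⟨some (m, n, k), ?_⟩
    change g m n k x = y
    have hx : x ∈ D m n k := ⟨by simp only [mem_ofPred_eq]; rw [hn, hm], hk1, by simpa [hn] using hk2⟩
    simp only [g]
    rw [if_pos hx, hn]
  · rintro ⟨n, rfl⟩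
    change E x (T (e n) x)
    rcases e n with _ | p
    · exact hE.1.refl x
    · exact hgE _ _ _ x

end FM
end CocycleNadkarni
end

section
set_option linter.unusedSectionVars false
set_option linter.style.haveILetI false
open MeasureTheory Set ENNReal
namespace CocycleNadkarni

section SM
variable {X : Type*}

/-- sum of `f` over `Y` -/
noncomputable def sm (f : X → ℝ≥0∞) (Y : Set X) : ℝ≥0∞ := ∑' y : Y, f y

theorem sm_eq (f : X → ℝ≥0∞) (Y : Set X) : sm f Y = ∑' y, Y.indicator f y := tsum_subtype Y f

theorem sm_mono (f : X → ℝ≥0∞) {Y Z : Set X} (h : Y ⊆ Z) : sm f Y ≤ sm f Z :=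
  ENNReal.tsum_mono_subtype f h

theorem sm_le_sm {f g : X → ℝ≥0∞} {Y : Set X} (h : ∀ y ∈ Y, f y ≤ g y) : sm f Y ≤ sm g Y :=
  ENNReal.tsum_le_tsum fun y => h y y.2

theorem sm_congr {f g : X → ℝ≥0∞} {Y : Set X} (h : ∀ y ∈ Y, f y = g y) : sm f Y = sm g Y :=
  tsum_congr fun y => h y y.2

@[simp] theorem sm_empty (f : X → ℝ≥0∞) : sm f ∅ = 0 := by simp [sm]

theorem sm_union (f : X → ℝ≥0∞) {Y Z : Set X} (h : Disjoint Y Z) :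
    sm f (Y ∪ Z) = sm f Y + sm f Z :=
  ENNReal.summable.tsum_union_disjoint h ENNReal.summable

theorem sm_union_le (f : X → ℝ≥0∞) (Y Z : Set X) : sm f (Y ∪ Z) ≤ sm f Y + sm f Z :=
  ENNReal.tsum_union_le f Y Z

theorem sm_inter_add_diff (f : X → ℝ≥0∞) (Y Z : Set X) : sm f (Y ∩ Z) + sm f (Y \ Z) = sm f Y := by
  rw [← sm_union f (by
    rw [Set.disjoint_left]; intro x h1 h2; exact h2.2 h1.2), inter_union_sdiff]

@[simp] theorem sm_singleton (f : X → ℝ≥0∞) (x : X) : sm f {x} = f x := by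
  simp [sm]

theorem le_sm (f : X → ℝ≥0∞) {Y : Set X} {x : X} (h : x ∈ Y) : f x ≤ sm f Y := by
  rw [← sm_singleton f x]; exact sm_mono f (by simpa using h)

theorem sm_mul_right (f : X → ℝ≥0∞) (Y : Set X) (c : ℝ≥0∞) :
    sm (fun y => f y * c) Y = sm f Y * c := ENNReal.tsum_mul_right

theorem sm_mul_left (f : X → ℝ≥0∞) (Y : Set X) (c : ℝ≥0∞) :
    sm (fun y => c * f y) Y = c * sm f Y := ENNReal.tsum_mul_left

theorem sm_finset (f : X → ℝ≥0∞) (S : Finset X) : sm f S = ∑ y ∈ S, f y := by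
  rw [sm]; exact Finset.tsum_subtype S f

theorem sm_finite_lt {f : X → ℝ≥0∞} (hf : ∀ x, f x ≠ ⊤) {Y : Set X} (h : Y.Finite) :
    sm f Y < ⊤ := by
  lift Y to Finset X using h
  rw [sm_finset]
  exact ENNReal.sum_lt_top.2 fun x _ => (hf x).lt_top

theorem sm_le_of_finset {f : X → ℝ≥0∞} {Y : Set X} {c : ℝ≥0∞}
    (h : ∀ S : Finset X, (S : Set X) ⊆ Y → sm f S ≤ c) : sm f Y ≤ c := by
  rw [sm, ENNReal.tsum_eq_iSup_sum]
  refine iSup_le fun S => ?_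
  classical
  have := h (S.map (Function.Embedding.subtype _)) (by intro x hx; simp at hx; exact hx.1)
  rw [sm_finset] at this
  simpa using this

theorem sm_eq_fiber {ι : Type*} (f : X → ℝ≥0∞) (Y : Set X) (q : X → ι) :
    sm f Y = ∑' i, sm f (Y ∩ q ⁻¹' {i}) := by
  rw [sm_eq, ← ENNReal.tsum_fiberwise (Y.indicator f) q]
  refine tsum_congr fun i => ?_
  rw [sm_eq, tsum_subtype (q ⁻¹' {i}) (Y.indicator f)]
  refine tsum_congr fun x => ?_
  rw [indicator_indicator, inter_comm]

theorem sm_iUnion {ι : Type*} (f : X → ℝ≥0∞) {Y : ι → Set X}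
    (h : Pairwise (Function.onFun Disjoint Y)) : sm f (⋃ i, Y i) = ∑' i, sm f (Y i) :=
  ENNReal.tsum_biUnion fun _ _ _ _ hij => h hij

/-- comparing sums piecewise -/
theorem sm_piece {F : X → X → Prop} (hF : Equivalence F) {f g : X → ℝ≥0∞} {Y : Set X}
    (hY : ∀ x y, F x y → x ∈ Y → y ∈ Y)
    (h : ∀ y ∈ Y, sm f {z | F z y} ≤ sm g {z | F z y}) : sm f Y ≤ sm g Y := by
  let st : Setoid X := ⟨F, hF⟩
  rw [sm_eq_fiber f Y (Quotient.mk st), sm_eq_fiber g Y (Quotient.mk st)]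
  refine ENNReal.tsum_le_tsum fun i => ?_
  by_cases hi : (Y ∩ Quotient.mk st ⁻¹' {i}).Nonempty
  · obtain ⟨y, hy, hyi⟩ := hi
    have : Y ∩ Quotient.mk st ⁻¹' {i} = {z | F z y} := by
      ext z
      simp only [mem_preimage, mem_singleton_iff] at hyi
      simp only [mem_inter_iff, mem_preimage, mem_singleton_iff, ← hyi, mem_ofPred_eq]
      constructor
      · rintro ⟨_, h⟩; exact Quotient.exact h
      · intro h; exact ⟨hY _ _ (hF.symm h) hy, Quotient.sound h⟩
    rw [this]
    exact h y hy
  · rw [not_nonempty_iff_eq_empty.1 hi]; simp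

theorem sm_piece_lt {F : X → X → Prop} (hF : Equivalence F) {f g : X → ℝ≥0∞} {Y : Set X}
    (hY : ∀ x y, F x y → x ∈ Y → y ∈ Y) (hfin : sm f Y ≠ ⊤)
    (h : ∀ y ∈ Y, sm f {z | F z y} ≤ sm g {z | F z y})
    (y : X) (hy : y ∈ Y) (hlt : sm f {z | F z y} < sm g {z | F z y}) : sm f Y < sm g Y := by
  rw [← sm_inter_add_diff f Y {z | F z y}, ← sm_inter_add_diff g Y {z | F z y}]
  have h1 : Y ∩ {z | F z y} = {z | F z y} :=
    inter_eq_right.2 fun z hz => hY _ _ (hF.symm hz) hy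
  rw [h1]
  refine ENNReal.add_lt_add_of_lt_of_le ?_ hlt (sm_piece hF ?_ ?_)
  · exact ne_top_of_le_ne_top hfin (sm_mono f sdiff_subset)
  · rintro a b hab ⟨ha, ha'⟩
    exact ⟨hY _ _ hab ha, fun hb => ha' (hF.trans hab hb)⟩
  · intro z hz; exact h z hz.1

end SM

/-- a bundled setup -/
structure Sys (X : Type*) [MeasurableSpace X] where
  E : X → X → Prop
  ρ : X → X → ℝ
  hE : IsCBER E
  hρ : IsCocycle E ρ
  G : ℕ → X ≃ᵐ X
  hG : ∀ x y, E x y ↔ ∃ n, G n x = y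
  r : X → ℝ
  hr : Measurable r
  hri : Function.Injective r

namespace Sys
variable {X : Type*} [MeasurableSpace X] (s : Sys X)

theorem refl (x : X) : s.E x x := s.hE.1.refl x
theorem symm {x y : X} (h : s.E x y) : s.E y x := s.hE.1.symm h
theorem trans {x y z : X} (h : s.E x y) (h' : s.E y z) : s.E x z := s.hE.1.trans h h'
theorem EG (n : ℕ) (x : X) : s.E x (s.G n x) := (s.hG _ _).2 ⟨n, rfl⟩

/-- weight -/
noncomputable def w (z y : X) : ℝ≥0∞ := ENNReal.ofReal (s.ρ y z)

/-- size -/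
noncomputable abbrev sz (Y : Set X) (z : X) : ℝ≥0∞ := sm (s.w z) Y

theorem sz_eq (Y : Set X) (z : X) : eSize s.ρ Y z = s.sz Y z := rfl

theorem w_ne_top (z y : X) : s.w z y ≠ ⊤ := ENNReal.ofReal_ne_top

theorem w_pos {z y : X} (h : s.E z y) : 0 < s.w z y :=
  ENNReal.ofReal_pos.2 (s.hρ.2.1 (s.symm h))

theorem w_mul {x y z : X} (h : s.E x y) (h' : s.E y z) : s.w z x = s.w y x * s.w z y := by
  rw [w, s.hρ.2.2 h h', ENNReal.ofReal_mul (s.hρ.2.1 h).le]; rfl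

theorem rho_self (x : X) : s.ρ x x = 1 := by
  have h := s.hρ.2.2 (s.refl x) (s.refl x)
  have h2 := s.hρ.2.1 (s.refl x)
  nlinarith [mul_pos h2 h2]

@[simp] theorem w_self (x : X) : s.w x x = 1 := by simp [w, rho_self]

theorem sz_base {Y : Set X} {z z' : X} (hY : ∀ y ∈ Y, s.E z y) (h : s.E z z') :
    s.sz Y z' = s.sz Y z * s.w z' z := by
  rw [sz, sz, ← sm_mul_right]
  exact sm_congr fun y hy => s.w_mul (s.symm (hY y hy)) h

theorem sz_pos {Y : Set X} {z y : X} (hy : y ∈ Y) (h : s.E z y) : 0 < s.sz Y z :=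
  (s.w_pos h).trans_le (le_sm _ hy)

theorem sz_lt_top {Y : Set X} (z : X) (h : Y.Finite) : s.sz Y z < ⊤ :=
  sm_finite_lt (s.w_ne_top z) h

theorem sz_le_base {a b : ℝ≥0∞} {Y Y' : Set X} {z z' : X} (hY : ∀ y ∈ Y, s.E z y)
    (hY' : ∀ y ∈ Y', s.E z y) (h : s.E z z') :
    a * s.sz Y z' ≤ b * s.sz Y' z' ↔ a * s.sz Y z ≤ b * s.sz Y' z := by
  rw [s.sz_base hY h, s.sz_base hY' h, ← mul_assoc, ← mul_assoc]
  exact ENNReal.mul_le_mul_iff_left (s.w_pos (s.symm h)).ne' (s.w_ne_top _ _)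

theorem sz_le_base1 {Y Y' : Set X} {z z' : X} (hY : ∀ y ∈ Y, s.E z y)
    (hY' : ∀ y ∈ Y', s.E z y) (h : s.E z z') :
    s.sz Y z' ≤ s.sz Y' z' ↔ s.sz Y z ≤ s.sz Y' z := by
  simpa using s.sz_le_base (a := 1) (b := 1) hY hY' h

theorem sz_lt_base1 {Y Y' : Set X} {z z' : X} (hY : ∀ y ∈ Y, s.E z y)
    (hY' : ∀ y ∈ Y', s.E z y) (h : s.E z z') :
    s.sz Y z' < s.sz Y' z' ↔ s.sz Y z < s.sz Y' z := by
  rw [← not_le, ← not_le, s.sz_le_base1 hY' hY h]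

/-! measurability -/
variable {Z : Type*} [MeasurableSpace Z]

theorem meas_E {a b : Z → X} (ha : Measurable a) (hb : Measurable b) :
    Measurable fun z => s.E (a z) (b z) :=
  measurableSet_setOfPred.1 ((ha.prodMk hb) s.hE.2.1)

theorem meas_w {a b : Z → X} (ha : Measurable a) (hb : Measurable b) :
    Measurable fun z => s.w (a z) (b z) :=
  (s.hρ.1.comp (hb.prodMk ha)).ennreal_ofReal

theorem meas_ex {b : Z → X} (hb : Measurable b) {P : Z → X → Prop}
    (hP : Measurable fun p : Z × X => P p.1 p.2) : Measurable fun z => ∃ y, s.E (b z) y ∧ P z y := by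
  have : (fun z => ∃ y, s.E (b z) y ∧ P z y) = fun z => ∃ n, P z (s.G n (b z)) := by
    funext z
    refine propext ⟨?_, ?_⟩
    · rintro ⟨y, h, h'⟩
      obtain ⟨n, rfl⟩ := (s.hG _ _).1 h
      exact ⟨n, h'⟩
    · rintro ⟨n, h⟩; exact ⟨_, s.EG n _, h⟩
  rw [this]
  exact Measurable.exists fun n => hP.comp (measurable_id.prodMk ((s.G n).measurable.comp hb))

theorem meas_all {b : Z → X} (hb : Measurable b) {P : Z → X → Prop}
    (hP : Measurable fun p : Z × X => P p.1 p.2) : Measurable fun z => ∀ y, s.E (b z) y → P z y := by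
  have := (s.meas_ex hb (P := fun z y => ¬ P z y) hP.not).not
  convert this using 2 with z
  push Not; rfl

theorem sm_class (f : X → ℝ≥0∞) (x : X) [DecidableEq X] : sm f {y | s.E x y} =
    ∑' n, if (∀ m < n, s.G m x ≠ s.G n x) then f (s.G n x) else 0 := by
  have h1 : (fun n => if (∀ m < n, s.G m x ≠ s.G n x) then f (s.G n x) else 0) =
      {n | ∀ m < n, s.G m x ≠ s.G n x}.indicator (fun n => f (s.G n x)) := by
    funext n; simp [indicator]
  rw [h1, ← tsum_subtype]
  let e : {n | ∀ m < n, s.G m x ≠ s.G n x} → {y | s.E x y} := fun n => ⟨s.G n x, s.EG _ _⟩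
  have he : Function.Bijective e := by
    constructor
    · rintro ⟨n, hn⟩ ⟨m, hm⟩ h
      have h' : s.G n x = s.G m x := congrArg Subtype.val h
      rcases lt_trichotomy n m with h1 | h1 | h1
      · exact absurd h' (hm n h1)
      · exact Subtype.ext h1
      · exact absurd h'.symm (hn m h1)
    · rintro ⟨y, hy⟩
      have hex : ∃ n, s.G n x = y := (s.hG _ _).1 hy
      classical
      refine ⟨⟨Nat.find hex, fun m hm h => Nat.find_min hex hm (h.trans (Nat.find_spec hex))⟩, ?_⟩
      exact Subtype.ext (Nat.find_spec hex)
  rw [sm, ← (Equiv.ofBijective e he).tsum_eq]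
  rfl

theorem meas_sm [MeasurableEq X] {b : Z → X} (hb : Measurable b) {f : Z → X → ℝ≥0∞}
    (hf : Measurable fun p : Z × X => f p.1 p.2) :
    Measurable fun z => sm (f z) {y | s.E (b z) y} := by
  classical
  simp_rw [s.sm_class]
  refine Measurable.tsum fun n => Measurable.ite ?_ ?_ measurable_const
  · refine measurableSet_setOfPred.2 (Measurable.forall fun m => Measurable.forall fun _ => ?_)
    refine Measurable.not (measurableSet_setOfPred.1 ?_)
    exact measurableSet_eq_fun ((s.G m).measurable.comp hb) ((s.G n).measurable.comp hb)
  · exact hf.comp (measurable_id.prodMk ((s.G n).measurable.comp hb))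

theorem meas_sz [MeasurableEq X] {b c : Z → X} (hb : Measurable b) (hc : Measurable c)
    {P : Z → X → Prop}
    (hP : Measurable fun p : Z × X => P p.1 p.2) (hE : ∀ z y, P z y → s.E (b z) y) :
    Measurable fun z => s.sz {y | P z y} (c z) := by
  classical
  have : (fun z => s.sz {y | P z y} (c z)) =
      fun z => sm (fun y => if P z y then s.w (c z) y else 0) {y | s.E (b z) y} := by
    funext z
    rw [sz, sm_eq, sm_eq]
    refine tsum_congr fun y => ?_
    by_cases h : P z y
    · simp [indicator, h, hE z y h]
    · simp [indicator, h]
  rw [this]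
  refine s.meas_sm hb (Measurable.ite (measurableSet_setOfPred.2 hP) ?_ measurable_const)
  exact s.meas_w (hc.comp measurable_fst) measurable_snd

open Classical in
/-- selection -/
noncomputable def sel (R : X → X → Prop) (x : X) : X :=
  if h : ∃ n, R x (s.G n x) then s.G (Nat.find h) x else x

theorem sel_E (R : X → X → Prop) (x : X) : s.E x (s.sel R x) := by
  unfold sel
  split_ifs with h
  · exact s.EG _ _
  · exact s.refl _

theorem sel_spec {R : X → X → Prop} {x : X} (h : ∃ y, s.E x y ∧ R x y) : R x (s.sel R x) := by
  have h' : ∃ n, R x (s.G n x) := by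
    obtain ⟨y, hy, hR⟩ := h
    obtain ⟨n, rfl⟩ := (s.hG _ _).1 hy
    exact ⟨n, hR⟩
  classical
  unfold sel
  rw [dif_pos h']
  exact Nat.find_spec h'

theorem sel_neg {R : X → X → Prop} {x : X} (h : ¬ ∃ y, s.E x y ∧ R x y) : s.sel R x = x := by
  have h' : ¬ ∃ n, R x (s.G n x) := fun ⟨n, hn⟩ => h ⟨_, s.EG n x, hn⟩
  unfold sel
  rw [dif_neg h']

theorem sel_meas {R : X → X → Prop} (hR : Measurable fun p : X × X => R p.1 p.2) :
    Measurable (s.sel R) := by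
  classical
  have hRn : ∀ n, MeasurableSet {x | R x (s.G n x)} := fun n =>
    measurableSet_setOfPred.2 (hR.comp (measurable_id.prodMk (s.G n).measurable))
  let D : ℕ → Set X := fun n => {x | R x (s.G n x)} ∩ ⋂ m ∈ Finset.range n, {x | R x (s.G m x)}ᶜ
  have hD : ∀ n, MeasurableSet (D n) := fun n => (hRn n).inter
    (Finset.measurableSet_biInter _ fun m _ => (hRn m).compl)
  have hDs : ∀ n x, x ∈ D n → s.sel R x = s.G n x := by
    intro n x hx
    have h : ∃ n, R x (s.G n x) := ⟨n, hx.1⟩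
    unfold sel
    rw [dif_pos h]
    congr 2
    rw [Nat.find_eq_iff]
    refine ⟨hx.1, fun m hm => ?_⟩
    have := hx.2
    simp only [mem_iInter] at this
    exact this m (by simpa using hm)
  have hcov : ∀ x, (∃ n, x ∈ D n) ∨ s.sel R x = x ∧ ∀ n, ¬ R x (s.G n x) := by
    intro x
    by_cases h : ∃ n, R x (s.G n x)
    · left
      refine ⟨Nat.find h, Nat.find_spec h, ?_⟩
      simp only [mem_iInter]
      intro m hm
      exact Nat.find_min h (by simpa using hm)
    · right
      refine ⟨by unfold sel; rw [dif_neg h], by push Not at h; exact h⟩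
  intro B hB
  have : s.sel R ⁻¹' B = (⋃ n, D n ∩ (s.G n) ⁻¹' B) ∪ ((⋃ n, D n)ᶜ ∩ B) := by
    ext x
    rcases hcov x with ⟨n, hn⟩ | ⟨h, h'⟩
    · simp only [mem_preimage, mem_union, mem_iUnion, mem_inter_iff, mem_compl_iff]
      constructor
      · intro hx; exact Or.inl ⟨n, hn, by rwa [← hDs n x hn]⟩
      · rintro (⟨m, hm, hx⟩ | ⟨hx, _⟩)
        · rwa [hDs m x hm]
        · exact absurd ⟨n, hn⟩ hx
    · have h2 : ∀ n, x ∉ D n := fun n hn => h' n hn.1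
      simp [h, h2]
  rw [this]
  exact (MeasurableSet.iUnion fun n => (hD n).inter ((s.G n).measurable hB)).union
    ((MeasurableSet.iUnion hD).compl.inter hB)

end Sys
end CocycleNadkarni
end

section
set_option linter.unusedSectionVars false
set_option linter.style.haveILetI false
open MeasureTheory Set ENNReal
namespace CocycleNadkarni
namespace Sys
variable {X : Type*} [MeasurableSpace X] [StandardBorelSpace X] (s : Sys X)

theorem fself {F : X → X → Prop} (hF : IsFinSubequiv s.E F) (x : X) : x ∈ {y | F y x} :=
  hF.1.refl x
theorem fE {F : X → X → Prop} (hF : IsFinSubequiv s.E F) (x : X) : ∀ y ∈ {y | F y x}, s.E x y :=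
  fun _ hy => s.symm (hF.2.2.1 hy)
theorem ffin {F : X → X → Prop} (hF : IsFinSubequiv s.E F) (x : X) : {y | F y x}.Finite :=
  (hF.2.2.2 x).subset fun _ hy => hF.1.symm hy
theorem fpos {F : X → X → Prop} (hF : IsFinSubequiv s.E F) (x : X) : s.sz {y | F y x} x ≠ 0 :=
  (s.sz_pos (s.fself hF x) (s.refl x)).ne'
theorem fpos2 {F : X → X → Prop} (hF : IsFinSubequiv s.E F) {x z : X} (h : s.E z x) :
    s.sz {y | F y x} z ≠ 0 :=
  (s.sz_pos (s.fself hF x) h).ne'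
theorem ftop {F : X → X → Prop} (hF : IsFinSubequiv s.E F) (x z : X) : s.sz {y | F y x} z ≠ ⊤ :=
  (s.sz_lt_top z (s.ffin hF x)).ne
theorem feq {F : X → X → Prop} (hF : IsFinSubequiv s.E F) {x y : X} (h : F x y) :
    {z | F z x} = {z | F z y} :=
  Set.ext fun _ => ⟨fun hz => hF.1.trans hz h, fun hz => hF.1.trans hz (hF.1.symm h)⟩
theorem fmeas {Z : Type*} [MeasurableSpace Z] {F : X → X → Prop} (hF : IsFinSubequiv s.E F)
    {a b : Z → X} (ha : Measurable a) (hb : Measurable b) : Measurable fun z => F (a z) (b z) :=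
  measurableSet_setOfPred.1 ((ha.prodMk hb) hF.2.1)
theorem fszm {F : X → X → Prop} (hF : IsFinSubequiv s.E F) :
    Measurable fun x => s.sz {y | F y x} x :=
  s.meas_sz measurable_id measurable_id (s.fmeas hF measurable_snd measurable_fst)
    fun _ _ h => s.symm (hF.2.2.1 h)

/-- `C` is compressible -/
def Comp (C : Set X) : Prop :=
  MeasurableSet C ∧ EInvariant s.E C ∧ ∃ (φ : X → X) (F : X → X → Prop), Measurable φ ∧
    IsFinSubequiv s.E F ∧ (∀ x, s.E x (φ x)) ∧ ∀ x ∈ C, (φ ⁻¹' {x}).Finite ∧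
      s.sz (φ ⁻¹' {y | F y x}) x ≤ s.sz {y | F y x} x ∧
      ∃ y, s.E x y ∧ s.sz (φ ⁻¹' {z | F z y}) y < s.sz {z | F z y} y

variable {s}
theorem Comp.mono {C D : Set X} (h : s.Comp C) (hD : MeasurableSet D) (hDi : EInvariant s.E D)
    (hDC : D ⊆ C) : s.Comp D := by
  obtain ⟨h1, h2, φ, F, h3, h4, h5, h6⟩ := h
  exact ⟨hD, hDi, φ, F, h3, h4, h5, fun x hx => h6 x (hDC hx)⟩

theorem Comp.iUnion {C : ℕ → Set X} (h : ∀ n, s.Comp (C n)) : s.Comp (⋃ n, C n) := by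
  classical
  choose hm hi φ F hφ hF hφE hC using h
  have hU : MeasurableSet (⋃ n, C n) := MeasurableSet.iUnion hm
  have hUi : EInvariant s.E (⋃ n, C n) := by
    intro x y hxy hx
    obtain ⟨n, hn⟩ := mem_iUnion.1 hx
    exact mem_iUnion.2 ⟨n, hi n hxy hn⟩
  have hex : ∀ x, ∃ n, x ∈ C n ∨ x ∉ ⋃ n, C n := by
    intro x
    by_cases hx : x ∈ ⋃ n, C n
    · obtain ⟨n, hn⟩ := mem_iUnion.1 hx
      exact ⟨n, Or.inl hn⟩
    · exact ⟨0, Or.inr hx⟩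
  let N : X → ℕ := fun x => Nat.find (hex x)
  have hpm : ∀ n, MeasurableSet {x | x ∈ C n ∨ x ∉ ⋃ n, C n} := fun n => (hm n).union hU.compl
  have hNm : Measurable N := measurable_find hex hpm
  have hNE : ∀ x y, s.E x y → N x = N y := by
    intro x y hxy
    have : ∀ n, (x ∈ C n ∨ x ∉ ⋃ n, C n) ↔ (y ∈ C n ∨ y ∉ ⋃ n, C n) := by
      intro n
      have a : x ∈ C n ↔ y ∈ C n := ⟨fun h => hi n hxy h, fun h => hi n (s.symm hxy) h⟩
      have b : x ∈ (⋃ n, C n) ↔ y ∈ (⋃ n, C n) := ⟨fun h => hUi hxy h, fun h => hUi (s.symm hxy) h⟩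
      rw [a, b]
    simp only [N]
    exact Nat.find_congr' (@fun n => this n)
  have hNC : ∀ x ∈ ⋃ n, C n, x ∈ C (N x) := by
    intro x hx
    rcases Nat.find_spec (hex x) with h | h
    · exact h
    · exact absurd hx h
  have hpre : ∀ x (S : Set X), (∀ y ∈ S, s.E x y) →
      (fun x => φ (N x) x) ⁻¹' S = φ (N x) ⁻¹' S := by
    intro x S hS
    ext y
    simp only [mem_preimage]
    constructor
    · intro h
      have := hNE x y (s.trans (hS _ h) (s.symm (hφE _ y)))
      rwa [this]
    · intro h
      have := hNE x y (s.trans (hS _ h) (s.symm (hφE _ y)))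
      rwa [← this]
  have hcl : ∀ x, {y | F (N y) y x} = {y | F (N x) y x} := by
    intro x
    ext y
    simp only [mem_ofPred_eq]
    constructor
    · intro h; rwa [← hNE y x ((hF _).2.2.1 h)]
    · intro h; rwa [hNE y x ((hF _).2.2.1 h)]
  refine ⟨hU, hUi, fun x => φ (N x) x, fun x y => F (N x) x y, ?_, ⟨⟨?_, ?_, ?_⟩, ?_, ?_, ?_⟩, ?_, ?_⟩
  · exact Measurable.find hφ hpm hex
  · exact fun x => (hF _).1.refl x
  · intro x y h
    rw [← hNE x y ((hF _).2.2.1 h)]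
    exact (hF _).1.symm h
  · intro x y z h h'
    rw [← hNE x y ((hF _).2.2.1 h)] at h'
    exact (hF _).1.trans h h'
  · have : {p : X × X | F (N p.1) p.1 p.2} =
        ⋃ n, ((N ∘ Prod.fst) ⁻¹' {n} ∩ {p : X × X | F n p.1 p.2}) := by
      ext p
      simp
    rw [this]
    exact MeasurableSet.iUnion fun n => ((hNm.comp measurable_fst) (measurableSet_singleton n)).inter
      (hF n).2.1
  · intro x y h; exact (hF _).2.2.1 h
  · intro x; exact (hF _).2.2.2 x
  · intro x; exact hφE _ x
  · intro x hx
    obtain ⟨h1, h2, y, hxy, h3⟩ := hC (N x) x (hNC x hx)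
    refine ⟨?_, ?_, y, hxy, ?_⟩
    · rw [hpre x {x} (by simp [s.refl])]; exact h1
    · rw [hcl, hpre x _ (s.fE (hF _) x)]; exact h2
    · rw [hcl, hpre y _ (s.fE (hF _) y), ← hNE x y hxy]; exact h3

theorem Comp.union {C D : Set X} (h : s.Comp C) (h' : s.Comp D) : s.Comp (C ∪ D) := by
  have := Comp.iUnion (s := s) (C := fun n => if n = 0 then C else D) (by
    intro n; split_ifs <;> assumption)
  convert this using 1
  ext x
  simp only [mem_union, mem_iUnion]
  constructor
  · rintro (h | h)
    · exact ⟨0, by simpa⟩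
    · exact ⟨1, by simpa⟩
  · rintro ⟨n, hn⟩
    split_ifs at hn
    · exact Or.inl hn
    · exact Or.inr hn

theorem Comp.compression (h : s.Comp univ) : ∃ φ : X → X, Measurable φ ∧
    (∀ x : X, (φ ⁻¹' {x}).Finite) ∧
    ∃ F : X → X → Prop, IsFinSubequiv s.E F ∧ CompressionOver s.E F s.ρ φ := by
  obtain ⟨-, -, φ, F, h3, h4, h5, h6⟩ := h
  have hpos : ∀ x, s.sz {y | F y x} x ≠ 0 := s.fpos h4
  have hfin : ∀ x, s.sz {y | F y x} x ≠ ⊤ := fun x => s.ftop h4 x x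
  refine ⟨φ, h3, fun x => (h6 x (mem_univ _)).1, F, h4, h5, fun x => ?_, fun x => ?_⟩
  · unfold relSize
    rw [sz_eq, sz_eq, ENNReal.div_le_iff (hpos x) (hfin x), one_mul]
    exact (h6 x (mem_univ _)).2.1
  · obtain ⟨y, hy, hlt⟩ := (h6 x (mem_univ _)).2.2
    refine ⟨y, hy, ?_⟩
    unfold relSize
    rw [sz_eq, sz_eq, ENNReal.div_lt_iff (Or.inl (hpos y)) (Or.inl (hfin y)), one_mul]
    exact hlt

variable (s)

theorem lint_G {μ : Measure X} (hμ : IsInvariant s.E s.ρ μ) (n : ℕ) {g : X → ℝ≥0∞}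
    (hg : Measurable g) : ∫⁻ x, g (s.G n x) * s.w x (s.G n x) ∂μ = ∫⁻ x, g x ∂μ := by
  have hw : Measurable fun x => s.w x (s.G n x) := s.meas_w measurable_id (s.G n).measurable
  have h1 : (μ.withDensity (fun x => s.w x (s.G n x))).map (s.G n) = μ := by
    ext B hB
    rw [Measure.map_apply (s.G n).measurable hB, withDensity_apply _ ((s.G n).measurable hB)]
    have := hμ (s.G n) (fun x => s.symm (s.EG n x)) _ ((s.G n).measurable hB)
    rw [image_preimage_eq _ (s.G n).surjective] at this
    exact this.symm
  conv_rhs => rw [← h1]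
  rw [lintegral_map hg (s.G n).measurable]
  change _ = ∫⁻ x, (g ∘ s.G n) x ∂_
  rw [lintegral_withDensity_eq_lintegral_mul _ hw (hg.comp (s.G n).measurable)]
  refine lintegral_congr fun x => ?_
  simp [mul_comm]

theorem sm_class_inv (f : X → ℝ≥0∞) (y : X) [DecidableEq X] : sm f {x | s.E x y} =
    ∑' n, if (∀ m < n, s.G m ((s.G n).symm y) ≠ y) then f ((s.G n).symm y) else 0 := by
  have h1 : (fun n => if (∀ m < n, s.G m ((s.G n).symm y) ≠ y) then f ((s.G n).symm y) else 0) =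
      {n | ∀ m < n, s.G m ((s.G n).symm y) ≠ y}.indicator (fun n => f ((s.G n).symm y)) := by
    funext n; simp [indicator]
  rw [h1, ← tsum_subtype]
  let e : {n | ∀ m < n, s.G m ((s.G n).symm y) ≠ y} → {x | s.E x y} := fun n =>
    ⟨(s.G n).symm y, (s.hG _ _).2 ⟨n, by simp⟩⟩
  have he : Function.Bijective e := by
    constructor
    · rintro ⟨n, hn⟩ ⟨m, hm⟩ h
      have h' : (s.G n).symm y = (s.G m).symm y := congrArg Subtype.val h
      rcases lt_trichotomy n m with h1 | h1 | h1
      · exact absurd (by rw [← h']; simp) (hm n h1)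
      · exact Subtype.ext h1
      · exact absurd (by rw [h']; simp) (hn m h1)
    · rintro ⟨x, hx⟩
      have hex : ∃ n, s.G n x = y := (s.hG _ _).1 hx
      classical
      have hsp := Nat.find_spec hex
      have hsy : (s.G (Nat.find hex)).symm y = x := by
        rw [MeasurableEquiv.symm_apply_eq]; exact hsp.symm
      refine ⟨⟨Nat.find hex, fun m hm h => Nat.find_min hex hm (by rwa [hsy] at h)⟩, ?_⟩
      exact Subtype.ext hsy
  rw [sm, ← (Equiv.ofBijective e he).tsum_eq]
  rfl

theorem mass_transport {μ : Measure X} (hμ : IsInvariant s.E s.ρ μ) {f : X → X → ℝ≥0∞}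
    (hf : Measurable fun p : X × X => f p.1 p.2) :
    ∫⁻ x, sm (fun y => f x y * s.w x y) {y | s.E x y} ∂μ =
      ∫⁻ y, sm (fun x => f x y) {x | s.E x y} ∂μ := by
  classical
  simp_rw [s.sm_class, s.sm_class_inv]
  have hm : ∀ n, MeasurableSet {x | ∀ m < n, s.G m x ≠ s.G n x} := by
    intro n
    refine measurableSet_setOfPred.2 (Measurable.forall fun m => Measurable.forall fun _ => ?_)
    refine Measurable.not (measurableSet_setOfPred.1 ?_)
    exact measurableSet_eq_fun ((s.G m).measurable) ((s.G n).measurable)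
  have hm2 : ∀ n, MeasurableSet {y | ∀ m < n, s.G m ((s.G n).symm y) ≠ y} := by
    intro n
    refine measurableSet_setOfPred.2 (Measurable.forall fun m => Measurable.forall fun _ => ?_)
    refine Measurable.not (measurableSet_setOfPred.1 ?_)
    exact measurableSet_eq_fun ((s.G m).measurable.comp (s.G n).symm.measurable) measurable_id
  have hg : ∀ n, Measurable (fun y => if (∀ m < n, s.G m ((s.G n).symm y) ≠ y) then
      f ((s.G n).symm y) y else 0) := fun n => Measurable.ite (hm2 n)
        (hf.comp ((s.G n).symm.measurable.prodMk measurable_id)) measurable_const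
  rw [lintegral_tsum, lintegral_tsum]
  · refine tsum_congr fun n => ?_
    rw [← s.lint_G hμ n (hg n)]
    refine lintegral_congr fun x => ?_
    simp only [MeasurableEquiv.symm_apply_apply, ite_mul, zero_mul]
  · exact fun n => (hg n).aemeasurable
  · intro n
    refine (Measurable.ite (hm n) ?_ measurable_const).aemeasurable
    exact (hf.comp (measurable_id.prodMk (s.G n).measurable)).mul
      (s.meas_w measurable_id (s.G n).measurable)

theorem not_both {φ : X → X} (hφ : Measurable φ) {F : X → X → Prop}
    (hF : IsFinSubequiv s.E F) (hc : CompressionOver s.E F s.ρ φ)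
    {μ : Measure X} [IsProbabilityMeasure μ] (hμ : IsInvariant s.E s.ρ μ) : False := by
  classical
  obtain ⟨h1, h2, h3⟩ := hc
  have hpos : ∀ x, s.sz {y | F y x} x ≠ 0 := s.fpos hF
  have hfin : ∀ x, s.sz {y | F y x} x ≠ ⊤ := fun x => s.ftop hF x x
  have hsm := s.fszm hF
  let f : X → X → ℝ≥0∞ := fun x y => if F (φ y) x then (s.sz {z | F z x} x)⁻¹ else 0
  have hf : Measurable fun p : X × X => f p.1 p.2 := Measurable.ite
    (measurableSet_setOfPred.2 (s.fmeas hF (hφ.comp measurable_snd) measurable_fst))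
    (hsm.comp measurable_fst).inv measurable_const
  have hmt := s.mass_transport hμ hf
  have hL : ∀ x, sm (fun y => f x y * s.w x y) {y | s.E x y} =
      relSize s.ρ (φ ⁻¹' {y | F y x}) {y | F y x} x := by
    intro x
    rw [relSize, sz_eq, sz_eq, sz, div_eq_mul_inv, ← sm_mul_right, sm_eq, sm_eq]
    refine tsum_congr fun y => ?_
    by_cases h : F (φ y) x
    · have : s.E x y := s.trans (s.symm (hF.2.2.1 h)) (s.symm (h1 y))
      simp [indicator, h, this, f, mul_comm]
    · simp [indicator, h, f]
  have hR : ∀ y, sm (fun x => f x y) {x | s.E x y} = 1 := by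
    intro y
    have : sm (fun x => f x y) {x | s.E x y} =
        sm (fun x => s.w (φ y) x * (s.sz {z | F z (φ y)} (φ y))⁻¹) {x | F x (φ y)} := by
      rw [sm_eq, sm_eq]
      refine tsum_congr fun x => ?_
      by_cases h : F (φ y) x
      · have hE' : s.E (φ y) x := hF.2.2.1 h
        have hE : s.E x y := s.trans (s.symm hE') (s.symm (h1 y))
        have h' := hF.1.symm h
        simp only [indicator, mem_ofPred_eq, hE, h', if_true, f, h]
        rw [s.feq hF h', s.sz_base (z := φ y) (z' := x) (s.fE hF _) hE',
          ENNReal.mul_inv (Or.inl (hpos _)) (Or.inl (hfin _)), mul_comm]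
        congr 1
        symm
        refine ENNReal.eq_inv_of_mul_eq_one_left ?_
        rw [← s.w_mul (s.symm hE') hE', s.w_self]
      · have : ¬ F x (φ y) := fun h' => h (hF.1.symm h')
        simp [indicator, h, f, this]
    rw [this, sm_mul_right]
    exact ENNReal.mul_inv_cancel (hpos _) (hfin _)
  simp_rw [hL, hR] at hmt
  have hWm : Measurable fun x => relSize s.ρ (φ ⁻¹' {y | F y x}) {y | F y x} x := by
    have := s.meas_sm (b := id) measurable_id (f := fun x y => f x y * s.w x y)
      (hf.mul (s.meas_w measurable_fst measurable_snd))
    simp only [id] at this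
    simp_rw [hL] at this
    exact this
  set W := fun x => relSize s.ρ (φ ⁻¹' {y | F y x}) {y | F y x} x with hW
  have hae : W =ᵐ[μ] fun _ => 1 := by
    refine ae_eq_of_ae_le_of_lintegral_le (Filter.Eventually.of_forall h2) ?_
      aemeasurable_const ?_
    · rw [hmt]; simp
    · rw [hmt]
  have hnull : μ {x | W x ≠ 1} = 0 := hae
  have hnm : MeasurableSet {x | W x ≠ 1} := (measurableSet_eq_fun hWm measurable_const).compl
  have hG0 : ∀ n, μ (s.G n ⁻¹' {x | W x ≠ 1}) = 0 := by
    intro n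
    have := hμ (s.G n) (fun x => s.symm (s.EG n x)) _ ((s.G n).measurable hnm)
    rw [image_preimage_eq _ (s.G n).surjective, hnull] at this
    have hw : Measurable fun x => s.w x (s.G n x) := s.meas_w measurable_id (s.G n).measurable
    have h0 := (setLIntegral_eq_zero_iff ((s.G n).measurable hnm) hw).1 this.symm
    refine measure_mono_null ?_ h0
    intro x hx hx2
    exact (s.w_pos (s.EG n x)).ne' (hx2 hx)
  have : μ univ = 0 := by
    refine measure_mono_null ?_ (measure_iUnion_null hG0)
    intro x _
    obtain ⟨y, hy, hlt⟩ := h3 x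
    obtain ⟨n, rfl⟩ := (s.hG _ _).1 hy
    exact mem_iUnion.2 ⟨n, hlt.ne⟩
  simp at this

end Sys
end CocycleNadkarni
end

section
set_option linter.unusedSectionVars false
set_option linter.style.haveILetI false
open MeasureTheory Set ENNReal
namespace CocycleNadkarni
namespace Sys
variable {X : Type*} [MeasurableSpace X] [StandardBorelSpace X] (s : Sys X)

theorem measure_of_finite_class (x0 : X) (h : s.sz {y | s.E x0 y} x0 ≠ ⊤) :
    ∃ μ : Measure X, IsProbabilityMeasure μ ∧ IsInvariant s.E s.ρ μ := by
  classical
  set S := s.sz {y | s.E x0 y} x0 with hS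
  have hS0 : S ≠ 0 := (s.sz_pos (show x0 ∈ {y | s.E x0 y} from s.refl x0) (s.refl x0)).ne'
  have : Countable {y | s.E x0 y} := (s.hE.2.2 x0).to_subtype
  let ν : Measure X := Measure.sum fun y : {y | s.E x0 y} => s.w x0 y • Measure.dirac (y : X)
  have hν : ∀ f : X → ℝ≥0∞, Measurable f →
      ∫⁻ x, f x ∂ν = ∑' y : {y | s.E x0 y}, s.w x0 y * f y := by
    intro f hf
    simp only [ν, lintegral_sum_measure, lintegral_smul_measure, lintegral_dirac' _ hf, smul_eq_mul]
  refine ⟨S⁻¹ • ν, ⟨?_⟩, ?_⟩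
  · have := hν (fun _ => 1) measurable_const
    simp only [lintegral_const, one_mul, mul_one] at this
    rw [Measure.smul_apply, this, smul_eq_mul]
    exact ENNReal.inv_mul_cancel hS0 h
  · intro T hT B hB
    have hTB : MeasurableSet (T '' B) := by
      rw [MeasurableEquiv.image_eq_preimage_symm]; exact T.symm.measurable hB
    rw [Measure.restrict_smul, lintegral_smul_measure, Measure.smul_apply,
      ← lintegral_indicator_one hTB, ← lintegral_indicator hB]
    congr 1
    rw [hν _ (measurable_one.indicator hTB), hν]
    · let e : {y | s.E x0 y} ≃ {y | s.E x0 y} := T.toEquiv.subtypeEquiv (by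
        intro a
        exact ⟨fun h => s.trans h (s.symm (hT a)), fun h => s.trans h (hT a)⟩)
      rw [← e.tsum_eq]
      refine tsum_congr fun y => ?_
      have he : ((e y : {y | s.E x0 y}) : X) = T y := rfl
      rw [he]
      by_cases hy : (y : X) ∈ B
      · have : T y ∈ T '' B := ⟨y, hy, rfl⟩
        simp only [indicator, this, hy, if_true, Pi.one_apply, mul_one]
        rw [s.w_mul (hT y) (s.symm y.2), mul_comm]
        rfl
      · have : T y ∉ T '' B := by
          rintro ⟨z, hz, h⟩
          rw [T.injective h] at hz; exact hy hz
        simp [indicator, this, hy]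
    · exact (s.meas_w measurable_id T.measurable).indicator hB

/-- finite patterns -/
def Tset (I : Finset ℕ) (x : X) : Set X := {y | ∃ i ∈ I, s.G i x = y}

theorem Tset_finite (I : Finset ℕ) (x : X) : (s.Tset I x).Finite := by
  have : s.Tset I x = (fun i => s.G i x) '' (I : Set ℕ) := by ext y; simp [Tset]
  rw [this]; exact I.finite_toSet.image _

theorem Tset_E {I : Finset ℕ} {x y : X} (h : y ∈ s.Tset I x) : s.E x y := by
  obtain ⟨i, _, rfl⟩ := h; exact s.EG i x

theorem meas_Tset (I : Finset ℕ) : Measurable fun p : X × X => p.2 ∈ s.Tset I p.1 := by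
  simp only [Tset, mem_ofPred_eq]
  refine Measurable.exists fun i => Measurable.and measurable_const ?_
  exact measurableSet_setOfPred.1 (measurableSet_eq_fun ((s.G i).measurable.comp measurable_fst)
    measurable_snd)

theorem meas_sz_Tset (I : Finset ℕ) {A : Set X} (hA : MeasurableSet A) :
    Measurable fun x => s.sz (A ∩ s.Tset I x) x := by
  refine s.meas_sz (b := id) (c := id) (P := fun x y => y ∈ A ∧ y ∈ s.Tset I x) measurable_id
    measurable_id ?_ fun z y h => s.Tset_E h.2
  exact (measurableSet_setOfPred.1 (measurable_snd hA)).and (s.meas_Tset I)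

theorem max_lemma {F : X → X → Prop} (hF : IsFinSubequiv s.E F) (Φ : X → Set X → Prop)
    (hΦE : ∀ x y S, S.Finite → (∀ z ∈ S, s.E x z) → s.E x y → Φ x S → Φ y S)
    (hΦm : ∀ I : Finset ℕ, Measurable fun x => Φ x (s.Tset I x)) :
    ∃ (F' : X → X → Prop) (Y : Set X), IsFinSubequiv s.E F' ∧ (∀ x y, F x y → F' x y) ∧
      MeasurableSet Y ∧ (∀ x y, F' x y → x ∈ Y → y ∈ Y ∧ F x y) ∧
      (∀ x, x ∉ Y → Φ x {y | F' y x}) ∧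
      ∀ x S, S.Finite → S.Nonempty → (∀ z ∈ S, s.E x z) → S ⊆ Y →
        (∀ y z, F y z → y ∈ S → z ∈ S) → ¬ Φ x S := by
  classical
  obtain ⟨c, hc⟩ := exists_surjective_nat (ℕ × Finset (ℕ × ℤ))
  let I : ℕ → Finset ℕ := fun k => (c k).2.image Prod.fst
  let U : ℕ → Set X := fun k => {x | (∀ p ∈ (c k).2, ∀ p' ∈ (c k).2, p.2 = p'.2 → p.1 = p'.1) ∧
    ∀ p ∈ (c k).2, ⌊2 ^ (c k).1 * s.r (s.G p.1 x)⌋ = p.2}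
  have hU : ∀ k, MeasurableSet (U k) := by
    intro k
    refine measurableSet_setOfPred.2 (Measurable.and measurable_const ?_)
    refine Measurable.forall fun p => Measurable.imp measurable_const ?_
    refine measurableSet_setOfPred.1 (measurableSet_eq_fun ?_ measurable_const)
    exact Int.measurable_floor.comp ((s.hr.comp (s.G p.1).measurable).const_mul _)
  have hUd : ∀ k x x' y, x ∈ U k → x' ∈ U k → y ∈ s.Tset (I k) x → y ∈ s.Tset (I k) x' → x = x' := by
    rintro k x x' y hx hx' ⟨i, hi, h⟩ ⟨j, hj, h'⟩
    simp only [I, Finset.mem_image] at hi hj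
    obtain ⟨p, hp, rfl⟩ := hi
    obtain ⟨q, hq, rfl⟩ := hj
    have h1 := hx.2 p hp
    have h2 := hx'.2 q hq
    rw [h] at h1
    rw [h'] at h2
    have h3 := hx.1 p hp q hq (h1.symm.trans h2)
    rw [h3] at h
    exact (s.G q.1).injective (h.trans h'.symm)
  let V : ℕ → Set X → Set X := fun k Y => {x | x ∈ U k ∧ (∀ i ∈ I k, s.G i x ∈ Y) ∧
    (∀ z, s.E x z → (∃ i ∈ I k, F (s.G i x) z) → z ∈ s.Tset (I k) x) ∧ Φ x (s.Tset (I k) x)}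
  have hV : ∀ k Y, MeasurableSet Y → MeasurableSet (V k Y) := by
    intro k Y hY
    refine measurableSet_setOfPred.2 ?_
    refine (measurableSet_setOfPred.1 (hU k)).and (Measurable.and ?_ (Measurable.and ?_ (hΦm _)))
    · exact Measurable.forall fun i => Measurable.imp measurable_const
        (measurableSet_setOfPred.1 ((s.G i).measurable hY))
    · refine s.meas_all (b := id) measurable_id (P := fun x z => (∃ i ∈ I k, F (s.G i x) z) →
        z ∈ s.Tset (I k) x) ?_
      refine Measurable.imp (Measurable.exists fun i => Measurable.and measurable_const ?_)
        (s.meas_Tset _)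
      exact s.fmeas hF ((s.G i).measurable.comp measurable_fst) measurable_snd
  let Rm : ℕ → Set X → Set X := fun k Y => {y | ∃ x, s.E y x ∧ (x ∈ V k Y ∧ y ∈ s.Tset (I k) x)}
  have hRm : ∀ k Y, MeasurableSet Y → MeasurableSet (Rm k Y) := by
    intro k Y hY
    refine measurableSet_setOfPred.2 (s.meas_ex (b := id) measurable_id
      (P := fun y x => x ∈ V k Y ∧ y ∈ s.Tset (I k) x) ?_)
    exact (measurableSet_setOfPred.1 (measurable_snd (hV k Y hY))).and
      ((s.meas_Tset (I k)).comp measurable_swap)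
  let Yk : ℕ → Set X := fun k => Nat.rec univ (fun k Y => Y \ Rm k Y) k
  have hYk : ∀ k, Yk (k + 1) = Yk k \ Rm k (Yk k) := fun k => rfl
  have hYm : ∀ k, MeasurableSet (Yk k) := by
    intro k
    induction k with
    | zero => exact MeasurableSet.univ
    | succ k ih => rw [hYk]; exact ih.diff (hRm k _ ih)
  have hYa : Antitone Yk := antitone_nat_of_succ_le fun k => by rw [hYk]; exact sdiff_subset
  -- tiles
  let Ti : ℕ → X → X → Prop := fun k x y => x ∈ V k (Yk k) ∧ y ∈ s.Tset (I k) x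
  have hTiY : ∀ k x y, Ti k x y → y ∈ Yk k ∧ y ∉ Yk (k + 1) := by
    rintro k x y ⟨hx, hy⟩
    refine ⟨?_, ?_⟩
    · obtain ⟨i, hi, rfl⟩ := hy; exact hx.2.1 i hi
    · rw [hYk]
      rintro ⟨_, h⟩
      exact h ⟨x, s.symm (s.Tset_E hy), hx, hy⟩
  have hTiu : ∀ k x y k' x', Ti k x y → Ti k' x' y → k = k' ∧ x = x' := by
    intro k x y k' x' h h'
    have hk : k = k' := by
      rcases lt_trichotomy k k' with hlt | he | hlt
      · exact absurd (hYa hlt (hTiY _ _ _ h').1) (hTiY _ _ _ h).2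
      · exact he
      · exact absurd (hYa hlt (hTiY _ _ _ h).1) (hTiY _ _ _ h').2
    subst hk
    exact ⟨rfl, hUd k x x' y h.1.1 h'.1.1 h.2 h'.2⟩
  have hTiF : ∀ k x y z, Ti k x y → F y z → Ti k x z := by
    rintro k x y z ⟨hx, hy⟩ hyz
    refine ⟨hx, ?_⟩
    have hxz := s.trans (s.Tset_E hy) (hF.2.2.1 hyz)
    obtain ⟨i, hi, rfl⟩ := hy
    exact hx.2.2.1 z hxz ⟨i, hi, hyz⟩
  set Y := ⋂ k, Yk k with hYdef
  have hnY : ∀ y, y ∉ Y → ∃ k x, Ti k x y := by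
    intro y hy
    by_contra hcon
    push Not at hcon
    apply hy
    refine mem_iInter.2 fun k => ?_
    induction k with
    | zero => exact mem_univ _
    | succ k ih =>
      rw [hYk]
      refine ⟨ih, ?_⟩
      rintro ⟨x, _, hx⟩
      exact hcon k x hx
  let F' : X → X → Prop := fun y z => F y z ∨ ∃ k x, Ti k x y ∧ Ti k x z
  have hcl : ∀ k x y, Ti k x y → {z | F' z y} = s.Tset (I k) x := by
    intro k x y h
    ext z
    simp only [mem_ofPred_eq, F']
    constructor
    · rintro (hz | ⟨k', x', h1, h2⟩)
      · exact (hTiF k x y z h (hF.1.symm hz)).2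
      · obtain ⟨rfl, rfl⟩ := hTiu _ _ _ _ _ h h2
        exact h1.2
    · intro hz
      exact Or.inr ⟨k, x, ⟨h.1, hz⟩, h⟩
  have hsymm : ∀ {y z}, F' y z → F' z y := by
    rintro y z (h | ⟨k, x, h1, h2⟩)
    · exact Or.inl (hF.1.symm h)
    · exact Or.inr ⟨k, x, h2, h1⟩
  have hYF' : ∀ x y, F' x y → x ∈ Y → y ∈ Y ∧ F x y := by
    rintro x y h hx
    have hxy : F x y := by
      rcases h with h | ⟨k, x', h1, h2⟩
      · exact h
      · exact absurd (mem_iInter.1 hx (k + 1)) (hTiY _ _ _ h1).2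
    refine ⟨?_, hxy⟩
    by_contra hy
    obtain ⟨k, x', h1⟩ := hnY y hy
    exact (hTiY _ _ _ (hTiF _ _ _ _ h1 (hF.1.symm hxy))).2 (mem_iInter.1 hx (k + 1))
  refine ⟨F', Y, ⟨⟨?_, ?_, ?_⟩, ?_, ?_, ?_⟩, fun x y h => Or.inl h, MeasurableSet.iInter hYm, hYF',
    ?_, ?_⟩
  · exact fun x => Or.inl (hF.1.refl x)
  · exact hsymm
  · rintro a b d (h | ⟨k, x, h1, h2⟩) (h' | ⟨k', x', h1', h2'⟩)
    · exact Or.inl (hF.1.trans h h')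
    · exact Or.inr ⟨k', x', hTiF _ _ _ _ h1' (hF.1.symm h), h2'⟩
    · exact Or.inr ⟨k, x, h1, hTiF _ _ _ _ h2 h'⟩
    · obtain ⟨rfl, rfl⟩ := hTiu _ _ _ _ _ h2 h1'
      exact Or.inr ⟨k, x, h1, h2'⟩
  · refine measurableSet_setOfPred.2 (Measurable.or (measurableSet_setOfPred.1 hF.2.1) ?_)
    refine Measurable.exists fun k => ?_
    have : (fun p : X × X => ∃ x, Ti k x p.1 ∧ Ti k x p.2) =
        fun p : X × X => ∃ x, s.E p.1 x ∧ (Ti k x p.1 ∧ Ti k x p.2) := by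
      funext p
      refine propext ⟨?_, ?_⟩
      · rintro ⟨x, h⟩; exact ⟨x, s.symm (s.Tset_E h.1.2), h⟩
      · rintro ⟨x, _, h⟩; exact ⟨x, h⟩
    rw [this]
    refine s.meas_ex measurable_fst (P := fun p x => Ti k x p.1 ∧ Ti k x p.2) ?_
    have hTm : ∀ {f : (X × X) × X → X}, Measurable f →
        Measurable fun q : (X × X) × X => Ti k q.2 (f q) := fun hf =>
      (measurableSet_setOfPred.1 (measurable_snd (hV k _ (hYm k)))).and
        ((s.meas_Tset (I k)).comp (measurable_snd.prodMk hf))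
    exact (hTm (measurable_fst.comp measurable_fst)).and (hTm (measurable_snd.comp measurable_fst))
  · rintro x y (h | ⟨k, z, h1, h2⟩)
    · exact hF.2.2.1 h
    · exact s.trans (s.symm (s.Tset_E h1.2)) (s.Tset_E h2.2)
  · intro x
    have hh : {y | F' x y} = {y | F' y x} := by ext y; exact ⟨hsymm, hsymm⟩
    rw [hh]
    by_cases hx : x ∈ Y
    · exact (s.ffin hF x).subset fun y hy => hF.1.symm (hYF' x y (hsymm hy) hx).2
    · obtain ⟨k, z, h⟩ := hnY x hx
      rw [hcl k z x h]
      exact s.Tset_finite _ _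
  · intro x hx
    obtain ⟨k, z, h⟩ := hnY x hx
    rw [hcl k z x h]
    exact hΦE z x _ (s.Tset_finite _ _) (fun y hy => s.Tset_E hy) (s.Tset_E h.2) h.1.2.2.2
  · intro x S hSf hSn hSE hSY hSF hΦ
    -- find a scale
    have hscale : ∃ n : ℕ, ∀ y ∈ S, ∀ z ∈ S, y ≠ z → 1 ≤ 2 ^ n * |s.r y - s.r z| := by
      have h1 : ∀ p ∈ S ×ˢ S, ∀ᶠ n : ℕ in Filter.atTop, p.1 ≠ p.2 →
          1 ≤ 2 ^ n * |s.r p.1 - s.r p.2| := by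
        rintro ⟨y, z⟩ _
        by_cases hyz : y = z
        · simp [hyz]
        · have hpos : 0 < |s.r y - s.r z| := abs_pos.2 (sub_ne_zero.2 fun h => hyz (s.hri h))
          have := (tendsto_pow_atTop_atTop_of_one_lt (r := (2 : ℝ)) (by norm_num)).atTop_mul_const hpos
          filter_upwards [this.eventually_ge_atTop 1] with n hn _
          exact hn
      obtain ⟨n, hn⟩ := ((Filter.eventually_all_finite (hSf.prod hSf)).2 h1).exists
      exact ⟨n, fun y hy z hz hyz => hn (y, z) ⟨hy, hz⟩ hyz⟩
    obtain ⟨n, hn⟩ := hscale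
    have hix : ∀ y ∈ S, ∃ i, s.G i x = y := fun y hy => (s.hG _ _).1 (hSE y hy)
    let ix : X → ℕ := fun y => if h : ∃ i, s.G i x = y then h.choose else 0
    have hixs : ∀ y ∈ S, s.G (ix y) x = y := by
      intro y hy
      simp only [ix, dif_pos (hix y hy)]
      exact (hix y hy).choose_spec
    obtain ⟨k, hk⟩ := hc (n, hSf.toFinset.image fun y => (ix y, ⌊2 ^ n * s.r y⌋))
    have hT : s.Tset (I k) x = S := by
      ext y
      simp only [Tset, I, hk, Finset.image_image, Finset.mem_image, Finite.mem_toFinset,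
        mem_ofPred_eq, Function.comp]
      constructor
      · rintro ⟨i, ⟨z, hz, rfl⟩, rfl⟩
        rw [hixs z hz]; exact hz
      · intro hy
        exact ⟨_, ⟨y, hy, rfl⟩, hixs y hy⟩
    have hxU : x ∈ U k := by
      simp only [U, hk, mem_ofPred_eq, Finset.mem_image, Finite.mem_toFinset]
      refine ⟨?_, ?_⟩
      · rintro _ ⟨y, hy, rfl⟩ _ ⟨z, hz, rfl⟩ h
        simp only at h ⊢
        by_cases hyz : y = z
        · rw [hyz]
        · exfalso
          have h1 := hn y hy z hz hyz
          have h2 := Int.abs_sub_lt_one_of_floor_eq_floor h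
          rw [← mul_sub, abs_mul, abs_of_pos (by positivity)] at h2
          linarith
      · rintro _ ⟨y, hy, rfl⟩
        simp only
        rw [hixs y hy]
    have hxV : x ∈ V k (Yk k) := by
      refine ⟨hxU, ?_, ?_, by rw [hT]; exact hΦ⟩
      · intro i hi
        have : s.G i x ∈ s.Tset (I k) x := ⟨i, hi, rfl⟩
        rw [hT] at this
        exact mem_iInter.1 (hSY this) k
      · rintro z hz ⟨i, hi, h⟩
        have : s.G i x ∈ s.Tset (I k) x := ⟨i, hi, rfl⟩
        rw [hT] at this ⊢
        exact hSF _ _ h this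
    obtain ⟨y, hy⟩ := hSn
    have hTi : Ti k x y := ⟨hxV, by rw [hT]; exact hy⟩
    exact (hTiY _ _ _ hTi).2 (mem_iInter.1 (hSY hy) (k + 1))

end Sys
end CocycleNadkarni
end

section
set_option linter.unusedSectionVars false
set_option linter.style.haveILetI false
open MeasureTheory Set ENNReal
namespace CocycleNadkarni
namespace Sys
variable {X : Type*} [MeasurableSpace X] [StandardBorelSpace X] (s : Sys X)

/-- all classes have infinite size -/
def Inf : Prop := ∀ x, s.sz {y | s.E x y} x = ⊤

theorem Tset_large (hinf : s.Inf) (z : X) {M : ℝ≥0∞} (hM : M ≠ ⊤) :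
    ∃ n, M ≤ s.sz (s.Tset (Finset.range n) z) z := by
  classical
  by_contra hcon
  push Not at hcon
  have : s.sz {y | s.E z y} z ≤ M := by
    refine sm_le_of_finset fun S hS => ?_
    have : ∃ n, (S : Set X) ⊆ s.Tset (Finset.range n) z := by
      induction S using Finset.induction_on with
      | empty => exact ⟨0, by simp⟩
      | insert a S ha ih =>
        rw [Finset.coe_insert, insert_subset_iff] at hS
        obtain ⟨n, hn⟩ := ih hS.2
        obtain ⟨m, hm⟩ := (s.hG _ _).1 hS.1
        refine ⟨max n (m + 1), ?_⟩
        rw [Finset.coe_insert, insert_subset_iff]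
        refine ⟨⟨m, by simp, hm⟩, fun y hy => ?_⟩
        obtain ⟨i, hi, h⟩ := hn hy
        exact ⟨i, by simp at hi ⊢; omega, h⟩
    obtain ⟨n, hn⟩ := this
    exact (sm_mono _ hn).trans (hcon n).le
  rw [hinf z] at this
  exact hM (top_le_iff.1 this)

theorem comp_of_transversal (hinf : s.Inf) {C : Set X} (hC : MeasurableSet C)
    (hCi : EInvariant s.E C) {z : X → X} (hz : Measurable z) (hzE : ∀ x, s.E x (z x))
    (hzc : ∀ x ∈ C, ∀ y, s.E x y → z x = z y) : s.Comp C := by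
  classical
  let c : X → ℕ → ℝ≥0∞ := fun z n => s.sz (s.Tset (Finset.range n) z) z
  have hcm : ∀ n, Measurable fun z => c z n := by
    intro n
    simpa using s.meas_sz_Tset (Finset.range n) MeasurableSet.univ
  have hct : ∀ z n, c z n ≠ ⊤ := fun z n => (s.sz_lt_top z (s.Tset_finite _ _)).ne
  have hex : ∀ z m, ∃ n, 2 * c z m ≤ c z n := fun z m =>
    s.Tset_large hinf z (ENNReal.mul_ne_top (by simp) (hct z m))
  let T : ℕ → X → ℕ := fun k => Nat.rec (fun _ => 1) (fun _ t z => Nat.find (hex z (t z))) k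
  have hTs : ∀ k z, T (k + 1) z = Nat.find (hex z (T k z)) := fun k z => rfl
  have hTm : ∀ k, Measurable (T k) := by
    intro k
    induction k with
    | zero => exact measurable_const
    | succ k ih =>
      have h1 : Measurable fun z => c z (T k z) := by
        have : Measurable fun p : X × ℕ => c p.1 p.2 := measurable_from_prod_countable_left hcm
        exact this.comp (measurable_id.prodMk ih)
      exact measurable_find (fun z => hex z (T k z)) fun n =>
        measurableSet_le (h1.const_mul 2) (hcm n)
  let Ck : ℕ → X → Set X := fun k z => s.Tset (Finset.range (T k z)) z
  have hCk0 : ∀ k z, s.sz (Ck k z) z ≠ 0 := by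
    intro k
    induction k with
    | zero =>
      intro z
      exact (s.sz_pos (show s.G 0 z ∈ Ck 0 z from ⟨0, by simp [T], rfl⟩) (s.EG _ _)).ne'
    | succ k ih =>
      intro z
      have : 2 * s.sz (Ck k z) z ≤ s.sz (Ck (k + 1) z) z := Nat.find_spec (hex z (T k z))
      intro h0
      rw [h0] at this
      simp at this
      exact ih z this
  have hCk2 : ∀ k z, 2 * s.sz (Ck k z) z ≤ s.sz (Ck (k + 1) z) z :=
    fun k z => Nat.find_spec (hex z (T k z))
  have hCkt : ∀ k z, s.sz (Ck k z) z ≠ ⊤ := fun k z => hct z _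
  have hTlt : ∀ k z, T k z < T (k + 1) z := by
    intro k z
    by_contra hcon
    push Not at hcon
    have h1 : s.sz (Ck (k + 1) z) z ≤ s.sz (Ck k z) z := by
      refine sm_mono _ ?_
      rintro y ⟨i, hi, h⟩
      exact ⟨i, by simp at hi ⊢; omega, h⟩
    have h2 := (hCk2 k z).trans h1
    rw [two_mul] at h2
    have h3 : s.sz (Ck k z) z < s.sz (Ck k z) z + s.sz (Ck k z) z :=
      ENNReal.lt_add_right (hCkt k z) (hCk0 k z)
    exact absurd h2 (not_le.2 h3)
  have hmono : ∀ z, StrictMono (fun k => T k z) := fun z => strictMono_nat_of_lt_succ fun k => hTlt k z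
  have hCkm : ∀ z, Monotone (fun k => Ck k z) := by
    rintro z k l hkl y ⟨i, hi, h⟩
    have : T k z ≤ T l z := (hmono z).monotone hkl
    exact ⟨i, by simp at hi ⊢; omega, h⟩
  have hKex : ∀ x, ∃ k, x ∈ Ck k (z x) := by
    intro x
    obtain ⟨n, hn⟩ := (s.hG _ _).1 (s.symm (hzE x))
    have : n + 1 ≤ T (n + 1) (z x) := (hmono (z x)).le_apply
    exact ⟨n + 1, n, by simp; omega, hn⟩
  let K : X → ℕ := fun x => Nat.find (hKex x)
  have hCkms : ∀ k, MeasurableSet {x | x ∈ Ck k (z x)} := by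
    intro k
    have : {x | x ∈ Ck k (z x)} = {x | ∃ i, i < T k (z x) ∧ s.G i (z x) = x} := by
      ext x; simp [Ck, Tset]
    rw [this]
    refine measurableSet_setOfPred.2 (Measurable.exists fun i => Measurable.and ?_ ?_)
    · exact measurableSet_setOfPred.1 (measurableSet_lt measurable_const ((hTm k).comp hz))
    · exact measurableSet_setOfPred.1 (measurableSet_eq_fun ((s.G i).measurable.comp hz) measurable_id)
  have hKm : Measurable K := measurable_find hKex hCkms
  -- blocks
  have hKle : ∀ x k, K x ≤ k ↔ x ∈ Ck k (z x) := by
    intro x k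
    constructor
    · intro h; exact hCkm _ h (Nat.find_spec (hKex x))
    · intro h; exact Nat.find_min' (hKex x) h
  let D : ℕ → X → Set X := fun k x => {y | s.E y x ∧ K y = k}
  have hzz : ∀ x ∈ C, z (z x) = z x := fun x hx => (hzc x hx _ (hzE x)).symm
  have hmemC : ∀ x ∈ C, ∀ k y, (s.E y x ∧ K y ≤ k) ↔ y ∈ Ck k (z x) := by
    intro x hx k y
    constructor
    · rintro ⟨h1, h2⟩
      rw [hzc x hx y (s.symm h1)]
      exact (hKle y k).1 h2
    · intro h
      have hE : s.E y x := s.trans (s.symm (s.Tset_E h)) (s.symm (hzE x))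
      refine ⟨hE, ?_⟩
      rw [hKle, ← hzc x hx y (s.symm hE)]
      exact h
  have hCkE : ∀ x k, ∀ y ∈ Ck k (z x), s.E x y := fun x k y hy => s.trans (hzE x) (s.Tset_E hy)
  have hDsucc : ∀ x ∈ C, ∀ k, s.sz (D k x) (z x) ≤ s.sz (D (k + 1) x) (z x) := by
    intro x hx k
    have h1 : D k x ⊆ Ck k (z x) := by
      rintro y ⟨h, h'⟩; exact (hmemC x hx k y).1 ⟨h, h'.le⟩
    have h2 : Ck (k + 1) (z x) ⊆ Ck k (z x) ∪ D (k + 1) x := by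
      intro y hy
      obtain ⟨h3, h4⟩ := (hmemC x hx (k + 1) y).2 hy
      rcases h4.lt_or_eq with h | h
      · exact Or.inl ((hmemC x hx k y).1 ⟨h3, by omega⟩)
      · exact Or.inr ⟨h3, h⟩
    have h3 := (hCk2 k (z x)).trans ((sm_mono _ h2).trans (sm_union_le _ _ _))
    rw [two_mul] at h3
    exact (sm_mono _ h1).trans ((ENNReal.add_le_add_iff_left (hCkt k (z x))).1 h3)
  have hDpos : ∀ x ∈ C, ∀ k, 0 < s.sz (D k x) (z x) := by
    intro x hx k
    induction k with
    | zero =>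
      have : D 0 x = Ck 0 (z x) := by
        ext y; rw [← hmemC x hx 0 y]; simp [D]
      rw [this]
      exact pos_iff_ne_zero.2 (hCk0 0 _)
    | succ k ih => exact ih.trans_le (hDsucc x hx k)
  have hDne : ∀ x ∈ C, ∀ k, ∃ y, s.E x y ∧ K y = k := by
    intro x hx k
    by_contra hcon
    push Not at hcon
    have : D k x = ∅ := by
      ext y; simp only [D, mem_ofPred_eq, mem_empty_iff_false, iff_false]
      rintro ⟨h, h'⟩; exact hcon y (s.symm h) h'
    have h2 := hDpos x hx k
    rw [this] at h2; simp at h2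
  have hDfin : ∀ x ∈ C, ∀ k, (D k x).Finite := by
    intro x hx k
    refine (s.Tset_finite (Finset.range (T k (z x))) (z x)).subset ?_
    rintro y ⟨h, h'⟩; exact (hmemC x hx k y).1 ⟨h, h'.le⟩
  let F : X → X → Prop := fun x y => x = y ∨ (x ∈ C ∧ s.E x y ∧ K x = K y)
  have hF : IsFinSubequiv s.E F := by
    refine ⟨⟨fun x => Or.inl rfl, ?_, ?_⟩, ?_, ?_, ?_⟩
    · rintro x y (h | ⟨h1, h2, h3⟩)
      · exact Or.inl h.symm
      · exact Or.inr ⟨hCi h2 h1, s.symm h2, h3.symm⟩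
    · rintro x y w (rfl | ⟨h1, h2, h3⟩) (rfl | ⟨h1', h2', h3'⟩)
      · exact Or.inl rfl
      · exact Or.inr ⟨h1', h2', h3'⟩
      · exact Or.inr ⟨h1, h2, h3⟩
      · exact Or.inr ⟨h1, s.trans h2 h2', h3.trans h3'⟩
    · refine measurableSet_setOfPred.2 (Measurable.or ?_ (Measurable.and ?_ (Measurable.and ?_ ?_)))
      · exact measurableSet_setOfPred.1 (measurableSet_eq_fun measurable_fst measurable_snd)
      · exact measurableSet_setOfPred.1 (measurable_fst hC)
      · exact s.meas_E measurable_fst measurable_snd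
      · exact measurableSet_setOfPred.1 (measurableSet_eq_fun (hKm.comp measurable_fst)
          (hKm.comp measurable_snd))
    · rintro x y (rfl | h)
      · exact s.refl _
      · exact h.2.1
    · intro x
      by_cases hx : x ∈ C
      · refine ((hDfin x hx (K x)).insert x).subset ?_
        rintro y (rfl | h)
        · exact Or.inl rfl
        · exact Or.inr ⟨s.symm h.2.1, h.2.2.symm⟩
      · refine (finite_singleton x).subset ?_
        rintro y (rfl | h)
        · rfl
        · exact absurd h.1 hx
  let R : X → X → Prop := fun x y => K y = K x + 1
  have hφs : ∀ x ∈ C, K (s.sel R x) = K x + 1 := fun x hx => s.sel_spec (R := R) (hDne x hx _)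
  have hFD : ∀ x ∈ C, {y | F y x} = D (K x) x := by
    intro x hx
    ext y
    simp only [mem_ofPred_eq, F, D]
    constructor
    · rintro (rfl | h)
      · exact ⟨s.refl _, rfl⟩
      · exact h.2
    · rintro ⟨h1, h2⟩
      exact Or.inr ⟨hCi (s.symm h1) hx, h1, h2⟩
  have hpre0 : ∀ x ∈ C, K x = 0 → s.sel R ⁻¹' {y | F y x} = ∅ := by
    intro x hx h0
    rw [hFD x hx, h0]
    ext y
    simp only [mem_preimage, mem_empty_iff_false, iff_false, D, mem_ofPred_eq]
    rintro ⟨h1, h2⟩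
    have hy : y ∈ C := hCi (s.symm (s.trans (s.sel_E R y) h1)) hx
    rw [hφs y hy] at h2
    omega
  have hpreS : ∀ x ∈ C, ∀ k, K x = k + 1 → s.sel R ⁻¹' {y | F y x} ⊆ D k x := by
    intro x hx k h0
    rw [hFD x hx, h0]
    intro y
    simp only [mem_preimage, D, mem_ofPred_eq]
    rintro ⟨h1, h2⟩
    have hE := s.trans (s.sel_E R y) h1
    have hy : y ∈ C := hCi (s.symm hE) hx
    rw [hφs y hy] at h2
    exact ⟨hE, by omega⟩
  refine ⟨hC, hCi, s.sel R, F, s.sel_meas ?_, hF, s.sel_E R, fun x hx => ⟨?_, ?_, ?_⟩⟩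
  · exact measurableSet_setOfPred.1 (measurableSet_eq_fun (hKm.comp measurable_snd)
      ((hKm.comp measurable_fst).add_const 1))
  · have hsub : s.sel R ⁻¹' {x} ⊆ s.sel R ⁻¹' {y | F y x} :=
      preimage_mono (by rintro _ rfl; exact Or.inl rfl)
    rcases Nat.eq_zero_or_eq_succ_pred (K x) with h | h
    · exact (finite_empty).subset (hsub.trans (hpre0 x hx h).subset)
    · exact (hDfin x hx _).subset (hsub.trans (hpreS x hx _ h))
  · rcases Nat.eq_zero_or_eq_succ_pred (K x) with h | h
    · rw [hpre0 x hx h]; simp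
    · refine (sm_mono _ (hpreS x hx _ h)).trans ?_
      have hE : ∀ k, ∀ y ∈ D k x, s.E (z x) y := fun k y hy => s.trans (s.symm (hzE x)) (s.symm hy.1)
      rw [hFD x hx, h]
      exact (s.sz_le_base1 (hE _) (hE _) (s.symm (hzE x))).2 (hDsucc x hx _)
  · obtain ⟨y, hy, h0⟩ := hDne x hx 0
    refine ⟨y, hy, ?_⟩
    rw [hpre0 y (hCi hy hx) h0]
    simp only [sm_empty]
    exact pos_iff_ne_zero.2 (s.fpos hF y)

theorem comp_of_finite (hinf : s.Inf) {C Z : Set X} (hC : MeasurableSet C)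
    (hCi : EInvariant s.E C) (hZ : MeasurableSet Z)
    (h : ∀ x ∈ C, (Z ∩ {y | s.E x y}).Finite ∧ (Z ∩ {y | s.E x y}).Nonempty) : s.Comp C := by
  let R : X → X → Prop := fun x y => y ∈ Z ∧ ∀ y', s.E x y' → y' ∈ Z → s.r y ≤ s.r y'
  have hR : Measurable fun p : X × X => R p.1 p.2 := by
    refine (measurableSet_setOfPred.1 (measurable_snd hZ)).and ?_
    refine s.meas_all measurable_fst (P := fun (p : X × X) y' => y' ∈ Z → s.r p.2 ≤ s.r y') ?_
    refine (measurableSet_setOfPred.1 (measurable_snd hZ)).imp (measurableSet_setOfPred.1 ?_)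
    exact measurableSet_le (s.hr.comp (measurable_snd.comp measurable_fst)) (s.hr.comp measurable_snd)
  have hspec : ∀ x ∈ C, R x (s.sel R x) := by
    intro x hx
    apply s.sel_spec
    obtain ⟨h1, h2⟩ := h x hx
    obtain ⟨y, hy, hmin⟩ := exists_min_image _ s.r h1 h2
    exact ⟨y, hy.2, hy.1, fun y' h3 h4 => hmin y' ⟨h4, h3⟩⟩
  refine s.comp_of_transversal hinf hC hCi (s.sel_meas hR) (s.sel_E R) ?_
  intro x hx y hxy
  apply s.hri
  have h1 := hspec x hx
  have h2 := hspec y (hCi hxy hx)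
  apply le_antisymm
  · exact h1.2 _ (s.trans hxy (s.sel_E R y)) h2.1
  · exact h2.2 _ (s.trans (s.symm hxy) (s.sel_E R x)) h1.1

theorem tiles_finite {F : X → X → Prop} (hF : IsFinSubequiv s.E F) {Q : Set X} (x : X)
    (hQF : ∀ y z, F y z → y ∈ Q → z ∈ Q) (hQ : s.sz Q x ≠ ⊤) {ε : ℝ≥0∞} (hε : ε ≠ 0)
    (h : ∀ z ∈ Q, ε ≤ s.sz {y | F y z} x) : Q.Finite := by
  let st : Setoid X := ⟨F, hF.1⟩
  rw [sz, sm_eq_fiber _ Q (Quotient.mk st)] at hQ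
  have hfin := ENNReal.finite_const_le_of_tsum_ne_top hQ hε
  have hfib : ∀ z ∈ Q, Q ∩ Quotient.mk st ⁻¹' {Quotient.mk st z} = {y | F y z} := by
    intro z hz
    ext y
    simp only [mem_inter_iff, mem_preimage, mem_singleton_iff, mem_ofPred_eq]
    constructor
    · rintro ⟨_, h⟩; exact Quotient.exact h
    · intro h; exact ⟨hQF _ _ (hF.1.symm h) hz, Quotient.sound h⟩
  refine Set.Finite.of_finite_fibers (Quotient.mk st) (hfin.subset ?_) ?_
  · rintro _ ⟨z, hz, rfl⟩
    simp only [mem_ofPred_eq]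
    rw [hfib z hz]
    exact h z hz
  · rintro _ ⟨z, hz, rfl⟩
    rw [hfib z hz]
    exact s.ffin hF z

end Sys
end CocycleNadkarni
end

section
set_option linter.unusedSectionVars false
set_option linter.style.haveILetI false
open MeasureTheory Set ENNReal
namespace CocycleNadkarni
namespace Sys
variable {X : Type*} [MeasurableSpace X] [StandardBorelSpace X] (s : Sys X)

/-- the tile of `x` is at most as large as the tile of `y` -/
def tl (F : X → X → Prop) (x y : X) : Prop := s.sz {z | F z x} x ≤ s.sz {z | F z y} x

theorem meas_mem {Z : Type*} [MeasurableSpace Z] {a : Z → X} (ha : Measurable a) {A : Set X}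
    (hA : MeasurableSet A) : Measurable fun z => a z ∈ A := measurableSet_setOfPred.1 (ha hA)

theorem meas_szF {Z : Type*} [MeasurableSpace Z] {F : X → X → Prop} (hF : IsFinSubequiv s.E F)
    {a b : Z → X} (ha : Measurable a) (hb : Measurable b) :
    Measurable fun z => s.sz {y | F y (a z)} (b z) :=
  s.meas_sz ha hb (s.fmeas hF measurable_snd (ha.comp measurable_fst))
    fun _ _ h => s.symm (hF.2.2.1 h)

theorem meas_tl {Z : Type*} [MeasurableSpace Z] {F : X → X → Prop} (hF : IsFinSubequiv s.E F)
    {a b : Z → X} (ha : Measurable a) (hb : Measurable b) :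
    Measurable fun z => s.tl F (a z) (b z) :=
  measurableSet_setOfPred.1 (measurableSet_le (s.meas_szF hF ha ha) (s.meas_szF hF hb ha))

theorem tl_iff {F : X → X → Prop} (hF : IsFinSubequiv s.E F) {x u v : X} (hu : s.E x u)
    (hv : s.E x v) : s.tl F u v ↔ s.sz {z | F z u} x ≤ s.sz {z | F z v} x :=
  s.sz_le_base1 (fun y hy => s.trans hu (s.fE hF u y hy)) (fun y hy => s.trans hv (s.fE hF v y hy)) hu

theorem lac_finite {F : X → X → Prop} (hF : IsFinSubequiv s.E F) {Y0 : Set X}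
    (hYF : ∀ x y, F x y → x ∈ Y0 → y ∈ Y0) {x y : X} (hxy : s.E x y)
    (hl : s.sz {z | s.E y z ∧ z ∈ Y0 ∧ s.tl F z y} y ≠ ⊤) {ε : ℝ≥0∞} (hε : ε ≠ 0) :
    {z | s.E x z ∧ z ∈ Y0 ∧ s.sz {v | F v z} x ≤ s.sz {v | F v y} x ∧
      ε ≤ s.sz {v | F v z} x}.Finite := by
  refine s.tiles_finite hF x ?_ ?_ hε (fun z hz => hz.2.2.2)
  · rintro u v huv ⟨h1, h2, h3, h4⟩
    rw [s.feq hF huv] at h3 h4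
    exact ⟨s.trans h1 (hF.2.2.1 huv), hYF _ _ huv h2, h3, h4⟩
  · have h1 : {z | s.E x z ∧ z ∈ Y0 ∧ s.sz {v | F v z} x ≤ s.sz {v | F v y} x ∧
      ε ≤ s.sz {v | F v z} x} ⊆ {z | s.E y z ∧ z ∈ Y0 ∧ s.tl F z y} := by
      rintro z ⟨h1, h2, h3, h4⟩
      exact ⟨s.trans (s.symm hxy) h1, h2, (s.tl_iff hF h1 hxy).2 h3⟩
    refine ne_top_of_le_ne_top ?_ (sm_mono _ h1)
    change s.sz _ x ≠ ⊤
    rw [s.sz_base (z := y) (fun v hv => hv.1) (s.symm hxy)]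
    exact ENNReal.mul_ne_top hl (s.w_ne_top _ _)

theorem lac_comp (hinf : s.Inf) {F : X → X → Prop} (hF : IsFinSubequiv s.E F) {C Y0 : Set X}
    (hC : MeasurableSet C) (hCi : EInvariant s.E C) (hY : MeasurableSet Y0)
    (hYF : ∀ x y, F x y → x ∈ Y0 → y ∈ Y0) (hYC : ∀ x ∈ C, ∃ y ∈ Y0, s.E x y)
    (hl : ∀ y ∈ Y0, y ∈ C → s.sz {z | s.E y z ∧ z ∈ Y0 ∧ s.tl F z y} y ≠ ⊤) : s.Comp C := by
  have hfin : ∀ x ∈ C, ∀ y ∈ Y0, s.E x y → ∀ ε ≠ 0, {z | s.E x z ∧ z ∈ Y0 ∧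
      s.sz {v | F v z} x ≤ s.sz {v | F v y} x ∧ ε ≤ s.sz {v | F v z} x}.Finite :=
    fun x hx y hy hxy ε hε => s.lac_finite hF hYF hxy (hl y hy (hCi hxy hx)) hε
  let Mx : X → Prop := fun y => y ∈ Y0 ∧ ∀ z, s.E y z → z ∈ Y0 → s.tl F z y
  have hMx : Measurable Mx := (meas_mem measurable_id hY).and
    (s.meas_all (P := fun y z => z ∈ Y0 → s.tl F z y) measurable_id
      ((meas_mem measurable_snd hY).imp (s.meas_tl hF measurable_snd measurable_fst)))
  let C1 : Set X := C ∩ {x | ∃ y, s.E x y ∧ Mx y}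
  have hC1m : MeasurableSet C1 := hC.inter (measurableSet_setOfPred.2
    (s.meas_ex (P := fun _ y => Mx y) measurable_id (hMx.comp measurable_snd)))
  have hC1i : EInvariant s.E C1 := by
    rintro x y hxy ⟨h1, z, h2, h3⟩
    exact ⟨hCi hxy h1, z, s.trans (s.symm hxy) h2, h3⟩
  have hC1 : s.Comp C1 := by
    refine s.comp_of_finite hinf hC1m hC1i (Z := {y | Mx y}) (measurableSet_setOfPred.2 hMx) ?_
    rintro x ⟨hx, y, hxy, hy⟩
    refine ⟨(hfin x hx y hy.1 hxy _ (s.fpos2 hF hxy)).subset ?_, y, hy, hxy⟩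
    rintro z ⟨hz1, hz2⟩
    have hz2 : s.E x z := hz2
    exact ⟨hz2, hz1.1, (s.tl_iff hF hz2 hxy).1 (hy.2 z (s.trans (s.symm hxy) hz2) hz1.1),
      (s.tl_iff hF hxy hz2).1 (hz1.2 y (s.trans (s.symm hz2) hxy) hy.1)⟩
  let Y2 : Set X := {y | y ∈ Y0 ∧ ∀ z, s.E y z → z ∈ Y0 → s.tl F z y → s.tl F y z → s.r y ≤ s.r z}
  have hY2 : MeasurableSet Y2 := measurableSet_setOfPred.2 <| (meas_mem measurable_id hY).and
    (s.meas_all (P := fun y z => z ∈ Y0 → s.tl F z y → s.tl F y z → s.r y ≤ s.r z) measurable_id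
      ((meas_mem measurable_snd hY).imp ((s.meas_tl hF measurable_snd measurable_fst).imp
        ((s.meas_tl hF measurable_fst measurable_snd).imp (measurableSet_setOfPred.1
          (measurableSet_le (s.hr.comp measurable_fst) (s.hr.comp measurable_snd)))))))
  let Y1 : Set X := {x | ∃ y, s.E x y ∧ (F x y ∧ y ∈ Y2)}
  have hY1 : MeasurableSet Y1 := measurableSet_setOfPred.2 <|
    s.meas_ex (P := fun x y => F x y ∧ y ∈ Y2) measurable_id
      ((s.fmeas hF measurable_fst measurable_snd).and (meas_mem measurable_snd hY2))
  have hY1F : ∀ x y, F x y → x ∈ Y1 → y ∈ Y1 := by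
    rintro x y hxy ⟨z, h1, h2, h3⟩
    exact ⟨z, s.trans (s.symm (hF.2.2.1 hxy)) h1, hF.1.trans (hF.1.symm hxy) h2, h3⟩
  have hY2Y1 : Y2 ⊆ Y1 := fun y hy => ⟨y, s.refl y, hF.1.refl y, hy⟩
  have hY1Y0 : Y1 ⊆ Y0 := by
    rintro x ⟨z, h1, h2, h3⟩
    exact hYF _ _ (hF.1.symm h2) h3.1
  -- every size has a representative
  have hrep : ∀ x ∈ C, ∀ y ∈ Y0, s.E x y → ∃ z ∈ Y2, s.E x z ∧
      s.sz {v | F v z} x = s.sz {v | F v y} x := by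
    intro x hx y hy hxy
    obtain ⟨z, hz, hmin⟩ := exists_min_image _ s.r (hfin x hx y hy hxy _ (s.fpos2 hF hxy))
      ⟨y, hxy, hy, le_rfl, le_rfl⟩
    refine ⟨z, ⟨hz.2.1, fun u h1 h2 h3 h4 => hmin u ?_⟩, hz.1, le_antisymm hz.2.2.1 hz.2.2.2⟩
    have hxu := s.trans hz.1 h1
    exact ⟨hxu, h2, ((s.tl_iff hF hxu hz.1).1 h3).trans hz.2.2.1,
      hz.2.2.2.trans ((s.tl_iff hF hz.1 hxu).1 h4)⟩
  -- uniqueness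
  have huniq : ∀ u ∈ Y1, ∀ v ∈ Y1, s.E u v → s.tl F u v → s.tl F v u → F u v := by
    rintro u ⟨u', hu1, hu2, hu3⟩ v ⟨v', hv1, hv2, hv3⟩ huv h1 h2
    have e1 : s.tl F u' v' := by
      rw [s.tl_iff hF hu1 (s.trans huv hv1), ← s.feq hF hu2, ← s.feq hF hv2]; exact h1
    have e2 : s.tl F v' u' := by
      rw [s.tl_iff hF (s.trans huv hv1) hu1, ← s.feq hF hu2, ← s.feq hF hv2]
      exact (s.tl_iff hF huv (s.refl u)).1 h2
    have hE' : s.E u' v' := s.trans (s.symm hu1) (s.trans huv hv1)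
    have : u' = v' := s.hri (le_antisymm (hu3.2 v' hE' hv3.1 e2 e1)
      (hv3.2 u' (s.symm hE') hu3.1 e1 e2))
    subst this
    exact hF.1.trans hu2 (hF.1.symm hv2)
  let R : X → X → Prop := fun x y => x ∈ Y1 ∧ y ∈ Y2 ∧ ¬ s.tl F y x ∧
    ∀ z, s.E x z → z ∈ Y0 → ¬ s.tl F z x → s.tl F y z
  have hR : Measurable fun p : X × X => R p.1 p.2 := by
    refine (meas_mem measurable_fst hY1).and ((meas_mem measurable_snd hY2).and
      ((s.meas_tl hF measurable_snd measurable_fst).not.and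
      (s.meas_all (P := fun (p : X × X) z => z ∈ Y0 → ¬ s.tl F z p.1 → s.tl F p.2 z) measurable_fst
        ((meas_mem measurable_snd hY).imp (Measurable.imp (Measurable.not ?_) ?_)))))
    · exact s.meas_tl hF measurable_snd (measurable_fst.comp measurable_fst)
    · exact s.meas_tl hF (measurable_snd.comp measurable_fst) measurable_snd
  have hspec : ∀ x ∈ C \ C1, x ∈ Y1 → R x (s.sel R x) := by
    intro x hx hx1
    apply s.sel_spec
    have : ¬ Mx x := fun h => hx.2 ⟨hx.1, x, s.refl x, h⟩
    simp only [Mx, not_and, not_forall] at this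
    obtain ⟨y, hxy, hy, hlt⟩ := this (hY1Y0 hx1)
    have hlt' : s.sz {v | F v x} x < s.sz {v | F v y} x :=
      not_le.1 fun h => hlt ((s.tl_iff hF hxy (s.refl x)).2 h)
    have hfin2 := hfin x hx.1 y hy hxy _ (s.fpos2 hF (s.refl x))
    obtain ⟨z, hz, hmin⟩ := exists_min_image ({z | s.E x z ∧ z ∈ Y0 ∧
      s.sz {v | F v z} x ≤ s.sz {v | F v y} x ∧ s.sz {v | F v x} x ≤ s.sz {v | F v z} x} ∩
        {z | s.sz {v | F v x} x < s.sz {v | F v z} x}) (fun z => s.sz {v | F v z} x)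
      (hfin2.subset inter_subset_left) ⟨y, ⟨hxy, hy, le_rfl, hlt'.le⟩, hlt'⟩
    obtain ⟨z', hz', hxz', heq⟩ := hrep x hx.1 z hz.1.2.1 hz.1.1
    refine ⟨z', hxz', hx1, hz', ?_, ?_⟩
    · rw [s.tl_iff hF hxz' (s.refl x), heq, not_le]
      exact hz.2
    · intro u hxu hu hlu
      rw [s.tl_iff hF hxz' hxu, heq]
      rw [s.tl_iff hF hxu (s.refl x), not_le] at hlu
      rcases le_total (s.sz {v | F v u} x) (s.sz {v | F v y} x) with h | h
      · exact hmin u ⟨⟨hxu, hu, h, hlu.le⟩, hlu⟩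
      · exact hz.1.2.2.1.trans h
  have hneg : ∀ x, x ∉ Y1 → s.sel R x = x := by
    intro x hx
    apply s.sel_neg
    rintro ⟨y, -, h, -⟩
    exact hx h
  have hC2m : MeasurableSet (C \ C1) := hC.diff hC1m
  have hC2i : EInvariant s.E (C \ C1) := fun x y hxy hx =>
    ⟨hCi hxy hx.1, fun h => hx.2 (hC1i (s.symm hxy) h)⟩
  have hout : ∀ x ∈ C \ C1, x ∉ Y1 → s.sel R ⁻¹' {y | F y x} ⊆ {y | F y x} := by
    intro x hx hx1 y hy
    have hy : F (s.sel R y) x := hy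
    by_cases hy1 : y ∈ Y1
    · have hyC := hC2i (s.symm (s.trans (s.sel_E R y) (hF.2.2.1 hy))) hx
      exact absurd (hY1F _ _ hy (hY2Y1 (hspec y hyC hy1).2.1)) hx1
    · rw [hneg y hy1] at hy; exact hy
  have hin : ∀ x ∈ C \ C1, x ∈ Y1 → s.sel R ⁻¹' {y | F y x} = ∅ ∨
      ∃ u, s.E x u ∧ s.sel R ⁻¹' {y | F y x} ⊆ {y | F y u} ∧
        s.sz {v | F v u} x < s.sz {v | F v x} x := by
    intro x hx hx1
    have hb : ∀ y, F (s.sel R y) x → s.E x y ∧ y ∈ Y1 ∧ R y (s.sel R y) := by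
      intro y hy
      have hE := s.symm (s.trans (s.sel_E R y) (hF.2.2.1 hy))
      have hy1 : y ∈ Y1 := by
        by_contra h
        rw [hneg y h] at hy
        exact h (hY1F _ _ (hF.1.symm hy) hx1)
      exact ⟨hE, hy1, hspec y (hC2i hE hx) hy1⟩
    have hb2 : ∀ y, F (s.sel R y) x → s.sz {v | F v y} x < s.sz {v | F v x} x := by
      intro y hy
      obtain ⟨h1, h2, h3⟩ := hb y hy
      have := h3.2.2.1
      rw [s.tl_iff hF (s.symm (hF.2.2.1 hy)) h1, not_le, s.feq hF hy] at this
      exact this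
    have hb3 : ∀ y z, F (s.sel R y) x → F (s.sel R z) x → s.tl F y z := by
      intro y z hy hz
      obtain ⟨h1, h2, h3⟩ := hb y hy
      obtain ⟨h1', h2', h3'⟩ := hb z hz
      by_contra hcon
      have := h3'.2.2.2 y (s.trans (s.symm h1') h1) (hY1Y0 h2) hcon
      rw [s.tl_iff hF (s.symm (hF.2.2.1 hz)) h1, s.feq hF hz] at this
      exact absurd this (not_le.2 (hb2 y hy))
    rcases (s.sel R ⁻¹' {y | F y x}).eq_empty_or_nonempty with h | ⟨u, hu⟩
    · exact Or.inl h
    · refine Or.inr ⟨u, (hb u hu).1, fun y hy => ?_, hb2 u hu⟩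
      obtain ⟨h1, h2, h3⟩ := hb y hy
      obtain ⟨h1', h2', h3'⟩ := hb u hu
      exact huniq y h2 u h2' (s.trans (s.symm h1) h1') (hb3 y u hy hu) (hb3 u y hu hy)
  have hC2 : s.Comp (C \ C1) := by
    refine ⟨hC2m, hC2i, s.sel R, F, s.sel_meas hR, hF, s.sel_E R, fun x hx => ⟨?_, ?_, ?_⟩⟩
    · have hsub : s.sel R ⁻¹' {x} ⊆ s.sel R ⁻¹' {y | F y x} :=
        preimage_mono (singleton_subset_iff.2 (s.fself hF x))
      refine Finite.subset ?_ hsub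
      by_cases hx1 : x ∈ Y1
      · rcases hin x hx hx1 with h | ⟨u, _, hu, _⟩
        · rw [h]; exact finite_empty
        · exact (s.ffin hF u).subset hu
      · exact (s.ffin hF x).subset (hout x hx hx1)
    · by_cases hx1 : x ∈ Y1
      · rcases hin x hx hx1 with h | ⟨u, _, hu, hlt⟩
        · rw [h]; simp
        · exact (sm_mono _ hu).trans hlt.le
      · exact sm_mono _ (hout x hx hx1)
    · obtain ⟨y, hy, hxy⟩ := hYC x hx.1
      obtain ⟨z, hz, hxz, -⟩ := hrep x hx.1 y hy hxy
      refine ⟨z, hxz, ?_⟩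
      rcases hin z (hC2i hxz hx) (hY2Y1 hz) with h | ⟨u, _, hu, hlt⟩
      · rw [h]; simp only [sm_empty]; exact pos_iff_ne_zero.2 (s.fpos hF z)
      · exact (sm_mono _ hu).trans_lt hlt
  refine (hC1.union hC2).mono hC hCi fun x hx => ?_
  by_cases h : x ∈ C1
  · exact Or.inl h
  · exact Or.inr ⟨hx, h⟩

end Sys
end CocycleNadkarni
end

section
set_option linter.unusedSectionVars false
set_option linter.style.haveILetI false
open MeasureTheory Set ENNReal
namespace CocycleNadkarni
namespace Sys
variable {X : Type*} [MeasurableSpace X] [StandardBorelSpace X] (s : Sys X)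

theorem big_sub {F : X → X → Prop} (hF : IsFinSubequiv s.E F) {Q : Set X} {x : X}
    (hQF : ∀ x y, F x y → x ∈ Q → y ∈ Q) (hQ : s.sz Q x = ⊤) {N : ℝ≥0∞} (hN : N ≠ ⊤) :
    ∃ U ⊆ Q, U.Finite ∧ (∀ x y, F x y → x ∈ U → y ∈ U) ∧ N ≤ s.sz U x := by
  by_contra hcon
  push Not at hcon
  have : s.sz Q x ≤ N := by
    refine sm_le_of_finset fun S hS => ?_
    let U : Set X := ⋃ a ∈ S, {y | F y a}
    have h1 : (S : Set X) ⊆ U := fun a ha => mem_biUnion ha (s.fself hF a)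
    refine (sm_mono _ h1).trans (hcon U ?_ ?_ ?_).le
    · intro y hy
      simp only [U, mem_iUnion] at hy
      obtain ⟨a, ha, hy⟩ := hy
      exact hQF _ _ (hF.1.symm hy) (hS ha)
    · exact S.finite_toSet.biUnion fun a _ => s.ffin hF a
    · intro u v huv hu
      simp only [U, mem_iUnion] at hu ⊢
      obtain ⟨a, ha, hy⟩ := hu
      exact ⟨a, ha, hF.1.trans (hF.1.symm huv) hy⟩
  rw [hQ] at this
  exact hN (top_le_iff.1 this)

theorem meas_lac {F : X → X → Prop} (hF : IsFinSubequiv s.E F) {Y : Set X}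
    (hY : MeasurableSet Y) :
    Measurable fun y => s.sz {z | s.E y z ∧ z ∈ Y ∧ s.tl F z y} y ≠ ⊤ := by
  refine Measurable.not (measurableSet_setOfPred.1 (measurableSet_eq_fun ?_ measurable_const))
  refine s.meas_sz (P := fun y z => s.E y z ∧ z ∈ Y ∧ s.tl F z y) measurable_id measurable_id
    ?_ (fun z y h => h.1)
  exact (s.meas_E measurable_fst measurable_snd).and ((meas_mem measurable_snd hY).and
    (s.meas_tl hF measurable_snd measurable_fst))

theorem lacF {F : X → X → Prop} (hF : IsFinSubequiv s.E F) {Y : Set X}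
    (hYF : ∀ x y, F x y → x ∈ Y → y ∈ Y) (y : X) :
    ∀ u v, F u v → u ∈ {z | s.E y z ∧ z ∈ Y ∧ s.tl F z y} →
      v ∈ {z | s.E y z ∧ z ∈ Y ∧ s.tl F z y} := by
  rintro u v huv ⟨h1, h2, h3⟩
  have h4 := s.trans h1 (hF.2.2.1 huv)
  refine ⟨h4, hYF _ _ huv h2, ?_⟩
  rw [s.tl_iff hF h4 (s.refl y), ← s.feq hF huv]
  exact (s.tl_iff hF h1 (s.refl y)).1 h3

theorem meas_sat {Y : Set X} (hY : MeasurableSet Y) : MeasurableSet {x | ∃ y, s.E x y ∧ y ∈ Y} :=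
  measurableSet_setOfPred.2 (s.meas_ex (P := fun _ y => y ∈ Y) measurable_id
    (meas_mem measurable_snd hY))

theorem sat_inv {Y : Set X} : EInvariant s.E {x | ∃ y, s.E x y ∧ y ∈ Y} := by
  rintro x y hxy ⟨z, h1, h2⟩
  exact ⟨z, s.trans (s.symm hxy) h1, h2⟩

theorem diff_lemma (hinf : s.Inf) {F : X → X → Prop} (hF : IsFinSubequiv s.E F) {ε : ℝ≥0∞}
    (hε : ε ≠ 0) (hε' : ε ≠ ⊤) : ∃ (F' : X → X → Prop) (C : Set X), IsFinSubequiv s.E F' ∧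
      (∀ x y, F x y → F' x y) ∧ s.Comp C ∧ ∀ x, x ∉ C → 1 ≤ ε * s.sz {y | F' y x} x := by
  obtain ⟨F', Y, hF', hFF', hY, hYF, hΦ, hmax⟩ := s.max_lemma hF
    (fun x S => ∀ y ∈ S, s.w x y ≤ ε * s.sz S x) (by
      intro x y S hS hSE hxy h z hz
      rw [s.sz_base (z := x) (z' := y) hSE hxy, ← mul_assoc,
        s.w_mul (x := z) (y := x) (s.symm (hSE z hz)) hxy]
      exact mul_le_mul_left (h z hz) _) (by
      intro I
      have : (fun x => ∀ y ∈ s.Tset I x, s.w x y ≤ ε * s.sz (s.Tset I x) x) =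
          fun x => ∀ i, i ∈ I → s.w x (s.G i x) ≤ ε * s.sz (univ ∩ s.Tset I x) x := by
        funext x
        simp [Tset]
      rw [this]
      refine Measurable.forall fun i => Measurable.forall fun _ => measurableSet_setOfPred.1 ?_
      exact measurableSet_le (s.meas_w measurable_id (s.G i).measurable)
        ((s.meas_sz_Tset I MeasurableSet.univ).const_mul ε))
  have hYFF : ∀ x y, F x y → x ∈ Y → y ∈ Y := fun x y h hx => (hYF x y (hFF' x y h) hx).1
  refine ⟨F', {x | ∃ y, s.E x y ∧ y ∈ Y}, hF', hFF', ?_, ?_⟩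
  · refine s.lac_comp hinf hF (s.meas_sat hY) s.sat_inv hY hYFF ?_ ?_
    · rintro x ⟨y, h1, h2⟩; exact ⟨y, h2, h1⟩
    · intro y hy _ htop
      obtain ⟨U, hUQ, hUf, hUF, hU⟩ := s.big_sub hF (s.lacF hF hYFF y) htop
        (N := s.sz {z | F z y} y / ε) (ENNReal.div_ne_top (s.ftop hF y y) hε)
      refine hmax y U hUf ?_ (fun z hz => (hUQ hz).1) (fun z hz => (hUQ hz).2.1) hUF ?_
      · by_contra hne
        rw [not_nonempty_iff_eq_empty.1 hne] at hU
        simp only [sm_empty, nonpos_iff_eq_zero, ENNReal.div_eq_zero_iff] at hU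
        exact hU.elim (s.fpos hF y) hε'
      · intro z hz
        obtain ⟨h1, h2, h3⟩ := hUQ hz
        rw [ENNReal.div_le_iff hε hε', mul_comm] at hU
        refine le_trans ?_ hU
        refine le_trans ?_ ((s.tl_iff hF h1 (s.refl y)).1 h3)
        exact le_sm _ (s.fself hF z)
  · intro x hx
    have := hΦ x (fun h => hx ⟨x, s.refl x, h⟩) x (s.fself hF' x)
    rwa [s.w_self] at this

theorem step_core {F : X → X → Prop} (hF : IsFinSubequiv s.E F) {A Y : Set X}
    {p q : ℝ≥0∞} (hpq : p < q) (hq : q ≠ ⊤)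
    (hYF : ∀ x y, F x y → x ∈ Y → y ∈ Y)
    (hmax : ∀ (x : X) (S : Set X), S.Finite → S.Nonempty → (∀ z ∈ S, s.E x z) → S ⊆ Y →
      (∀ y z, F y z → y ∈ S → z ∈ S) →
      ¬ (p * s.sz S x ≤ s.sz (A ∩ S) x ∧ s.sz (A ∩ S) x ≤ q * s.sz S x))
    {h l : X} (hhl : s.E h l)
    (hH : s.sz {z | s.E h z ∧ z ∈ {y | y ∈ Y ∧ q * s.sz {v | F v y} y < s.sz (A ∩ {v | F v y}) y}
      ∧ s.tl F z h} h = ⊤)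
    (hL : s.sz {z | s.E l z ∧ z ∈ {y | y ∈ Y ∧ s.sz (A ∩ {v | F v y}) y < p * s.sz {v | F v y} y}
      ∧ s.tl F z l} l = ⊤) : False := by
  classical
  have hp : p ≠ ⊤ := hpq.ne_top
  set H := {y | y ∈ Y ∧ q * s.sz {v | F v y} y < s.sz (A ∩ {v | F v y}) y} with hHd
  set L := {y | y ∈ Y ∧ s.sz (A ∩ {v | F v y}) y < p * s.sz {v | F v y} y} with hLd
  have hAE : ∀ y, ∀ v ∈ A ∩ {v | F v y}, s.E y v := fun y v hv => s.fE hF y v hv.2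
  have chgH : ∀ x y, s.E x y → (q * s.sz {v | F v y} y ≤ s.sz (A ∩ {v | F v y}) y ↔
      q * s.sz {v | F v y} x ≤ s.sz (A ∩ {v | F v y}) x) := by
    intro x y hxy
    have := s.sz_le_base (a := q) (b := 1) (z := y) (z' := x) (s.fE hF y) (hAE y) (s.symm hxy)
    rw [one_mul, one_mul] at this
    exact this.symm
  have chgL : ∀ x y, s.E x y → (s.sz (A ∩ {v | F v y}) y ≤ p * s.sz {v | F v y} y ↔
      s.sz (A ∩ {v | F v y}) x ≤ p * s.sz {v | F v y} x) := by
    intro x y hxy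
    have := s.sz_le_base (a := 1) (b := p) (z := y) (z' := x) (hAE y) (s.fE hF y) (s.symm hxy)
    rw [one_mul, one_mul] at this
    exact this.symm
  have hHF : ∀ x y, F x y → x ∈ H → y ∈ H := by
    rintro x y hxy ⟨h1, h2⟩
    refine ⟨hYF _ _ hxy h1, ?_⟩
    rw [s.feq hF hxy, ← not_le] at h2
    rw [← not_le]
    intro h3
    apply h2
    have := s.sz_le_base (a := 1) (b := q) (z := y) (z' := x) (hAE y) (s.fE hF y)
      (s.symm (hF.2.2.1 hxy))
    rw [one_mul, one_mul] at this
    exact this.2 h3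
  have hLF : ∀ x y, F x y → x ∈ L → y ∈ L := by
    rintro x y hxy ⟨h1, h2⟩
    refine ⟨hYF _ _ hxy h1, ?_⟩
    rw [s.feq hF hxy, ← not_le] at h2
    rw [← not_le]
    intro h3
    apply h2
    have := s.sz_le_base (a := p) (b := 1) (z := y) (z' := x) (s.fE hF y) (hAE y)
      (s.symm (hF.2.2.1 hxy))
    rw [one_mul, one_mul] at this
    exact this.2 h3
  have hdisj : Disjoint H L := by
    rw [Set.disjoint_left]
    rintro y ⟨_, h1⟩ ⟨_, h2⟩
    have : q * s.sz {v | F v y} y < q * s.sz {v | F v y} y :=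
      (h1.trans h2).trans_le (mul_le_mul_left hpq.le _)
    exact lt_irrefl _ this
  -- averages on invariant subsets
  have avH : ∀ U ⊆ H, (∀ z ∈ U, s.E h z) → (∀ x y, F x y → x ∈ U → y ∈ U) →
      q * s.sz U h ≤ s.sz (A ∩ U) h := by
    intro U hU hUE hUF
    have : sm (fun y => q * s.w h y) U ≤ sm (A.indicator (s.w h)) U := by
      refine sm_piece hF.1 hUF fun y hy => ?_
      have := (chgH h y (hUE y hy)).1 (hU hy).2.le
      rw [sm_mul_left]
      refine this.trans (le_of_eq ?_)
      simp only [sz, sm_eq, ← indicator_indicator, inter_comm A]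
    rw [sm_mul_left] at this
    refine this.trans (le_of_eq ?_)
    simp only [sz, sm_eq, ← indicator_indicator, inter_comm A]
  have avL : ∀ V ⊆ L, (∀ z ∈ V, s.E h z) → (∀ x y, F x y → x ∈ V → y ∈ V) →
      s.sz (A ∩ V) h ≤ p * s.sz V h := by
    intro U hU hUE hUF
    have : sm (A.indicator (s.w h)) U ≤ sm (fun y => p * s.w h y) U := by
      refine sm_piece hF.1 hUF fun y hy => ?_
      have := (chgL h y (hUE y hy)).1 (hU hy).2.le
      rw [sm_mul_left]
      refine le_trans (le_of_eq ?_) this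
      simp only [sz, sm_eq, ← indicator_indicator, inter_comm A]
    rw [sm_mul_left] at this
    refine le_trans (le_of_eq ?_) this
    simp only [sz, sm_eq, ← indicator_indicator, inter_comm A]
  have hL' : s.sz {z | s.E l z ∧ z ∈ L ∧ s.tl F z l} h = ⊤ := by
    rw [s.sz_base (z := l) (z' := h) (fun z hz => hz.1) (s.symm hhl), hL]
    exact ENNReal.top_mul (s.w_pos hhl).ne'
  set M := s.sz {v | F v l} h with hM
  have hMt : M ≠ ⊤ := s.ftop hF l h
  have hM0 : M ≠ 0 := s.fpos2 hF hhl
  have hqp : q - p ≠ 0 := (tsub_pos_of_lt hpq).ne'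
  have hqp' : q - p ≠ ⊤ := ENNReal.sub_ne_top hq
  have hqe : q = p + (q - p) := (add_tsub_cancel_of_le hpq.le).symm
  obtain ⟨U, hUQ, hUf, hUF, hU⟩ := s.big_sub hF (s.lacF hF hHF h) hH
    (N := (p * M + 1) / (q - p)) (ENNReal.div_ne_top (by finiteness) hqp)
  have hUE : ∀ z ∈ U, s.E h z := fun z hz => (hUQ hz).1
  have hUH : U ⊆ H := fun z hz => (hUQ hz).2.1
  have hUt : s.sz U h ≠ ⊤ := (s.sz_lt_top h hUf).ne
  have hUne : U.Nonempty := by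
    by_contra hne
    rw [not_nonempty_iff_eq_empty.1 hne] at hU
    simp only [sm_empty, nonpos_iff_eq_zero, ENNReal.div_eq_zero_iff] at hU
    rcases hU with h | h
    · simp at h
    · exact hqp' h
  rw [ENNReal.div_le_iff hqp hqp', mul_comm (s.sz U h)] at hU
  have hU' : p * M ≤ (q - p) * s.sz U h := le_self_add.trans hU
  let good : Set X → Prop := fun V => V.Finite ∧ V ⊆ {z | s.E l z ∧ z ∈ L ∧ s.tl F z l} ∧
    (∀ x y, F x y → x ∈ V → y ∈ V) ∧ s.sz (A ∩ (U ∪ V)) h ≤ q * s.sz (U ∪ V) h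
  have hex : ∃ n, ∃ V, good V ∧ V.ncard = n := by
    obtain ⟨V, hVQ, hVf, hVF, hV⟩ := s.big_sub hF (s.lacF hF hLF l) hL'
      (N := s.sz U h / (q - p)) (ENNReal.div_ne_top hUt hqp)
    refine ⟨_, V, ⟨hVf, hVQ, hVF, ?_⟩, rfl⟩
    rw [ENNReal.div_le_iff hqp hqp', mul_comm] at hV
    have hVE : ∀ z ∈ V, s.E h z := fun z hz => s.trans hhl (hVQ hz).1
    have e1 : s.sz (A ∩ (U ∪ V)) h ≤ s.sz U h + p * s.sz V h := by
      rw [inter_union_distrib_left]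
      refine (sm_union_le _ _ _).trans (add_le_add (sm_mono _ inter_subset_right) ?_)
      exact avL V (fun z hz => (hVQ hz).2.1) hVE hVF
    refine e1.trans ((add_le_add_left hV _).trans ?_)
    rw [← add_mul, tsub_add_cancel_of_le hpq.le]
    exact mul_le_mul_right (sm_mono _ subset_union_right) _
  obtain ⟨V, ⟨hVf, hVQ, hVF, hV⟩, hVc⟩ := Nat.find_spec hex
  have hVE : ∀ z ∈ V, s.E h z := fun z hz => s.trans hhl (hVQ hz).1
  refine hmax h (U ∪ V) (hUf.union hVf) (hUne.mono subset_union_left) ?_ ?_ ?_ ⟨?_, hV⟩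
  · rintro z (hz | hz)
    · exact hUE z hz
    · exact hVE z hz
  · rintro z (hz | hz)
    · exact (hUH hz).1
    · exact (hVQ hz).2.1.1
  · rintro y z hyz (hy | hy)
    · exact Or.inl (hUF y z hyz hy)
    · exact Or.inr (hVF y z hyz hy)
  · rcases V.eq_empty_or_nonempty with rfl | ⟨v, hv⟩
    · rw [union_empty]
      exact (mul_le_mul_left hpq.le _).trans (avH U hUH hUE hUF)
    · have hlt : (V \ {z | F z v}).ncard < V.ncard :=
        ncard_lt_ncard ⟨sdiff_subset, fun hcon => (hcon hv).2 (s.fself hF v)⟩ hVf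
      have hng : ¬ good (V \ {z | F z v}) := by
        intro hg
        rw [hVc] at hlt
        exact Nat.find_min hex hlt ⟨_, hg, rfl⟩
      have hng2 : q * s.sz (U ∪ V \ {z | F z v}) h < s.sz (A ∩ (U ∪ V \ {z | F z v})) h := by
        by_contra hcon
        refine hng ⟨hVf.subset sdiff_subset, sdiff_subset.trans hVQ, ?_, not_lt.1 hcon⟩
        rintro x y hxy ⟨h1, h2⟩
        exact ⟨hVF x y hxy h1, fun h3 => h2 (hF.1.trans hxy h3)⟩
      have hvM : s.sz {z | F z v} h ≤ M :=
        (s.tl_iff hF (hVE v hv) hhl).1 (hVQ hv).2.2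
      calc p * s.sz (U ∪ V) h
          ≤ p * (s.sz (U ∪ V \ {z | F z v}) h + s.sz {z | F z v} h) := by
            refine mul_le_mul_right ((sm_mono _ ?_).trans (sm_union_le _ _ _)) _
            rintro z (hz | hz)
            · exact Or.inl (Or.inl hz)
            · by_cases h' : F z v
              · exact Or.inr h'
              · exact Or.inl (Or.inr ⟨hz, h'⟩)
        _ ≤ p * s.sz (U ∪ V \ {z | F z v}) h + (q - p) * s.sz (U ∪ V \ {z | F z v}) h := by
            rw [mul_add]
            refine add_le_add_right ?_ _
            refine (mul_le_mul_right hvM _).trans (hU'.trans ?_)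
            exact mul_le_mul_right (sm_mono _ subset_union_left) _
        _ = q * s.sz (U ∪ V \ {z | F z v}) h := by
            rw [← add_mul, add_tsub_cancel_of_le hpq.le]
        _ ≤ s.sz (A ∩ (U ∪ V \ {z | F z v})) h := hng2.le
        _ ≤ s.sz (A ∩ (U ∪ V)) h := sm_mono _
            (inter_subset_inter_right _ (union_subset_union_right _ sdiff_subset))

theorem step_lemma (hinf : s.Inf) {F : X → X → Prop} (hF : IsFinSubequiv s.E F) {A : Set X}
    (hA : MeasurableSet A) {p q : ℝ≥0∞} (hpq : p < q) (hq : q ≠ ⊤) :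
    ∃ (F' : X → X → Prop) (C : Set X), IsFinSubequiv s.E F' ∧
      (∀ x y, F x y → F' x y) ∧ s.Comp C ∧ ∀ x, x ∉ C →
        ((∀ y, s.E x y → p * s.sz {z | F' z y} y ≤ s.sz (A ∩ {z | F' z y}) y) ∨
          ∀ y, s.E x y → s.sz (A ∩ {z | F' z y}) y ≤ q * s.sz {z | F' z y} y) := by
  have hp : p ≠ ⊤ := hpq.ne_top
  obtain ⟨F', Y, hF', hFF', hY, hYF, hΦ, hmax⟩ := s.max_lemma hF
    (fun x S => p * s.sz S x ≤ s.sz (A ∩ S) x ∧ s.sz (A ∩ S) x ≤ q * s.sz S x) (by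
      rintro x y S hS hSE hxy ⟨h1, h2⟩
      have hASE : ∀ z ∈ A ∩ S, s.E x z := fun z hz => hSE z hz.2
      rw [s.sz_base (z := x) (z' := y) hSE hxy, s.sz_base (z := x) (z' := y) hASE hxy,
        ← mul_assoc, ← mul_assoc]
      exact ⟨mul_le_mul_left h1 _, mul_le_mul_left h2 _⟩) (by
      intro I
      have h1 := s.meas_sz_Tset I MeasurableSet.univ
      simp only [univ_inter] at h1
      have h2 := s.meas_sz_Tset I hA
      exact (measurableSet_setOfPred.1 (measurableSet_le (h1.const_mul p) h2)).and
        (measurableSet_setOfPred.1 (measurableSet_le h2 (h1.const_mul q))))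
  have hYFF : ∀ x y, F x y → x ∈ Y → y ∈ Y := fun x y h hx => (hYF x y (hFF' x y h) hx).1
  let H : Set X := {y | y ∈ Y ∧ q * s.sz {v | F v y} y < s.sz (A ∩ {v | F v y}) y}
  let L : Set X := {y | y ∈ Y ∧ s.sz (A ∩ {v | F v y}) y < p * s.sz {v | F v y} y}
  have hm1 := s.fszm hF
  have hm2 : Measurable fun y => s.sz (A ∩ {v | F v y}) y :=
    s.meas_sz (P := fun y v => v ∈ A ∧ F v y) measurable_id measurable_id
      ((meas_mem measurable_snd hA).and (s.fmeas hF measurable_snd measurable_fst))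
      fun z y h => s.symm (hF.2.2.1 h.2)
  have hHm : MeasurableSet H := hY.inter (measurableSet_lt (hm1.const_mul q) hm2)
  have hLm : MeasurableSet L := hY.inter (measurableSet_lt hm2 (hm1.const_mul p))
  have hAE : ∀ y, ∀ v ∈ A ∩ {v | F v y}, s.E y v := fun y v hv => s.fE hF y v hv.2
  have hHF : ∀ x y, F x y → x ∈ H → y ∈ H := by
    rintro x y hxy ⟨h1, h2⟩
    refine ⟨hYFF _ _ hxy h1, ?_⟩
    rw [s.feq hF hxy, ← not_le] at h2
    rw [← not_le]
    intro h3
    apply h2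
    have := s.sz_le_base (a := 1) (b := q) (z := y) (z' := x) (hAE y) (s.fE hF y)
      (s.symm (hF.2.2.1 hxy))
    rw [one_mul, one_mul] at this
    exact this.2 h3
  have hLF : ∀ x y, F x y → x ∈ L → y ∈ L := by
    rintro x y hxy ⟨h1, h2⟩
    refine ⟨hYFF _ _ hxy h1, ?_⟩
    rw [s.feq hF hxy, ← not_le] at h2
    rw [← not_le]
    intro h3
    apply h2
    have := s.sz_le_base (a := p) (b := 1) (z := y) (z' := x) (s.fE hF y) (hAE y)
      (s.symm (hF.2.2.1 hxy))
    rw [one_mul, one_mul] at this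
    exact this.2 h3
  let lacS : Set X → Set X := fun Z => {x | ∀ y, s.E x y → (y ∈ Z →
    s.sz {z | s.E y z ∧ z ∈ Z ∧ s.tl F z y} y ≠ ⊤)}
  have hlm : ∀ Z, MeasurableSet Z → MeasurableSet (lacS Z) := fun Z hZ => measurableSet_setOfPred.2 <|
    s.meas_all (P := fun _ y => y ∈ Z → s.sz {z | s.E y z ∧ z ∈ Z ∧ s.tl F z y} y ≠ ⊤)
      measurable_id ((meas_mem measurable_snd hZ).imp ((s.meas_lac hF hZ).comp measurable_snd))
  have hli : ∀ Z, EInvariant s.E (lacS Z) := fun Z x y hxy hx z hyz => hx z (s.trans hxy hyz)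
  let B : Set X := {x | ∃ y, s.E x y ∧ y ∈ H} ∩ {x | ∃ y, s.E x y ∧ y ∈ L}
  have hBm : MeasurableSet B := (s.meas_sat hHm).inter (s.meas_sat hLm)
  have hBi : EInvariant s.E B := fun x y hxy hx => ⟨s.sat_inv hxy hx.1, s.sat_inv hxy hx.2⟩
  have hBH : s.Comp (B ∩ lacS H) := by
    refine s.lac_comp hinf hF (hBm.inter (hlm H hHm))
      (fun x y hxy hx => ⟨hBi hxy hx.1, hli H hxy hx.2⟩) hHm hHF ?_ ?_
    · rintro x ⟨⟨⟨y, h1, h2⟩, _⟩, _⟩; exact ⟨y, h2, h1⟩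
    · intro y hy hyC
      exact hyC.2 y (s.refl y) hy
  have hBL : s.Comp (B ∩ lacS L) := by
    refine s.lac_comp hinf hF (hBm.inter (hlm L hLm))
      (fun x y hxy hx => ⟨hBi hxy hx.1, hli L hxy hx.2⟩) hLm hLF ?_ ?_
    · rintro x ⟨⟨_, ⟨y, h1, h2⟩⟩, _⟩; exact ⟨y, h2, h1⟩
    · intro y hy hyC
      exact hyC.2 y (s.refl y) hy
  refine ⟨F', _, hF', hFF', hBH.union hBL, fun x hx => ?_⟩
  have hxB : x ∉ B := by
    intro hxB
    have h1 : x ∉ lacS H := fun h => hx (Or.inl ⟨hxB, h⟩)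
    have h2 : x ∉ lacS L := fun h => hx (Or.inr ⟨hxB, h⟩)
    simp only [lacS, mem_ofPred_eq, not_forall, not_not] at h1 h2
    obtain ⟨h, hh1, _, hh3⟩ := h1
    obtain ⟨l, hl1, _, hl3⟩ := h2
    exact s.step_core hF hpq hq hYFF hmax (s.trans (s.symm hh1) hl1) hh3 hl3
  have hcl : ∀ y ∈ Y, {z | F' z y} = {z | F z y} := by
    intro y hy
    ext z
    exact ⟨fun h => hF.1.symm (hYF y z (hF'.1.symm h) hy).2, fun h => hFF' _ _ h⟩
  by_cases hxH : ∃ y, s.E x y ∧ y ∈ H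
  · refine Or.inl fun y hxy => ?_
    by_cases hy : y ∈ Y
    · rw [hcl y hy]
      by_contra hcon
      exact hxB ⟨hxH, y, hxy, hy, not_le.1 hcon⟩
    · exact (hΦ y hy).1
  · refine Or.inr fun y hxy => ?_
    by_cases hy : y ∈ Y
    · rw [hcl y hy]
      by_contra hcon
      exact hxH ⟨y, hxy, hy, not_le.1 hcon⟩
    · exact (hΦ y hy).2

end Sys
end CocycleNadkarni
end

section
set_option linter.unusedSectionVars false
set_option linter.style.haveILetI false
open MeasureTheory Set ENNReal
namespace CocycleNadkarni
namespace Sys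
variable {X : Type*} [MeasurableSpace X] [StandardBorelSpace X] (s : Sys X)

/-- average of `A` over the tile of `y` -/
noncomputable def av (F : X → X → Prop) (A : Set X) (y : X) : ℝ≥0∞ :=
  s.sz (A ∩ {z | F z y}) y / s.sz {z | F z y} y

theorem le_av {F : X → X → Prop} (hF : IsFinSubequiv s.E F) {A : Set X} {y : X} {a : ℝ≥0∞} :
    a ≤ s.av F A y ↔ a * s.sz {z | F z y} y ≤ s.sz (A ∩ {z | F z y}) y := by
  rw [av, ENNReal.le_div_iff_mul_le (Or.inl (s.fpos hF y)) (Or.inl (s.ftop hF y y))]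

theorem av_le {F : X → X → Prop} (hF : IsFinSubequiv s.E F) {A : Set X} {y : X} {a : ℝ≥0∞} :
    s.av F A y ≤ a ↔ s.sz (A ∩ {z | F z y}) y ≤ a * s.sz {z | F z y} y := by
  rw [av, ENNReal.div_le_iff (s.fpos hF y) (s.ftop hF y y)]

theorem le_av_base {F : X → X → Prop} (hF : IsFinSubequiv s.E F) {A : Set X} {x y : X} {a : ℝ≥0∞}
    (h : s.E x y) :
    a ≤ s.av F A y ↔ a * s.sz {z | F z y} x ≤ s.sz (A ∩ {z | F z y}) x := by
  rw [s.le_av hF]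
  have := s.sz_le_base (a := a) (b := 1) (z := y) (z' := x) (s.fE hF y)
    (Y' := A ∩ {z | F z y}) (fun v hv => s.fE hF y v hv.2) (s.symm h)
  rw [one_mul, one_mul] at this
  exact this.symm

theorem av_le_base {F : X → X → Prop} (hF : IsFinSubequiv s.E F) {A : Set X} {x y : X} {a : ℝ≥0∞}
    (h : s.E x y) :
    s.av F A y ≤ a ↔ s.sz (A ∩ {z | F z y}) x ≤ a * s.sz {z | F z y} x := by
  rw [s.av_le hF]
  have := s.sz_le_base (a := 1) (b := a) (z := y) (z' := x)
    (Y := A ∩ {z | F z y}) (fun v hv => s.fE hF y v hv.2) (s.fE hF y) (s.symm h)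
  rw [one_mul, one_mul] at this
  exact this.symm

theorem sm_inter_ind (f : X → ℝ≥0∞) (A U : Set X) : sm f (A ∩ U) = sm (A.indicator f) U := by
  simp only [sm_eq, ← indicator_indicator, inter_comm A]

theorem low_mono {F F' : X → X → Prop} (hF : IsFinSubequiv s.E F) (hF' : IsFinSubequiv s.E F')
    (hFF' : ∀ x y, F x y → F' x y) {A : Set X} {x : X} {a : ℝ≥0∞}
    (h : ∀ y, s.E x y → a ≤ s.av F A y) : ∀ y, s.E x y → a ≤ s.av F' A y := by
  intro y hxy
  rw [s.le_av hF', sz, sz, sm_inter_ind, ← sm_mul_left]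
  refine sm_piece hF.1 (fun u v huv hu => hF'.1.trans (hF'.1.symm (hFF' _ _ huv)) hu) ?_
  intro v hv
  have hyv : s.E y v := s.fE hF' y v hv
  rw [sm_mul_left, ← sm_inter_ind]
  exact (s.le_av_base hF hyv).1 (h v (s.trans hxy hyv))

theorem up_mono {F F' : X → X → Prop} (hF : IsFinSubequiv s.E F) (hF' : IsFinSubequiv s.E F')
    (hFF' : ∀ x y, F x y → F' x y) {A : Set X} {x : X} {a : ℝ≥0∞}
    (h : ∀ y, s.E x y → s.av F A y ≤ a) : ∀ y, s.E x y → s.av F' A y ≤ a := by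
  intro y hxy
  rw [s.av_le hF', sz, sz, sm_inter_ind, ← sm_mul_left]
  refine sm_piece hF.1 (fun u v huv hu => hF'.1.trans (hF'.1.symm (hFF' _ _ huv)) hu) ?_
  intro v hv
  have hyv : s.E y v := s.fE hF' y v hv
  rw [sm_mul_left, ← sm_inter_ind]
  exact (s.av_le_base hF hyv).1 (h v (s.trans hxy hyv))

theorem one_step (hinf : s.Inf) {A : Set X} (hA : MeasurableSet A) (a b : NNRat) (n : ℕ)
    {F : X → X → Prop} (hF : IsFinSubequiv s.E F) :
    ∃ (F' : X → X → Prop) (C : Set X), IsFinSubequiv s.E F' ∧ (∀ x y, F x y → F' x y) ∧ s.Comp C ∧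
      ∀ x, x ∉ C → (2 ^ n ≤ s.sz {z | F' z x} x) ∧ (a < b →
        (∀ y, s.E x y → ((a : NNReal) : ℝ≥0∞) ≤ s.av F' A y) ∨
          ∀ y, s.E x y → s.av F' A y ≤ ((b : NNReal) : ℝ≥0∞)) := by
  have key : ∃ (F' : X → X → Prop) (C : Set X), IsFinSubequiv s.E F' ∧ (∀ x y, F x y → F' x y) ∧
      s.Comp C ∧ ∀ x, x ∉ C → (a < b →
        (∀ y, s.E x y → ((a : NNReal) : ℝ≥0∞) ≤ s.av F' A y) ∨
          ∀ y, s.E x y → s.av F' A y ≤ ((b : NNReal) : ℝ≥0∞)) := by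
    by_cases hab : a < b
    · obtain ⟨F', C, h1, h2, h3, h4⟩ := s.step_lemma hinf hF hA (p := ((a : NNReal) : ℝ≥0∞))
        (q := ((b : NNReal) : ℝ≥0∞)) (by exact_mod_cast hab) (by simp)
      refine ⟨F', C, h1, h2, h3, fun x hx _ => ?_⟩
      simp only [s.le_av h1, s.av_le h1]
      exact h4 x hx
    · obtain ⟨F', C, h1, h2, h3, -⟩ := s.diff_lemma hinf hF (ε := 1) (by simp) (by simp)
      exact ⟨F', C, h1, h2, h3, fun x _ h => absurd h hab⟩
  obtain ⟨F1, C1, h1, h2, h3, h4⟩ := key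
  obtain ⟨F2, C2, k1, k2, k3, k4⟩ := s.diff_lemma hinf h1 (ε := (2 ^ n)⁻¹) (by simp) (by simp)
  refine ⟨F2, C1 ∪ C2, k1, fun x y h => k2 _ _ (h2 _ _ h), h3.union k3, fun x hx => ⟨?_, fun hab => ?_⟩⟩
  · have := k4 x fun h => hx (Or.inr h)
    rw [← ENNReal.div_le_iff_le_mul (by simp) (by simp)] at this
    simpa using this
  · rcases h4 x (fun h => hx (Or.inl h)) hab with h | h
    · exact Or.inl (s.low_mono h1 k1 k2 h)
    · exact Or.inr (s.up_mono h1 k1 k2 h)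

theorem exists_seq (hinf : s.Inf) (A : ℕ → Set X) (hA : ∀ i, MeasurableSet (A i)) :
    ∃ (F : ℕ → X → X → Prop) (C : Set X), (∀ n, IsFinSubequiv s.E (F n)) ∧
      (∀ n m, n ≤ m → ∀ x y, F n x y → F m x y) ∧ s.Comp C ∧
      ∀ x, x ∉ C → (∀ k : ℕ, ∃ N, ∀ n, N ≤ n → ∀ y, s.E x y → 2 ^ k ≤ s.sz {z | F n z y} y) ∧
        ∀ i, ∀ a b : NNRat, a < b →
          (∃ N, ∀ n, N ≤ n → ∀ y, s.E x y → ((a : NNReal) : ℝ≥0∞) ≤ s.av (F n) (A i) y) ∨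
          (∃ N, ∀ n, N ≤ n → ∀ y, s.E x y → s.av (F n) (A i) y ≤ ((b : NNReal) : ℝ≥0∞)) := by
  obtain ⟨e, he⟩ := exists_surjective_nat (ℕ × NNRat × NNRat)
  have hstep : ∀ (n : ℕ) (F : {F : X → X → Prop // IsFinSubequiv s.E F}),
      ∃ (F' : {F : X → X → Prop // IsFinSubequiv s.E F}) (C : Set X), (∀ x y, F.1 x y → F'.1 x y) ∧
      s.Comp C ∧ ∀ x, x ∉ C → (2 ^ n ≤ s.sz {z | F'.1 z x} x) ∧ ((e n).2.1 < (e n).2.2 →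
        (∀ y, s.E x y → (((e n).2.1 : NNReal) : ℝ≥0∞) ≤ s.av F'.1 (A (e n).1) y) ∨
          ∀ y, s.E x y → s.av F'.1 (A (e n).1) y ≤ (((e n).2.2 : NNReal) : ℝ≥0∞)) := by
    intro n F
    obtain ⟨F', C, h1, h2⟩ := s.one_step hinf (hA (e n).1) (e n).2.1 (e n).2.2 n F.2
    exact ⟨⟨F', h1⟩, C, h2⟩
  choose f C h1 h2 h3 using hstep
  have hid : IsFinSubequiv s.E (fun x y => x = y) := by
    refine ⟨⟨fun x => rfl, fun h => h.symm, fun h h' => h.trans h'⟩,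
      measurableSet_eq_fun measurable_fst measurable_snd, ?_, ?_⟩
    · rintro x y rfl; exact s.refl x
    · intro x; simp
  let F : ℕ → {F : X → X → Prop // IsFinSubequiv s.E F} := fun n =>
    Nat.rec ⟨fun x y => x = y, hid⟩ (fun n F => f n F) n
  have hFs : ∀ n, F (n + 1) = f n (F n) := fun n => rfl
  have hmono : ∀ n m, n ≤ m → ∀ x y, (F n).1 x y → (F m).1 x y := by
    intro n m hnm
    induction m, hnm using Nat.le_induction with
    | base => exact fun _ _ h => h
    | succ m _ ih => exact fun x y h => h1 m (F m) x y (ih x y h)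
  refine ⟨fun n => (F n).1, ⋃ n, C n (F n), fun n => (F n).2, hmono, Comp.iUnion fun n => h2 n (F n), ?_⟩
  intro x hx
  have hxn : ∀ n y, s.E x y → y ∉ C n (F n) := fun n y hxy h =>
    hx (mem_iUnion.2 ⟨n, (h2 n (F n)).2.1 (s.symm hxy) h⟩)
  constructor
  · intro k
    refine ⟨k + 1, fun n hn y hxy => ?_⟩
    refine (h3 k (F k) y (hxn k y hxy)).1.trans (sm_mono _ fun z hz => ?_)
    exact hmono (k + 1) n hn z y hz
  · intro i a b hab
    obtain ⟨n, hn⟩ := he (i, a, b)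
    have := (h3 n (F n) x (hxn n x (s.refl x))).2
    rw [hn] at this
    rcases this hab with h | h
    · exact Or.inl ⟨n + 1, fun m hm => s.low_mono (F (n + 1)).2 (F m).2 (hmono _ _ hm) h⟩
    · exact Or.inr ⟨n + 1, fun m hm => s.up_mono (F (n + 1)).2 (F m).2 (hmono _ _ hm) h⟩

end Sys
end CocycleNadkarni
end

section
set_option linter.unusedSectionVars false
set_option linter.style.haveILetI false
open MeasureTheory Set ENNReal
namespace CocycleNadkarni
namespace Sys
variable {X : Type*} [MeasurableSpace X] [StandardBorelSpace X] (s : Sys X)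

theorem inv_comp (g : X ≃ᵐ X) (hg : ∀ x, s.E x (g x)) {F : X → X → Prop}
    (hF : IsFinSubequiv s.E F) {A : Set X} (hA : MeasurableSet A) :
    s.Comp {x | ∀ y, s.E x y → s.sz {z | z ∈ g.symm ⁻¹' A ∧ F z y} y <
      s.sz {z | z ∈ g.symm ⁻¹' A ∧ F (g.symm z) y} y} := by
  have hgs : ∀ x, s.E x (g.symm x) := fun x => by
    have := hg (g.symm x); rw [MeasurableEquiv.apply_symm_apply] at this; exact s.symm this
  set B : Set X := g.symm ⁻¹' A with hB
  have hBm : MeasurableSet B := g.symm.measurable hA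
  have hE1 : ∀ y z, z ∈ B ∧ F z y → s.E y z := fun y z h => s.symm (hF.2.2.1 h.2)
  have hE2 : ∀ y z, z ∈ B ∧ F (g.symm z) y → s.E y z := fun y z h =>
    s.symm (s.trans (hgs z) (hF.2.2.1 h.2))
  have hCm : MeasurableSet {x | ∀ y, s.E x y → s.sz {z | z ∈ B ∧ F z y} y <
      s.sz {z | z ∈ B ∧ F (g.symm z) y} y} := by
    refine measurableSet_setOfPred.2 (s.meas_all (P := fun _ y => s.sz {z | z ∈ B ∧ F z y} y <
      s.sz {z | z ∈ B ∧ F (g.symm z) y} y) measurable_id (measurableSet_setOfPred.1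
        (measurableSet_lt ?_ ?_)))
    · exact (s.meas_sz (P := fun y z => z ∈ B ∧ F z y) measurable_id measurable_id
        ((meas_mem measurable_snd hBm).and (s.fmeas hF measurable_snd measurable_fst)) hE1).comp
          measurable_snd
    · exact (s.meas_sz (P := fun y z => z ∈ B ∧ F (g.symm z) y) measurable_id measurable_id
        ((meas_mem measurable_snd hBm).and (s.fmeas hF (g.symm.measurable.comp measurable_snd)
          measurable_fst)) hE2).comp measurable_snd
  let R : X → X → Prop := fun x z => x ∈ B ∧ z ∈ B ∧ F (g.symm z) x
  have hR : Measurable fun p : X × X => R p.1 p.2 :=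
    (meas_mem measurable_fst hBm).and ((meas_mem measurable_snd hBm).and
      (s.fmeas hF (g.symm.measurable.comp measurable_snd) measurable_fst))
  let F2 : X → X → Prop := fun u v => u = v ∨ (u ∈ B ∧ v ∈ B ∧ F (g.symm u) (g.symm v))
  have hF2 : IsFinSubequiv s.E F2 := by
    refine ⟨⟨fun x => Or.inl rfl, ?_, ?_⟩, ?_, ?_, ?_⟩
    · rintro x y (h | ⟨h1, h2, h3⟩)
      · exact Or.inl h.symm
      · exact Or.inr ⟨h2, h1, hF.1.symm h3⟩
    · rintro x y w (rfl | ⟨h1, h2, h3⟩) (rfl | ⟨h1', h2', h3'⟩)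
      · exact Or.inl rfl
      · exact Or.inr ⟨h1', h2', h3'⟩
      · exact Or.inr ⟨h1, h2, h3⟩
      · exact Or.inr ⟨h1, h2', hF.1.trans h3 h3'⟩
    · refine measurableSet_setOfPred.2 (Measurable.or ?_ (Measurable.and ?_ (Measurable.and ?_ ?_)))
      · exact measurableSet_setOfPred.1 (measurableSet_eq_fun measurable_fst measurable_snd)
      · exact meas_mem measurable_fst hBm
      · exact meas_mem measurable_snd hBm
      · exact s.fmeas hF (g.symm.measurable.comp measurable_fst)
          (g.symm.measurable.comp measurable_snd)
    · rintro x y (rfl | h)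
      · exact s.refl _
      · exact s.trans (hgs x) (s.trans (hF.2.2.1 h.2.2) (s.symm (hgs y)))
    · intro x
      refine (((hF.2.2.2 (g.symm x)).image g).insert x).subset ?_
      rintro y (rfl | h)
      · exact Or.inl rfl
      · exact Or.inr ⟨g.symm y, h.2.2, by simp⟩
  have hcl : ∀ x ∈ B, {y | F2 y x} = {z | z ∈ B ∧ F (g.symm z) (g.symm x)} := by
    intro x hx
    ext y
    constructor
    · rintro (rfl | h)
      · exact ⟨hx, hF.1.refl _⟩
      · exact ⟨h.1, h.2.2⟩
    · rintro ⟨h1, h2⟩; exact Or.inr ⟨h1, hx, h2⟩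
  have hneg : ∀ x, x ∉ B → s.sel R x = x := by
    intro x hx; apply s.sel_neg; rintro ⟨y, -, h, -⟩; exact hx h
  set C := {x | ∀ y, s.E x y → s.sz {z | z ∈ B ∧ F z y} y <
      s.sz {z | z ∈ B ∧ F (g.symm z) y} y} with hC
  have hCi : EInvariant s.E C := fun x y hxy hx z hyz => hx z (s.trans hxy hyz)
  have hne : ∀ x ∈ C, ∃ z, s.E x z ∧ z ∈ B ∧ F (g.symm z) x := by
    intro x hx
    by_contra hcon
    push Not at hcon
    have h1 := hx x (s.refl x)
    have : {z | z ∈ B ∧ F (g.symm z) x} = ∅ := by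
      ext z
      simp only [mem_ofPred_eq, mem_empty_iff_false, iff_false]
      intro h
      exact hcon z (hE2 x z h) h.1 h.2
    rw [this] at h1
    simp at h1
  have hspec : ∀ x ∈ C, x ∈ B → R x (s.sel R x) := by
    intro x hx hxB
    apply s.sel_spec
    obtain ⟨z, h1, h2, h3⟩ := hne x hx
    exact ⟨z, h1, hxB, h2, h3⟩
  have hin : ∀ x ∈ C, x ∈ B → s.sel R ⁻¹' {y | F2 y x} ⊆ {z | z ∈ B ∧ F z (g.symm x)} := by
    intro x hx hxB y hy
    have hEy : s.E y x := s.trans (s.sel_E R y) (hF2.2.2.1 hy)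
    rw [hcl x hxB] at hy
    have hyB : y ∈ B := by
      by_contra h
      have : s.sel R y ∈ B := hy.1
      rw [hneg y h] at this
      exact h this
    have := hspec y (hCi (s.symm hEy) hx) hyB
    exact ⟨hyB, hF.1.trans (hF.1.symm this.2.2) hy.2⟩
  have hlt : ∀ x ∈ C, x ∈ B → s.sz (s.sel R ⁻¹' {y | F2 y x}) x < s.sz {y | F2 y x} x := by
    intro x hx hxB
    refine (sm_mono _ (hin x hx hxB)).trans_lt ?_
    rw [hcl x hxB]
    refine (s.sz_lt_base1 (z := g.symm x) ?_ ?_ (s.symm (hgs x))).2 (hx _ (hgs x))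
    · exact hE1 _
    · exact hE2 _
  have hout : ∀ x ∈ C, x ∉ B → s.sel R ⁻¹' {y | F2 y x} ⊆ {x} := by
    intro x hx hxB y hy
    have hEy : s.E y x := s.trans (s.sel_E R y) (hF2.2.2.1 hy)
    rcases hy with h | h
    · by_cases hyB : y ∈ B
      · have := (hspec y (hCi (s.symm hEy) hx) hyB).2.1
        have h' : s.sel R y = x := h
        rw [h'] at this
        exact absurd this hxB
      · have h' : s.sel R y = x := h
        rw [hneg y hyB] at h'
        exact h'
    · exact absurd h.2.1 hxB
  refine ⟨hCm, hCi, s.sel R, F2, s.sel_meas hR, hF2, s.sel_E R, fun x hx => ⟨?_, ?_, ?_⟩⟩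
  · have hsub : s.sel R ⁻¹' {x} ⊆ s.sel R ⁻¹' {y | F2 y x} :=
      preimage_mono (singleton_subset_iff.2 (s.fself hF2 x))
    by_cases hxB : x ∈ B
    · exact (s.ffin hF (g.symm x)).subset ((hsub.trans (hin x hx hxB)).trans fun z hz => hz.2)
    · exact (finite_singleton x).subset (hsub.trans (hout x hx hxB))
  · by_cases hxB : x ∈ B
    · exact (hlt x hx hxB).le
    · exact sm_mono _ ((hout x hx hxB).trans (singleton_subset_iff.2 (s.fself hF2 x)))
  · obtain ⟨z, h1, h2, h3⟩ := hne x hx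
    exact ⟨z, h1, hlt z (hCi h1 hx) h2⟩

theorem inv_use (g : X ≃ᵐ X) (hg : ∀ x, s.E x (g x)) {F : X → X → Prop}
    (hF : IsFinSubequiv s.E F) {A : Set X} {c : ℝ≥0∞}
    (hc : ∀ a ∈ A, c ≤ s.w a (g a)) {x : X}
    (hx : x ∉ {x | ∀ y, s.E x y → s.sz {z | z ∈ g.symm ⁻¹' A ∧ F z y} y <
      s.sz {z | z ∈ g.symm ⁻¹' A ∧ F (g.symm z) y} y}) :
    ∃ y, s.E x y ∧ c * s.av F A y ≤ s.av F (g.symm ⁻¹' A) y := by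
  simp only [mem_ofPred_eq, not_forall, not_lt] at hx
  obtain ⟨y, hxy, h⟩ := hx
  refine ⟨y, hxy, ?_⟩
  rw [s.le_av hF, av, mul_assoc, ENNReal.div_mul_cancel (s.fpos hF y) (s.ftop hF y y)]
  refine le_trans ?_ h
  have h1 : c * s.sz (A ∩ {z | F z y}) y ≤ sm (fun a => s.w y (g a)) (A ∩ {z | F z y}) := by
    rw [sz, ← sm_mul_left]
    refine sm_le_sm fun a ha => ?_
    have hay : s.E a y := hF.2.2.1 ha.2
    rw [s.w_mul (s.symm (hg a)) hay]
    exact mul_le_mul_left (hc a ha.1) _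
  refine h1.trans (le_of_eq ?_)
  rw [sm_eq, sz, sm_eq]
  refine Eq.trans ?_ (g.toEquiv.tsum_eq _)
  refine tsum_congr fun a => ?_
  have hiff : a ∈ A ∩ {z | F z y} ↔ g a ∈ {z | z ∈ g.symm ⁻¹' A ∧ F (g.symm z) y} := by
    simp only [mem_ofPred_eq, mem_preimage, mem_inter_iff, MeasurableEquiv.symm_apply_apply]
  by_cases ha : a ∈ A ∩ {z | F z y}
  · rw [indicator_of_mem ha]
    exact (indicator_of_mem (hiff.1 ha) (s.w y)).symm
  · rw [indicator_of_notMem ha]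
    exact (indicator_of_notMem (fun h => ha (hiff.2 h)) (s.w y)).symm

end Sys
end CocycleNadkarni
end

section
set_option linter.unusedSectionVars false
set_option linter.style.haveILetI false
open MeasureTheory Set ENNReal
namespace CocycleNadkarni

theorem select {X : Type*} {f : X → ℝ≥0∞} {r : X → ℝ} (hri : Function.Injective r) {T : Set X}
    (hT : T.Finite) {M : ℝ≥0∞} (hf : ∀ x ∈ T, f x ≤ M) (hM : M < sm f T) :
    M < sm f {x | x ∈ T ∧ sm f {y | y ∈ T ∧ r y < r x} ≤ M} ∧
      sm f {x | x ∈ T ∧ sm f {y | y ∈ T ∧ r y < r x} ≤ M} ≤ 2 * M := by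
  set D := {x | x ∈ T ∧ sm f {y | y ∈ T ∧ r y < r x} ≤ M} with hD
  have hDT : D ⊆ T := fun x hx => hx.1
  constructor
  · rcases (T \ D).eq_empty_or_nonempty with h | h
    · rw [subset_antisymm hDT (sdiff_eq_empty.1 h)]; exact hM
    · obtain ⟨x, hx, hmin⟩ := exists_min_image _ r (hT.subset sdiff_subset) h
      have h1 : M < sm f {y | y ∈ T ∧ r y < r x} := by
        by_contra hcon
        exact hx.2 ⟨hx.1, not_lt.1 hcon⟩
      refine h1.trans_le (sm_mono _ ?_)
      rintro y ⟨hy, hyx⟩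
      by_contra hyD
      exact absurd (hmin y ⟨hy, hyD⟩) (not_le.2 hyx)
  · rcases D.eq_empty_or_nonempty with h | h
    · rw [h]; simp
    · obtain ⟨x, hx, hmax⟩ := exists_max_image _ r (hT.subset hDT) h
      have h1 : D ⊆ {y | y ∈ T ∧ r y < r x} ∪ {x} := by
        intro y hy
        rcases (hmax y hy).lt_or_eq with h | h
        · exact Or.inl ⟨hy.1, h⟩
        · exact Or.inr (hri h)
      refine (sm_mono _ h1).trans ((sm_union_le _ _ _).trans ?_)
      rw [two_mul, sm_singleton]
      exact add_le_add hx.2 (hf x hx.1)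

namespace Sys
variable {X : Type*} [MeasurableSpace X] [StandardBorelSpace X] (s : Sys X)

theorem glue {F : ℕ → X → X → Prop} (hF : ∀ n, IsFinSubequiv s.E (F n)) {N : X → ℕ}
    (hNm : Measurable N) (hNE : ∀ x y, s.E x y → N x = N y) :
    IsFinSubequiv s.E (fun x y => F (N x) x y) := by
  refine ⟨⟨?_, ?_, ?_⟩, ?_, ?_, ?_⟩
  · exact fun x => (hF _).1.refl x
  · intro x y h
    rw [← hNE x y ((hF _).2.2.1 h)]
    exact (hF _).1.symm h
  · intro x y z h h'
    rw [← hNE x y ((hF _).2.2.1 h)] at h'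
    exact (hF _).1.trans h h'
  · have : {p : X × X | F (N p.1) p.1 p.2} =
        ⋃ n, ((N ∘ Prod.fst) ⁻¹' {n} ∩ {p : X × X | F n p.1 p.2}) := by
      ext p
      simp
    rw [this]
    exact MeasurableSet.iUnion fun n => ((hNm.comp measurable_fst) (measurableSet_singleton n)).inter
      (hF n).2.1
  · intro x y h; exact (hF _).2.2.1 h
  · intro x; exact (hF _).2.2.2 x

theorem glue_cl {F : ℕ → X → X → Prop} (hF : ∀ n, IsFinSubequiv s.E (F n)) {N : X → ℕ}
    (hNE : ∀ x y, s.E x y → N x = N y) (x : X) :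
    {y | F (N y) y x} = {y | F (N x) y x} := by
  ext y
  simp only [mem_ofPred_eq]
  constructor
  · intro h; rwa [← hNE y x ((hF _).2.2.1 h)]
  · intro h; rwa [hNE y x ((hF _).2.2.1 h)]

/-- selection of an initial segment in each tile -/
def Dset (η : X → ℝ≥0∞) (P : X → X → Prop) (V : Set X) : Set X :=
  {x | x ∈ V ∧ s.sz {y | y ∈ V ∧ P y x ∧ s.r y < s.r x} x ≤ η x * s.sz {y | P y x} x}

theorem Dset_meas {η : X → ℝ≥0∞} (hη : Measurable η) {P : X → X → Prop} (hP : IsFinSubequiv s.E P)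
    {V : Set X} (hV : MeasurableSet V) : MeasurableSet (s.Dset η P V) := by
  refine hV.inter (measurableSet_le ?_ (hη.mul (s.fszm hP)))
  refine s.meas_sz (P := fun x y => y ∈ V ∧ P y x ∧ s.r y < s.r x) measurable_id measurable_id ?_
    (fun x y h => s.symm (hP.2.2.1 h.2.1))
  exact (meas_mem measurable_snd hV).and ((s.fmeas hP measurable_snd measurable_fst).and
    (measurableSet_setOfPred.1 (measurableSet_lt (s.hr.comp measurable_snd)
      (s.hr.comp measurable_fst))))

theorem Dset_spec {η : X → ℝ≥0∞} (hηE : ∀ x y, s.E x y → η x = η y)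
    {P : X → X → Prop} (hP : IsFinSubequiv s.E P) {V : Set X} {x : X}
    (h1 : η x * s.sz {y | P y x} x < s.sz (V ∩ {y | P y x}) x)
    (h2 : ∀ y, P y x → s.w x y ≤ η x * s.sz {z | P z x} x) :
    η x * s.sz {y | P y x} x < s.sz (s.Dset η P V ∩ {y | P y x}) x ∧
      s.sz (s.Dset η P V ∩ {y | P y x}) x ≤ 2 * (η x * s.sz {y | P y x} x) := by
  have := select (f := s.w x) s.hri ((s.ffin hP x).subset (inter_subset_right (s := V)))
    (fun y hy => h2 y hy.2) h1
  have heq : {u | u ∈ V ∩ {y | P y x} ∧ sm (s.w x) {y | y ∈ V ∩ {y | P y x} ∧ s.r y < s.r u} ≤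
      η x * s.sz {y | P y x} x} = s.Dset η P V ∩ {y | P y x} := by
    ext u
    have key : P u x → (sm (s.w x) {y | y ∈ V ∩ {y | P y x} ∧ s.r y < s.r u} ≤
      η x * s.sz {y | P y x} x ↔
        s.sz {y | y ∈ V ∧ P y u ∧ s.r y < s.r u} u ≤ η u * s.sz {y | P y u} u) := by
      intro hu
      have hE := hP.2.2.1 hu
      have hcl := s.feq hP hu
      have e1 : {y | y ∈ V ∧ P y u ∧ s.r y < s.r u} = {y | y ∈ V ∩ {y | P y x} ∧ s.r y < s.r u} := by
        ext y
        have : P y u ↔ P y x := Set.ext_iff.1 hcl y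
        simp only [mem_ofPred_eq, mem_inter_iff, this, and_assoc]
      rw [e1, hcl, hηE u x hE]
      have := s.sz_le_base (a := 1) (b := η x) (z := u) (z' := x)
        (Y := {y | y ∈ V ∩ {y | P y x} ∧ s.r y < s.r u}) (Y' := {y | P y x})
        (fun y hy => s.trans hE (s.fE hP x y hy.1.2)) (fun y hy => s.trans hE (s.fE hP x y hy)) hE
      rw [one_mul, one_mul] at this
      exact this
    constructor
    · rintro ⟨⟨hu1, hu2⟩, hu3⟩
      exact ⟨⟨hu1, (key hu2).1 hu3⟩, hu2⟩
    · rintro ⟨⟨hu1, hu3⟩, hu2⟩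
      exact ⟨⟨hu1, hu2⟩, (key hu2).2 hu3⟩
  rw [heq] at this
  exact this

end Sys
end CocycleNadkarni
end

section
set_option linter.unusedSectionVars false
set_option linter.style.haveILetI false
open MeasureTheory Set ENNReal
namespace CocycleNadkarni
namespace Sys
variable {X : Type*} [MeasurableSpace X] [StandardBorelSpace X] (s : Sys X)

/-- remaining available part -/
def Avl (η : ℕ → X → ℝ≥0∞) (P : ℕ → X → X → Prop) (B : Set X) : ℕ → Set X
  | 0 => B
  | k + 1 => Avl η P B k \ s.Dset (η k) (P k) (Avl η P B k)

theorem Avl_meas {η : ℕ → X → ℝ≥0∞} (hη : ∀ k, Measurable (η k)) {P : ℕ → X → X → Prop}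
    (hP : ∀ k, IsFinSubequiv s.E (P k)) {B : Set X} (hB : MeasurableSet B) (k : ℕ) :
    MeasurableSet (s.Avl η P B k) := by
  induction k with
  | zero => exact hB
  | succ k ih => exact ih.diff (s.Dset_meas (hη k) (hP k) ih)

theorem Avl_anti (η : ℕ → X → ℝ≥0∞) (P : ℕ → X → X → Prop) (B : Set X) :
    Antitone (s.Avl η P B) := antitone_nat_of_succ_le fun _ => sdiff_subset

theorem Avl_cover (η : ℕ → X → ℝ≥0∞) (P : ℕ → X → X → Prop) (B S : Set X) (x : X) (k : ℕ) :
    s.sz (B ∩ S) x ≤ s.sz (s.Avl η P B k ∩ S) x +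
      ∑ i ∈ Finset.range k, s.sz (s.Dset (η i) (P i) (s.Avl η P B i) ∩ S) x := by
  induction k with
  | zero => simp [Avl]
  | succ k ih =>
    rw [Finset.sum_range_succ, add_comm (∑ i ∈ Finset.range k, _), ← add_assoc]
    refine ih.trans (add_le_add_left ((sm_mono _ ?_).trans (sm_union_le _ _ _)) _)
    rintro y ⟨h1, h2⟩
    by_cases h : y ∈ s.Dset (η k) (P k) (s.Avl η P B k)
    · exact Or.inr ⟨h, h2⟩
    · exact Or.inl ⟨⟨h1, h⟩, h2⟩

theorem sa_sel {P : ℕ → X → X → Prop} (hP : ∀ k, IsFinSubequiv s.E (P k))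
    (hPm : ∀ i k, i ≤ k → ∀ x y, P i x y → P k x y) {B C : Set X}
    (hCi : EInvariant s.E C) {η : ℕ → X → ℝ≥0∞}
    (hηE : ∀ k x y, s.E x y → η k x = η k y) {t : ℝ≥0∞} (ht : t ≠ ⊤)
    (ha : ∀ x ∈ C, ∀ k, t ≤ s.av (P k) B x)
    (hc : ∀ x ∈ C, ∀ k, 1 ≤ η k x * s.sz {y | P k y x} x)
    (hd : ∀ x ∈ C, ∀ k, η k x ≠ 0)
    (hs : ∀ x ∈ C, ∀ k, ∑ i ∈ Finset.range k, 2 * η i x ≤ t) (k : ℕ) :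
    ∀ x ∈ C, η k x * s.sz {y | P k y x} x <
        s.sz (s.Dset (η k) (P k) (s.Avl η P B k) ∩ {y | P k y x}) x ∧
      s.sz (s.Dset (η k) (P k) (s.Avl η P B k) ∩ {y | P k y x}) x ≤
        2 * (η k x * s.sz {y | P k y x} x) := by
  induction k using Nat.strong_induction_on with
  | _ k ih =>
  intro x hx
  have hS0 := s.fpos (hP k) x
  have hSt := s.ftop (hP k) x x
  have hηt : ∀ i, η i x ≠ ⊤ := by
    intro i h
    have := hs x hx (i + 1)
    rw [Finset.sum_range_succ, h] at this
    simp at this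
    exact ht this
  refine s.Dset_spec (hηE k) (hP k) ?_ ?_
  · have h1 : ∀ i ∈ Finset.range k, s.sz (s.Dset (η i) (P i) (s.Avl η P B i) ∩ {y | P k y x}) x ≤
        2 * η i x * s.sz {y | P k y x} x := by
      intro i hi
      have hik := Finset.mem_range.1 hi
      rw [sz, sz, sm_inter_ind, ← sm_mul_left]
      refine sm_piece (hP i).1
        (fun u v huv hu => (hP k).1.trans ((hP k).1.symm (hPm i k hik.le _ _ huv)) hu) ?_
      intro v hv
      have hxv : s.E x v := s.fE (hP k) x v hv
      have := (ih i hik v (hCi hxv hx)).2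
      rw [sm_mul_left, ← sm_inter_ind]
      rw [← mul_assoc, ← hηE i x v hxv] at this
      have h2 := s.sz_le_base (a := 1) (b := 2 * η i x) (z := v) (z' := x)
        (Y := s.Dset (η i) (P i) (s.Avl η P B i) ∩ {y | P i y v}) (Y' := {y | P i y v})
        (fun y hy => s.fE (hP i) v y hy.2) (s.fE (hP i) v) (s.symm hxv)
      rw [one_mul, one_mul] at h2
      exact h2.2 this
    have h2 := (s.le_av (hP k)).1 (ha x hx k)
    have h3 := (h2.trans (s.Avl_cover η P B {y | P k y x} x k)).trans
      (add_le_add_right (Finset.sum_le_sum h1) _)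
    rw [← Finset.sum_mul, add_comm] at h3
    have h4 := (mul_le_mul_left (hs x hx (k + 1)) (s.sz {y | P k y x} x)).trans h3
    rw [Finset.sum_range_succ, add_mul] at h4
    have hfin : (∑ i ∈ Finset.range k, 2 * η i x) * s.sz {y | P k y x} x ≠ ⊤ := by
      refine ENNReal.mul_ne_top (ne_top_of_le_ne_top ht (hs x hx k)) hSt
    have h5 := (ENNReal.add_le_add_iff_left hfin).1 h4
    refine lt_of_lt_of_le ?_ h5
    rw [mul_assoc, two_mul]
    exact ENNReal.lt_add_right (ENNReal.mul_ne_top (hηt k) hSt) (mul_ne_zero (hd x hx k) hS0)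
  · intro y hy
    have hE := (hP k).2.2.1 hy
    have := hc y (hCi (s.symm hE) hx) k
    rw [s.feq (hP k) hy, hηE k y x hE] at this
    rw [s.sz_base (z := y) (z' := x) (fun z hz => s.trans hE (s.fE (hP k) x z hz)) hE, ← mul_assoc]
    calc s.w x y = 1 * s.w x y := (one_mul _).symm
      _ ≤ _ := mul_le_mul_left this _

theorem sa_core {P : ℕ → X → X → Prop} (hP : ∀ k, IsFinSubequiv s.E (P k))
    (hPm : ∀ i k, i ≤ k → ∀ x y, P i x y → P k x y) {B : ℕ → Set X} {C : Set X}
    (hB : ∀ k, MeasurableSet (B k)) (hBa : Antitone B) (hB0 : ⋂ k, B k = ∅)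
    (hC : MeasurableSet C)
    (hCi : EInvariant s.E C) {η : ℕ → X → ℝ≥0∞} (hη : ∀ k, Measurable (η k))
    (hηE : ∀ k x y, s.E x y → η k x = η k y) {t : ℝ≥0∞} (ht : t ≠ ⊤)
    (ha : ∀ x ∈ C, ∀ k, t ≤ s.av (P k) (B 0) x)
    (hb : ∀ x ∈ C, ∀ k, s.av (P k) (B k \ B (k + 1)) x ≤ η k x)
    (hc : ∀ x ∈ C, ∀ k, 1 ≤ η k x * s.sz {y | P k y x} x)
    (hd : ∀ x ∈ C, ∀ k, η k x ≠ 0)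
    (hs : ∀ x ∈ C, ∀ k, ∑ i ∈ Finset.range k, 2 * η i x ≤ t) : s.Comp C := by
  have hsel := s.sa_sel hP hPm hCi hηE ht ha hc hd hs
  set V := s.Avl η P (B 0) with hV
  set D : ℕ → Set X := fun k => s.Dset (η k) (P k) (V k) with hD
  have hVm : ∀ k, MeasurableSet (V k) := s.Avl_meas hη hP (hB 0)
  have hDm : ∀ k, MeasurableSet (D k) := fun k => s.Dset_meas (hη k) (hP k) (hVm k)
  have hDV : ∀ k, D k ⊆ V k := fun k x hx => hx.1
  have hVa : Antitone V := s.Avl_anti η P (B 0)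
  have hDB : ∀ k, D k ⊆ B 0 := fun k => (hDV k).trans (hVa (Nat.zero_le k))
  have hDd' : ∀ i j, i < j → ∀ x, x ∈ D i → x ∉ D j := by
    intro i j hij x hi hj
    have : x ∈ V (i + 1) := hVa hij (hDV j hj)
    exact this.2 hi
  have hDd : ∀ i j x, x ∈ D i → x ∈ D j → i = j := by
    intro i j x hi hj
    rcases lt_trichotomy i j with h | h | h
    · exact absurd hj (hDd' i j h x hi)
    · exact h
    · exact absurd hi (hDd' j i h x hj)
  have hLex : ∀ x ∈ B 0, ∃ k, x ∈ B k \ B (k + 1) := by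
    intro x hx
    by_contra hcon
    push Not at hcon
    have : ∀ k, x ∈ B k := by
      intro k
      induction k with
      | zero => exact hx
      | succ k ih => by_contra h; exact hcon k ⟨ih, h⟩
    have : x ∈ ⋂ k, B k := mem_iInter.2 this
    rw [hB0] at this
    exact this
  let R : X → X → Prop := fun x y => ∃ k, x ∈ B k \ B (k + 1) ∧ y ∈ D k ∧ P k x y
  have hR : Measurable fun p : X × X => R p.1 p.2 := Measurable.exists fun k =>
    (meas_mem measurable_fst ((hB k).diff (hB (k + 1)))).and ((meas_mem measurable_snd (hDm k)).and
      (s.fmeas (hP k) measurable_fst measurable_snd))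
  have hDpos : ∀ x ∈ C, ∀ k, ∃ y, s.E x y ∧ y ∈ D k ∧ P k x y := by
    intro x hx k
    have h1 := (hsel k x hx).1
    by_contra hcon
    push Not at hcon
    have : D k ∩ {y | P k y x} = ∅ := by
      ext y
      simp only [mem_inter_iff, mem_ofPred_eq, mem_empty_iff_false, iff_false, not_and]
      intro hy hyx
      exact hcon y (s.symm ((hP k).2.2.1 hyx)) hy ((hP k).1.symm hyx)
    change _ < s.sz (D k ∩ {y | P k y x}) x at h1
    rw [this] at h1
    simp at h1
  have hspec : ∀ x ∈ C, x ∈ B 0 → R x (s.sel R x) := by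
    intro x hx hx0
    apply s.sel_spec
    obtain ⟨k, hk⟩ := hLex x hx0
    obtain ⟨y, h1, h2, h3⟩ := hDpos x hx k
    exact ⟨y, h1, k, hk, h2, h3⟩
  have hneg : ∀ x, x ∉ B 0 → s.sel R x = x := by
    intro x hx
    apply s.sel_neg
    rintro ⟨y, -, k, h, -⟩
    exact hx (hBa (Nat.zero_le k) h.1)
  let F : X → X → Prop := fun u v => u = v ∨ ∃ k, u ∈ D k ∧ v ∈ D k ∧ P k u v
  have hcl : ∀ k, ∀ x ∈ D k, {y | F y x} = D k ∩ {y | P k y x} := by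
    intro k x hx
    ext y
    constructor
    · rintro (rfl | ⟨j, h1, h2, h3⟩)
      · exact ⟨hx, (hP k).1.refl _⟩
      · obtain rfl := hDd j k x h2 hx
        exact ⟨h1, h3⟩
    · rintro ⟨h1, h2⟩; exact Or.inr ⟨k, h1, hx, h2⟩
  have hF : IsFinSubequiv s.E F := by
    have hsymm : ∀ {x y}, F x y → F y x := by
      rintro x y (h | ⟨k, h1, h2, h3⟩)
      · exact Or.inl h.symm
      · exact Or.inr ⟨k, h2, h1, (hP k).1.symm h3⟩
    refine ⟨⟨fun x => Or.inl rfl, hsymm, ?_⟩, ?_, ?_, ?_⟩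
    · rintro x y w (rfl | ⟨k, h1, h2, h3⟩) (rfl | ⟨j, h1', h2', h3'⟩)
      · exact Or.inl rfl
      · exact Or.inr ⟨j, h1', h2', h3'⟩
      · exact Or.inr ⟨k, h1, h2, h3⟩
      · obtain rfl := hDd k j y h2 h1'
        exact Or.inr ⟨k, h1, h2', (hP k).1.trans h3 h3'⟩
    · refine measurableSet_setOfPred.2 (Measurable.or ?_ (Measurable.exists fun k =>
        Measurable.and ?_ (Measurable.and ?_ ?_)))
      · exact measurableSet_setOfPred.1 (measurableSet_eq_fun measurable_fst measurable_snd)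
      · exact meas_mem measurable_fst (hDm k)
      · exact meas_mem measurable_snd (hDm k)
      · exact s.fmeas (hP k) measurable_fst measurable_snd
    · rintro x y (rfl | ⟨k, h1, h2, h3⟩)
      · exact s.refl _
      · exact (hP k).2.2.1 h3
    · intro x
      by_cases h : ∃ k, x ∈ D k
      · obtain ⟨k, hk⟩ := h
        refine (s.ffin (hP k) x).subset fun y hy => ?_
        have : y ∈ {y | F y x} := hsymm hy
        rw [hcl k x hk] at this
        exact this.2
      · refine (finite_singleton x).subset ?_
        rintro y (rfl | ⟨k, h1, -⟩)
        · rfl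
        · exact absurd ⟨k, h1⟩ h
  have hin : ∀ x ∈ C, ∀ k, x ∈ D k → s.sel R ⁻¹' {y | F y x} ⊆ (B k \ B (k + 1)) ∩ {y | P k y x} := by
    intro x hx k hk y hy
    have hEy : s.E y x := s.trans (s.sel_E R y) (hF.2.2.1 hy)
    rw [hcl k x hk] at hy
    have hy1 : s.sel R y ∈ D k := hy.1
    have hy2 : P k (s.sel R y) x := hy.2
    have hyB : y ∈ B 0 := by
      by_contra h
      rw [hneg y h] at hy1
      exact h (hDB k hy1)
    obtain ⟨j, h1, h2, h3⟩ := hspec y (hCi (s.symm hEy) hx) hyB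
    obtain rfl := hDd j k _ h2 hy1
    exact ⟨h1, (hP j).1.trans h3 hy2⟩
  have hlt : ∀ x ∈ C, ∀ k, x ∈ D k → s.sz (s.sel R ⁻¹' {y | F y x}) x < s.sz {y | F y x} x := by
    intro x hx k hk
    refine (sm_mono _ (hin x hx k hk)).trans_lt ?_
    rw [hcl k x hk]
    exact ((s.av_le (hP k)).1 (hb x hx k)).trans_lt (hsel k x hx).1
  have hout : ∀ x ∈ C, (¬ ∃ k, x ∈ D k) → s.sel R ⁻¹' {y | F y x} ⊆ {x} := by
    intro x hx hxD y hy
    have hEy : s.E y x := s.trans (s.sel_E R y) (hF.2.2.1 hy)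
    rcases hy with h | ⟨k, _, h, _⟩
    · have h' : s.sel R y = x := h
      by_cases hyB : y ∈ B 0
      · obtain ⟨j, h1, h2, h3⟩ := hspec y (hCi (s.symm hEy) hx) hyB
        rw [h'] at h2
        exact absurd ⟨j, h2⟩ hxD
      · rw [hneg y hyB] at h'
        exact h'
    · exact absurd ⟨k, h⟩ hxD
  refine ⟨hC, hCi, s.sel R, F, s.sel_meas hR, hF, s.sel_E R, fun x hx => ⟨?_, ?_, ?_⟩⟩
  · have hsub : s.sel R ⁻¹' {x} ⊆ s.sel R ⁻¹' {y | F y x} :=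
      preimage_mono (singleton_subset_iff.2 (s.fself hF x))
    by_cases hxD : ∃ k, x ∈ D k
    · obtain ⟨k, hk⟩ := hxD
      exact (s.ffin (hP k) x).subset ((hsub.trans (hin x hx k hk)).trans fun z hz => hz.2)
    · exact (finite_singleton x).subset (hsub.trans (hout x hx hxD))
  · by_cases hxD : ∃ k, x ∈ D k
    · obtain ⟨k, hk⟩ := hxD
      exact (hlt x hx k hk).le
    · exact sm_mono _ ((hout x hx hxD).trans (singleton_subset_iff.2 (s.fself hF x)))
  · obtain ⟨z, h1, h2, h3⟩ := hDpos x hx 0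
    exact ⟨z, h1, hlt z (hCi h1 hx) 0 h2⟩

end Sys
end CocycleNadkarni
end

section
set_option linter.unusedSectionVars false
set_option linter.style.haveILetI false
open MeasureTheory Set ENNReal
namespace CocycleNadkarni
namespace Sys
variable {X : Type*} [MeasurableSpace X] [StandardBorelSpace X] (s : Sys X)

theorem meas_av {Z : Type*} [MeasurableSpace Z] {F : X → X → Prop} (hF : IsFinSubequiv s.E F)
    {A : Set X} (hA : MeasurableSet A) {a : Z → X} (ha : Measurable a) :
    Measurable fun z => s.av F A (a z) := by
  refine Measurable.div ?_ (s.meas_szF hF ha ha)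
  refine s.meas_sz (P := fun z y => y ∈ A ∧ F y (a z)) ha ha ?_
    (fun x y h => s.symm (hF.2.2.1 h.2))
  exact (meas_mem measurable_snd hA).and (s.fmeas hF measurable_snd (ha.comp measurable_fst))

/-- upper density -/
noncomputable def ub (F : ℕ → X → X → Prop) (A : Set X) (x : X) : ℝ≥0∞ :=
  ⨅ n, ⨆ m, s.av (F n) A (s.G m x)

theorem ub_meas {F : ℕ → X → X → Prop} (hF : ∀ n, IsFinSubequiv s.E (F n)) {A : Set X}
    (hA : MeasurableSet A) : Measurable (s.ub F A) :=
  Measurable.iInf fun n => Measurable.iSup fun m => s.meas_av (hF n) hA (s.G m).measurable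

theorem ub_E (F : ℕ → X → X → Prop) (A : Set X) {x y : X} (h : s.E x y) :
    s.ub F A x = s.ub F A y := by
  have key : ∀ {x y : X}, s.E x y → s.ub F A x ≤ s.ub F A y := by
    intro x y h
    refine iInf_mono fun n => iSup_le fun m => ?_
    obtain ⟨k, hk⟩ := (s.hG y (s.G m x)).1 (s.trans (s.symm h) (s.EG m x))
    rw [← hk]
    exact le_iSup (fun m => s.av (F n) A (s.G m y)) k
  exact le_antisymm (key h) (key (s.symm h))

theorem ub_lt {F : ℕ → X → X → Prop} {A : Set X} {x : X} {c : ℝ≥0∞} (h : s.ub F A x < c) :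
    ∃ n, ∀ y, s.E x y → s.av (F n) A y ≤ c := by
  obtain ⟨n, hn⟩ := iInf_lt_iff.1 h
  refine ⟨n, fun y hy => ?_⟩
  obtain ⟨m, rfl⟩ := (s.hG _ _).1 hy
  exact (le_iSup (fun m => s.av (F n) A (s.G m x)) m).trans hn.le

theorem ub_le {F : ℕ → X → X → Prop} {A : Set X} {x : X} {c : ℝ≥0∞} {n : ℕ}
    (h : ∀ y, s.E x y → s.av (F n) A y ≤ c) : s.ub F A x ≤ c :=
  (iInf_le _ n).trans (iSup_le fun m => h _ (s.EG m x))

theorem sa_comp {F : ℕ → X → X → Prop} (hF : ∀ n, IsFinSubequiv s.E (F n))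
    (hFm : ∀ n m, n ≤ m → ∀ x y, F n x y → F m x y) {B : ℕ → Set X}
    (hB : ∀ k, MeasurableSet (B k)) (hBa : Antitone B) (hB0 : ⋂ k, B k = ∅)
    {r : ℝ≥0∞} (hr0 : r ≠ 0) (hr : r ≠ ⊤) :
    s.Comp {x | (∃ n, ∀ y, s.E x y → r ≤ s.av (F n) (B 0) y) ∧
      (4 * ∑' k, s.ub F (B k \ B (k + 1)) x ≤ r) ∧
      ∀ k : ℕ, ∃ n, ∀ y, s.E x y → 2 ^ k ≤ s.sz {z | F n z y} y} := by
  classical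
  set C := {x | (∃ n, ∀ y, s.E x y → r ≤ s.av (F n) (B 0) y) ∧
      (4 * ∑' k, s.ub F (B k \ B (k + 1)) x ≤ r) ∧
      ∀ k : ℕ, ∃ n, ∀ y, s.E x y → 2 ^ k ≤ s.sz {z | F n z y} y} with hCdef
  have hL : ∀ k, MeasurableSet (B k \ B (k + 1)) := fun k => (hB k).diff (hB _)
  have hC : MeasurableSet C := by
    refine measurableSet_setOfPred.2 (Measurable.and ?_ (Measurable.and ?_ ?_))
    · refine Measurable.exists fun n => s.meas_all (P := fun _ y => r ≤ s.av (F n) (B 0) y)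
        measurable_id ?_
      exact measurableSet_setOfPred.1 (measurableSet_le measurable_const
        (s.meas_av (hF n) (hB 0) measurable_snd))
    · exact measurableSet_setOfPred.1 (measurableSet_le
        ((Measurable.tsum fun k => s.ub_meas hF (hL k)).const_mul _) measurable_const)
    · refine Measurable.forall fun k => Measurable.exists fun n =>
        s.meas_all (P := fun _ y => 2 ^ k ≤ s.sz {z | F n z y} y) measurable_id ?_
      exact measurableSet_setOfPred.1 (measurableSet_le measurable_const
        (s.meas_szF (hF n) measurable_snd measurable_snd))
  have hall : ∀ (P : X → Prop) {x y : X}, s.E x y → ((∀ u, s.E x u → P u) ↔ ∀ u, s.E y u → P u) :=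
    fun P x y h => ⟨fun h' u hu => h' u (s.trans h hu), fun h' u hu => h' u (s.trans (s.symm h) hu)⟩
  have hCi0 : ∀ x y, s.E x y → (x ∈ C ↔ y ∈ C) := by
    intro x y h
    simp only [hCdef, mem_ofPred_eq]
    simp only [hall _ h, s.ub_E F _ h]
  have hCi : EInvariant s.E C := by
    intro x y h
    first
      | exact hCi0 x y h
      | exact fun hx => (hCi0 x y h).1 hx
  set δ : ℕ → ℝ≥0∞ := fun k => r * 8⁻¹ * (2⁻¹) ^ k with hδ
  have hδ0 : ∀ k, δ k ≠ 0 := fun k => by simp [hδ, hr0]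
  set η : ℕ → X → ℝ≥0∞ := fun k x => s.ub F (B k \ B (k + 1)) x + δ k with hη
  have hηm : ∀ k, Measurable (η k) := fun k => (s.ub_meas hF (hL k)).add_const _
  have hηE : ∀ k x y, s.E x y → η k x = η k y := fun k x y h => by
    simp only [hη, s.ub_E F _ h]
  have hη0 : ∀ k x, η k x ≠ 0 := fun k x => by simp [hη, hδ0]
  let R : ℕ → ℕ → X → Prop := fun i n x => ∀ y, s.E x y → (s.av (F n) (B i \ B (i + 1)) y ≤ η i x ∧
    1 ≤ η i x * s.sz {z | F n z y} y) ∧ r ≤ s.av (F n) (B 0) y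
  have hRmono : ∀ i n m x, n ≤ m → R i n x → R i m x := by
    intro i n m x hnm h
    have h1 := s.up_mono (hF n) (hF m) (hFm n m hnm) (fun y hy => (h y hy).1.1)
    have h2 := s.low_mono (hF n) (hF m) (hFm n m hnm) (fun y hy => (h y hy).2)
    intro y hy
    refine ⟨⟨h1 y hy, (h y hy).1.2.trans ?_⟩, h2 y hy⟩
    exact mul_le_mul_right (sm_mono _ fun z hz => hFm n m hnm _ _ hz) _
  have hRex : ∀ i x, x ∈ C → ∃ n, R i n x := by
    rintro i x ⟨⟨n1, h1⟩, h2, h3⟩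
    have htop : s.ub F (B i \ B (i + 1)) x ≠ ⊤ := by
      intro htop
      have : (⊤ : ℝ≥0∞) ≤ ∑' k, s.ub F (B k \ B (k + 1)) x := by
        rw [← htop]; exact ENNReal.le_tsum i
      rw [top_le_iff.1 this] at h2
      simp [hr] at h2
    obtain ⟨n2, hn2⟩ := s.ub_lt (c := η i x) (ENNReal.lt_add_right htop (hδ0 i))
    obtain ⟨k, hk⟩ := ENNReal.exists_nat_gt (ENNReal.inv_ne_top.2 (hη0 i x))
    obtain ⟨n3, hn3⟩ := h3 k
    let n := max n1 (max n2 n3)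
    have a1 : n1 ≤ n := le_max_left _ _
    have a2 : n2 ≤ n := (le_max_left _ _).trans (le_max_right _ _)
    have a3 : n3 ≤ n := (le_max_right _ _).trans (le_max_right _ _)
    refine ⟨n, fun y hy => ⟨⟨s.up_mono (hF n2) (hF n) (hFm _ _ a2) hn2 y hy, ?_⟩,
      s.low_mono (hF n1) (hF n) (hFm _ _ a1) h1 y hy⟩⟩
    have h4 : (η i x)⁻¹ ≤ s.sz {z | F n z y} y := by
      refine hk.le.trans ?_
      refine le_trans ?_ ((hn3 y hy).trans (sm_mono _ fun z hz => hFm n3 n a3 _ _ hz))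
      exact_mod_cast (Nat.lt_two_pow_self (n := k)).le
    have hηt : η i x ≠ ⊤ := by
      simp only [hη]
      refine ENNReal.add_ne_top.2 ⟨htop, ?_⟩
      simp only [hδ]
      finiteness
    calc 1 = η i x * (η i x)⁻¹ := (ENNReal.mul_inv_cancel (hη0 i x) hηt).symm
      _ ≤ _ := mul_le_mul_right h4 _
  have hQ : ∀ k x, ∃ n, (∀ i, i ≤ k → R i n x) ∨ x ∉ C := by
    intro k x
    by_cases hx : x ∈ C
    · choose n hn using fun i => hRex i x hx
      refine ⟨(Finset.range (k + 1)).sup n, Or.inl fun i hi => hRmono _ _ _ _ ?_ (hn i)⟩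
      exact Finset.le_sup (f := n) (Finset.mem_range.2 (by omega))
    · exact ⟨0, Or.inr hx⟩
  have hRm : ∀ i n, Measurable fun x => R i n x := by
    intro i n
    refine s.meas_all (P := fun x y => (s.av (F n) (B i \ B (i + 1)) y ≤ η i x ∧
      1 ≤ η i x * s.sz {z | F n z y} y) ∧ r ≤ s.av (F n) (B 0) y) measurable_id ?_
    refine ((measurableSet_setOfPred.1 (measurableSet_le (s.meas_av (hF n) (hL i) measurable_snd)
      ((hηm i).comp measurable_fst))).and (measurableSet_setOfPred.1
      (measurableSet_le measurable_const (((hηm i).comp measurable_fst).mul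
        (s.meas_szF (hF n) measurable_snd measurable_snd))))).and
      (measurableSet_setOfPred.1 (measurableSet_le measurable_const
        (s.meas_av (hF n) (hB 0) measurable_snd)))
  let N : ℕ → X → ℕ := fun k x => Nat.find (hQ k x)
  have hNm : ∀ k, Measurable (N k) := by
    intro k
    refine measurable_find (hQ k) fun n => measurableSet_setOfPred.2 (Measurable.or ?_ ?_)
    · exact Measurable.forall fun i => Measurable.forall fun _ => hRm i n
    · exact (meas_mem measurable_id hC).not
  have hNE : ∀ k x y, s.E x y → N k x = N k y := by
    intro k x y h
    refine Nat.find_congr' fun {n} => ?_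
    have hR : ∀ i, R i n x ↔ R i n y := by
      intro i
      simp only [R, hηE i x y h]
      exact hall _ h
    simp only [hR, hCi0 x y h]
  have hNR : ∀ k x, x ∈ C → R k (N k x) x := by
    intro k x hx
    rcases Nat.find_spec (hQ k x) with h | h
    · exact h k le_rfl
    · exact absurd hx h
  have hNmono : ∀ i k x, i ≤ k → N i x ≤ N k x := by
    intro i k x hik
    refine Nat.find_mono fun n h => ?_
    exact h.imp (fun h j hj => h j (hj.trans hik)) id
  refine s.sa_core (P := fun k x y => F (N k x) x y) (fun k => s.glue hF (hNm k) (hNE k)) ?_ hB hBa hB0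
    hC hCi hηm hηE hr ?_ ?_ ?_ (fun x _ k => hη0 k x) ?_
  · intro i k hik x y h
    exact hFm _ _ (hNmono i k x hik) _ _ h
  · intro x hx k
    have := (hNR k x hx x (s.refl x)).2
    simp only [av] at this ⊢
    rwa [s.glue_cl hF (hNE k) x]
  · intro x hx k
    have := (hNR k x hx x (s.refl x)).1.1
    simp only [av] at this ⊢
    rwa [s.glue_cl hF (hNE k) x]
  · intro x hx k
    have := (hNR k x hx x (s.refl x)).1.2
    rwa [s.glue_cl hF (hNE k) x]
  · intro x hx k
    have h2 := hx.2.1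
    refine (ENNReal.sum_le_tsum _).trans ?_
    simp only [hη, mul_add]
    rw [ENNReal.tsum_add, ENNReal.tsum_mul_left, ENNReal.tsum_mul_left]
    simp only [hδ]
    rw [ENNReal.tsum_mul_left, ENNReal.tsum_geometric_two]
    have e1 : 2 * ∑' k, s.ub F (B k \ B (k + 1)) x ≤ r / 2 := by
      rw [ENNReal.le_div_iff_mul_le (by simp) (by simp)]
      calc _ = 4 * ∑' k, s.ub F (B k \ B (k + 1)) x := by ring
        _ ≤ r := h2
    have e2 : 2 * (r * 8⁻¹ * 2) ≤ r / 2 := by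
      rw [ENNReal.le_div_iff_mul_le (by simp) (by simp)]
      calc 2 * (r * 8⁻¹ * 2) * 2 = r * (8 * 8⁻¹) := by ring
        _ = r := by rw [ENNReal.mul_inv_cancel (by simp) (by simp), mul_one]
        _ ≤ r := le_rfl
    calc _ ≤ r / 2 + r / 2 := add_le_add e1 e2
      _ = r := ENNReal.add_halves r

end Sys
end CocycleNadkarni
end

section
set_option linter.unusedSectionVars false
set_option linter.style.haveILetI false
open MeasureTheory Set ENNReal
namespace CocycleNadkarni

/-- finitely additive probability measure on all sets -/
structure FA {X : Type*} (m : Set X → ℝ≥0∞) : Prop where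
  one : m univ = 1
  add : ∀ A B, Disjoint A B → m (A ∪ B) = m A + m B

/-- vanishing sequence -/
def Van {X : Type*} [MeasurableSpace X] (D : ℕ → Set X) : Prop :=
  Antitone D ∧ (∀ k, MeasurableSet (D k)) ∧ ⋂ k, D k = ∅

namespace FA
variable {X : Type*} {m : Set X → ℝ≥0∞}


theorem mono (hm : FA m) {A B : Set X} (h : A ⊆ B) : m A ≤ m B := by
  rw [← union_sdiff_cancel h, hm.add _ _ disjoint_sdiff_right]
  exact le_self_add

theorem le_one (hm : FA m) (A : Set X) : m A ≤ 1 := hm.one ▸ hm.mono (subset_univ A)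

theorem ne_top (hm : FA m) (A : Set X) : m A ≠ ⊤ := ((hm.le_one A).trans_lt one_lt_top).ne

theorem empty (hm : FA m) : m ∅ = 0 := by
  have := hm.add ∅ univ (by simp)
  rw [empty_union, hm.one] at this
  have h2 : (0 : ℝ≥0∞) + 1 = m ∅ + 1 := by rw [zero_add]; exact this
  exact ((ENNReal.add_left_inj one_ne_top).1 h2).symm

theorem compl (hm : FA m) (A : Set X) : m A + m Aᶜ = 1 := by
  rw [← hm.add _ _ disjoint_compl_right, union_compl_self, hm.one]

theorem compl_eq (hm : FA m) (A : Set X) : m Aᶜ = 1 - m A :=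
  ENNReal.eq_sub_of_add_eq (hm.ne_top A) (by rw [add_comm]; exact hm.compl A)

theorem sum_range (hm : FA m) {f : ℕ → Set X} (hf : Pairwise (Function.onFun Disjoint f)) (k : ℕ) :
    m (⋃ i, f i) = (∑ i ∈ Finset.range k, m (f i)) + m (⋃ i, f (i + k)) := by
  induction k with
  | zero => simp
  | succ k ih =>
    have h1 : (⋃ i, f (i + k)) = f k ∪ ⋃ i, f (i + (k + 1)) := by
      ext x
      simp only [mem_iUnion, mem_union]
      constructor
      · rintro ⟨i, hi⟩
        rcases i with _ | i
        · left; simpa using hi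
        · right; exact ⟨i, by rwa [show i + (k + 1) = i + 1 + k by omega]⟩
      · rintro (h | ⟨i, hi⟩)
        · exact ⟨0, by simpa using h⟩
        · exact ⟨i + 1, by rwa [show i + 1 + k = i + (k + 1) by omega]⟩
    have h2 : Disjoint (f k) (⋃ i, f (i + (k + 1))) :=
      disjoint_iUnion_right.2 fun i => hf (by omega)
    rw [ih, h1, hm.add _ _ h2, Finset.sum_range_succ, add_assoc]

end FA

theorem van_tail {X : Type*} [MeasurableSpace X] {f : ℕ → Set X} (hfm : ∀ i, MeasurableSet (f i))
    (hf : Pairwise (Function.onFun Disjoint f)) : Van (fun k => ⋃ i, f (i + k)) := by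
  refine ⟨?_, fun k => MeasurableSet.iUnion fun i => hfm _, ?_⟩
  · intro k l hkl
    refine iUnion_subset fun i => ?_
    have : f (i + l) = f (i + (l - k) + k) := by congr 1; omega
    rw [this]
    exact subset_iUnion (fun i => f (i + k)) (i + (l - k))
  · refine eq_empty_of_forall_notMem fun x hx => ?_
    simp only [mem_iInter, mem_iUnion] at hx
    obtain ⟨i, hi⟩ := hx 0
    obtain ⟨j, hj⟩ := hx (i + 1)
    have : i + 0 ≠ j + (i + 1) := by omega
    exact disjoint_left.1 (hf this) hi hj

theorem lemma_K (A : Set ℝ) (hA : MeasurableSet A) :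
    ∃ (ι : Type) (_ : Countable ι) (D : ι → ℕ → Set ℝ), (∀ i, Van (D i)) ∧
      ∀ (m : Set ℝ → ℝ≥0∞), FA m → ∀ (μ : Measure ℝ), IsProbabilityMeasure μ →
        (∀ q : ℚ, μ (Iic (q : ℝ)) = m (Iic (q : ℝ))) →
        (∀ i, Filter.Tendsto (fun k => m (D i k)) Filter.atTop (nhds 0)) → μ A = m A := by
  induction A, hA using MeasurableSpace.induction_on_inter (s := ⋃ a : ℚ, {Iic (a : ℝ)})
    (h_eq := by rw [← Real.borel_eq_generateFrom_Iic_rat])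
    (h_inter := Real.isPiSystem_Iic_rat) with
  | empty =>
    refine ⟨Empty, inferInstance, fun i => i.elim, fun i => i.elim, ?_⟩
    intro m hm μ _ _ _
    rw [measure_empty, hm.empty]
  | basic t ht =>
    refine ⟨Empty, inferInstance, fun i => i.elim, fun i => i.elim, ?_⟩
    intro m hm μ _ h _
    simp only [mem_iUnion, mem_singleton_iff] at ht
    obtain ⟨q, rfl⟩ := ht
    exact h q
  | compl t ht ih =>
    obtain ⟨ι, hι, D, hD, h⟩ := ih
    refine ⟨ι, hι, D, hD, ?_⟩
    intro m hm μ hμ h1 h2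
    rw [hm.compl_eq, prob_compl_eq_one_sub ht, h m hm μ hμ h1 h2]
  | iUnion f hd hf ih =>
    choose ι hι D hD h using ih
    refine ⟨Option (Σ i, ι i), inferInstance, fun o => o.elim (fun k => ⋃ i, f (i + k))
      (fun p => D p.1 p.2), ?_, ?_⟩
    · rintro (_ | p)
      · exact van_tail hf hd
      · exact hD p.1 p.2
    · intro m hm μ hμ h1 h2
      have h3 : ∀ i, μ (f i) = m (f i) := fun i => h i m hm μ hμ h1 fun j => h2 (some ⟨i, j⟩)
      have h4 := h2 none
      simp only [Option.elim] at h4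
      rw [measure_iUnion hd hf]
      simp_rw [h3]
      have h5 := (ENNReal.tendsto_nat_tsum fun i => m (f i)).add h4
      rw [add_zero] at h5
      refine tendsto_nhds_unique h5 ?_
      simp_rw [← hm.sum_range hd]
      exact tendsto_const_nhds

theorem base_K :
    ∃ (ι : Type) (_ : Countable ι) (D : ι → ℕ → Set ℝ), (∀ i, Van (D i)) ∧
      ∀ (m : Set ℝ → ℝ≥0∞), FA m →
        (∀ i, Filter.Tendsto (fun k => m (D i k)) Filter.atTop (nhds 0)) →
        ∃ (μ : Measure ℝ), IsProbabilityMeasure μ ∧ ∀ q : ℚ, μ (Iic (q : ℝ)) = m (Iic (q : ℝ)) := by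
  refine ⟨Option (Option ℚ), inferInstance, fun o => o.elim (fun n => Iic (-(n : ℝ)))
    fun o => o.elim (fun n => Ioi (n : ℝ)) fun q n => Ioc (q : ℝ) (q + 1 / ((n : ℝ) + 1)), ?_, ?_⟩
  · rintro (_ | _ | q)
    · refine ⟨fun a b h => Iic_subset_Iic.2 (by simpa using h), fun k => measurableSet_Iic, ?_⟩
      refine eq_empty_of_forall_notMem fun x hx => ?_
      simp only [Option.elim, mem_iInter, mem_Iic] at hx
      obtain ⟨n, hn⟩ := exists_nat_gt (-x)
      linarith [hx n]
    · refine ⟨fun a b h => Ioi_subset_Ioi (by simpa using h), fun k => measurableSet_Ioi, ?_⟩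
      refine eq_empty_of_forall_notMem fun x hx => ?_
      simp only [Option.elim, mem_iInter, mem_Ioi] at hx
      obtain ⟨n, hn⟩ := exists_nat_gt x
      linarith [hx n]
    · refine ⟨fun a b h => Ioc_subset_Ioc_right (by gcongr), fun k => measurableSet_Ioc, ?_⟩
      refine eq_empty_of_forall_notMem fun x hx => ?_
      simp only [Option.elim, mem_iInter, mem_Ioc] at hx
      obtain ⟨n, hn⟩ := exists_nat_one_div_lt (sub_pos.2 (hx 0).1)
      linarith [(hx n).2]
  · intro m hm h
    have h1 : Filter.Tendsto (fun n : ℕ => m (Iic (-(n : ℝ)))) Filter.atTop (nhds 0) := h none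
    have h2 : Filter.Tendsto (fun n : ℕ => m (Ioi (n : ℝ))) Filter.atTop (nhds 0) := h (some none)
    have h3 : ∀ q : ℚ, Filter.Tendsto (fun n : ℕ => m (Ioc (q : ℝ) (q + 1 / ((n : ℝ) + 1))))
      Filter.atTop (nhds 0) := fun q => h (some (some q))
    have toR : ∀ {u : ℕ → Set ℝ}, Filter.Tendsto (fun n => m (u n)) Filter.atTop (nhds 0) →
        Filter.Tendsto (fun n => (m (u n)).toReal) Filter.atTop (nhds 0) := by
      intro u hu
      have := (ENNReal.tendsto_toReal zero_ne_top).comp hu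
      rw [toReal_zero] at this
      exact this
    have h1 := toR h1
    have h2 := toR h2
    have h3 := fun q => toR (h3 q)
    set f : ℝ → ℝ := fun t => (m (Iic t)).toReal with hf
    have hmono : Monotone f := fun a b hab =>
      (ENNReal.toReal_le_toReal (hm.ne_top _) (hm.ne_top _)).2 (hm.mono (Iic_subset_Iic.2 hab))
    have hf0 : ∀ t, 0 ≤ f t := fun t => ENNReal.toReal_nonneg
    have hf1 : ∀ t, f t ≤ 1 := fun t => by
      have := (ENNReal.toReal_le_toReal (hm.ne_top _) one_ne_top).2 (hm.le_one (Iic t))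
      simpa using this
    have hbot : Filter.Tendsto f Filter.atBot (nhds 0) := by
      refine tendsto_order.2 ⟨fun a ha => Filter.Eventually.of_forall fun t => ha.trans_le (hf0 t), ?_⟩
      intro a ha
      obtain ⟨n, hn⟩ := ((tendsto_order.1 h1).2 a ha).exists
      filter_upwards [Filter.eventually_le_atBot (-(n : ℝ))] with t ht
      exact (hmono ht).trans_lt hn
    have htop : Filter.Tendsto f Filter.atTop (nhds 1) := by
      refine tendsto_order.2 ⟨?_, fun a ha => Filter.Eventually.of_forall fun t => (hf1 t).trans_lt ha⟩
      intro a ha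
      obtain ⟨n, hn⟩ := ((tendsto_order.1 h2).2 (1 - a) (by linarith)).exists
      filter_upwards [Filter.eventually_ge_atTop (n : ℝ)] with t ht
      refine lt_of_lt_of_le ?_ (hmono ht)
      have := congrArg ENNReal.toReal (hm.compl (Iic (n : ℝ)))
      rw [compl_Iic, ENNReal.toReal_add (hm.ne_top _) (hm.ne_top _), toReal_one] at this
      have h5 : f n = (m (Iic (n : ℝ))).toReal := rfl
      linarith
    have hq : ∀ q : ℚ, Function.rightLim f q = f q := by
      intro q
      refine le_antisymm ?_ (hmono.le_rightLim le_rfl)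
      have h4 : ∀ n : ℕ, Function.rightLim f q ≤
          f q + (m (Ioc (q : ℝ) (q + 1 / ((n : ℝ) + 1)))).toReal := by
        intro n
        have hlt : (q : ℝ) < q + 1 / ((n : ℝ) + 1) := by
          have : (0 : ℝ) < 1 / ((n : ℝ) + 1) := by positivity
          linarith
        refine (hmono.rightLim_le hlt).trans (le_of_eq ?_)
        simp only [hf]
        rw [← ENNReal.toReal_add (hm.ne_top _) (hm.ne_top _), ← hm.add _ _ (Iic_disjoint_Ioc le_rfl),
          Iic_union_Ioc_eq_Iic hlt.le]
      have h5 := (h3 q).const_add (f q)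
      rw [add_zero] at h5
      exact ge_of_tendsto' h5 h4
    set g := hmono.stieltjesFunction with hg
    have gb : Filter.Tendsto g Filter.atBot (nhds 0) := by
      have h6 : Filter.Tendsto (fun x : ℝ => f (x + 1)) Filter.atBot (nhds 0) :=
        hbot.comp (Filter.tendsto_atBot_add_const_right _ _ Filter.tendsto_id)
      refine tendsto_of_tendsto_of_tendsto_of_le_of_le tendsto_const_nhds h6 ?_ ?_
      · intro x; exact (hf0 x).trans (hmono.le_rightLim le_rfl)
      · intro x; exact hmono.rightLim_le (by linarith)
    have gt : Filter.Tendsto g Filter.atTop (nhds 1) := by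
      refine tendsto_of_tendsto_of_tendsto_of_le_of_le htop tendsto_const_nhds ?_ ?_
      · intro x; exact hmono.le_rightLim le_rfl
      · intro x; exact (hmono.rightLim_le (show x < x + 1 by linarith)).trans (hf1 _)
    refine ⟨g.measure, ⟨?_⟩, ?_⟩
    · rw [g.measure_univ gb gt]; simp
    · intro q
      rw [g.measure_Iic gb, sub_zero]
      change ENNReal.ofReal (Function.rightLim f q) = _
      rw [hq]
      exact ENNReal.ofReal_toReal (hm.ne_top _)

theorem test_thm {X : Type*} [MeasurableSpace X] [StandardBorelSpace X] {κ : Type} [Countable κ]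
    (A : κ → Set X) (hA : ∀ i, MeasurableSet (A i)) :
    ∃ (ι : Type) (_ : Countable ι) (D : ι → ℕ → Set X), (∀ i, Van (D i)) ∧
      ∀ (m : Set X → ℝ≥0∞), FA m →
        (∀ i, Filter.Tendsto (fun k => m (D i k)) Filter.atTop (nhds 0)) →
        ∃ (μ : Measure X), IsProbabilityMeasure μ ∧ ∀ i, μ (A i) = m (A i) := by
  have he := measurableEmbedding_embeddingReal X
  set j := embeddingReal X with hj
  obtain ⟨ι0, hι0, D0, hD0, h0⟩ := base_K
  obtain ⟨ι1, hι1, D1, hD1, h1⟩ := lemma_K (range j)ᶜ he.measurableSet_range.compl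
  have hK := fun i => lemma_K (j '' A i) (he.measurableSet_image.2 (hA i))
  choose ι2 hι2 D2 hD2 h2 using hK
  have hpull : ∀ {D : ℕ → Set ℝ}, Van D → Van (fun k => j ⁻¹' (D k)) := by
    intro D hD
    refine ⟨fun a b h => preimage_mono (hD.1 h), fun k => he.measurable (hD.2.1 k), ?_⟩
    rw [← preimage_iInter, hD.2.2, preimage_empty]
  refine ⟨ι0 ⊕ (ι1 ⊕ Σ i, ι2 i), inferInstance, Sum.elim (fun i k => j ⁻¹' (D0 i k))
    (Sum.elim (fun i k => j ⁻¹' (D1 i k)) (fun p k => j ⁻¹' (D2 p.1 p.2 k))), ?_, ?_⟩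
  · rintro (i | i | p)
    · exact hpull (hD0 i)
    · exact hpull (hD1 i)
    · exact hpull (hD2 p.1 p.2)
  · intro m hm hlim
    set m' : Set ℝ → ℝ≥0∞ := fun S => m (j ⁻¹' S) with hm'
    have hFA : FA m' := ⟨by simp [hm', hm.one], fun S T hST => by
      simp only [hm', preimage_union]
      exact hm.add _ _ (hST.preimage j)⟩
    obtain ⟨μ, hμ, hμq⟩ := h0 m' hFA (fun i => hlim (Sum.inl i))
    have e1 : μ (range j)ᶜ = 0 := by
      rw [h1 m' hFA μ hμ hμq (fun i => hlim (Sum.inr (Sum.inl i)))]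
      simp only [hm']
      rw [preimage_compl, preimage_range, compl_univ, hm.empty]
    have e2 : ∀ i, μ (j '' A i) = m (A i) := by
      intro i
      rw [h2 i m' hFA μ hμ hμq (fun k => hlim (Sum.inr (Sum.inr ⟨i, k⟩)))]
      simp only [hm']
      rw [preimage_image_eq _ he.injective]
    refine ⟨μ.comap j, ⟨?_⟩, fun i => ?_⟩
    · rw [he.comap_apply, image_univ]
      exact (prob_compl_eq_zero_iff he.measurableSet_range).1 e1
    · rw [he.comap_apply, e2]

end CocycleNadkarni
end

section
set_option linter.unusedSectionVars false
set_option linter.style.haveILetI false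
open MeasureTheory Set ENNReal
namespace CocycleNadkarni

/-- ratios converging to one -/
noncomputable def dl (d : ℕ) : ℝ≥0∞ := 1 + ((d + 1 : ℕ) : ℝ≥0∞)⁻¹

theorem dl_gt (d : ℕ) : 1 < dl d := by
  rw [dl]
  exact ENNReal.lt_add_right one_ne_top (by simp)

theorem dl_top (d : ℕ) : dl d ≠ ⊤ := by
  rw [dl]
  exact ENNReal.add_ne_top.2 ⟨one_ne_top, ENNReal.inv_ne_top.2 (by simp)⟩

theorem dl_zero (d : ℕ) : dl d ≠ 0 := (zero_lt_one.trans (dl_gt d)).ne'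

theorem dl_lim {a b : ℝ≥0∞} (h : ∀ d, a ≤ dl d * b) : a ≤ b := by
  have h1 : Filter.Tendsto (fun d => dl d) Filter.atTop (nhds 1) := by
    have := (ENNReal.tendsto_inv_nat_nhds_zero.comp (Filter.tendsto_add_atTop_nat 1)).const_add 1
    rw [add_zero] at this
    exact this
  have h2 := ENNReal.Tendsto.mul_const (b := b) h1 (Or.inl one_ne_zero)
  rw [one_mul] at h2
  exact ge_of_tendsto' h2 h

/-- test pieces -/
def pc {X : Type*} (f : X → ℝ≥0∞) (U : Set X) (d : ℕ) (k : ℤ) : Set X :=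
  {x | x ∈ U ∧ dl d ^ k ≤ f x ∧ f x < dl d ^ (k + 1)}

theorem pc_meas {X : Type*} [MeasurableSpace X] {f : X → ℝ≥0∞} (hf : Measurable f) {U : Set X}
    (hU : MeasurableSet U) (d : ℕ) (k : ℤ) : MeasurableSet (pc f U d k) :=
  hU.inter ((measurableSet_le measurable_const hf).inter (measurableSet_lt hf measurable_const))

theorem pc_union {X : Type*} {f : X → ℝ≥0∞} (hf0 : ∀ x, f x ≠ 0) (hft : ∀ x, f x ≠ ⊤) (U : Set X)
    (d : ℕ) : ⋃ k, pc f U d k = U := by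
  ext x
  simp only [mem_iUnion, pc, mem_ofPred_eq]
  constructor
  · rintro ⟨k, h⟩; exact h.1
  · intro h
    obtain ⟨k, hk⟩ := ENNReal.exists_mem_Ico_zpow (hf0 x) (hft x) (dl_gt d) (dl_top d)
    exact ⟨k, h, hk.1, hk.2⟩

theorem pc_disj {X : Type*} (f : X → ℝ≥0∞) (U : Set X) (d : ℕ) :
    Pairwise (Function.onFun Disjoint (pc f U d)) := by
  have key : ∀ k l : ℤ, k < l → Disjoint (pc f U d k) (pc f U d l) := by
    intro k l hkl
    refine disjoint_left.2 fun x hx hx' => ?_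
    have h1 : dl d ^ (k + 1) ≤ dl d ^ l := ENNReal.zpow_le_of_le (dl_gt d).le (by omega)
    exact absurd (hx.2.2.trans_le (h1.trans hx'.2.1)) (lt_irrefl _)
  intro k l hkl
  rcases lt_or_gt_of_ne hkl with h | h
  · exact key k l h
  · exact (key l k h).symm

theorem zpow_dl (d : ℕ) (k : ℤ) : dl d ^ (k + 1) = dl d * dl d ^ k := by
  rw [ENNReal.zpow_add (dl_zero d) (dl_top d), zpow_one, mul_comm]

/-- a countable pi-system generating the Borel sets and containing `univ` -/
noncomputable def Uq (X : Type*) [MeasurableSpace X] [StandardBorelSpace X] : Option ℚ → Set X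
  | none => univ
  | some q => embeddingReal X ⁻¹' (Iic (q : ℝ))

theorem Uq_meas {X : Type*} [MeasurableSpace X] [StandardBorelSpace X] (o : Option ℚ) :
    MeasurableSet (Uq X o) := by
  rcases o with _ | q
  · exact MeasurableSet.univ
  · exact (measurableEmbedding_embeddingReal X).measurable measurableSet_Iic

theorem Uq_ext {X : Type*} [MeasurableSpace X] [StandardBorelSpace X] {μ ν : Measure X}
    [IsFiniteMeasure μ] (h : ∀ o, μ (Uq X o) = ν (Uq X o)) : μ = ν := by
  have he := measurableEmbedding_embeddingReal X
  refine ext_of_generate_finite {t : Set X | ∃ u ∈ (⋃ a : ℚ, {Iic (a : ℝ)}), embeddingReal X ⁻¹' u = t}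
    ?_ (Real.isPiSystem_Iic_rat.comap _) ?_ (h none)
  · refine he.comap_eq.symm.trans ?_
    rw [BorelSpace.measurable_eq (α := ℝ), Real.borel_eq_generateFrom_Iic_rat,
      MeasurableSpace.comap_generateFrom]
    rfl
  · rintro _ ⟨u, hu, rfl⟩
    simp only [mem_iUnion, mem_singleton_iff] at hu
    obtain ⟨q, rfl⟩ := hu
    exact h (some q)

theorem inv_of_tests {X : Type*} [MeasurableSpace X] [StandardBorelSpace X] {μ : Measure X}
    [IsProbabilityMeasure μ] (g : X ≃ᵐ X) {f : X → ℝ≥0∞} (hf : Measurable f) (hf0 : ∀ x, f x ≠ 0)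
    (hft : ∀ x, f x ≠ ⊤)
    (h1 : ∀ o d k, dl d ^ k * μ (pc f (Uq X o) d k) ≤ μ (g.symm ⁻¹' (pc f (Uq X o) d k)))
    (h2 : ∀ o d k, μ (g.symm ⁻¹' (pc f (Uq X o) d k)) ≤ dl d ^ (k + 1) * μ (pc f (Uq X o) d k))
    (B : Set X) (hB : MeasurableSet B) : μ (g.symm ⁻¹' B) = ∫⁻ x in B, f x ∂μ := by
  have : IsProbabilityMeasure (μ.map g.symm) :=
    Measure.isProbabilityMeasure_map g.symm.measurable.aemeasurable
  have key : μ.map g.symm = μ.withDensity f := by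
    refine Uq_ext fun o => ?_
    have hpm := fun d k => pc_meas hf (Uq_meas (X := X) o) d k
    rw [Measure.map_apply g.symm.measurable (Uq_meas o), withDensity_apply _ (Uq_meas o)]
    have e1 : ∀ d, μ (g.symm ⁻¹' (Uq X o)) = ∑' k, μ (g.symm ⁻¹' (pc f (Uq X o) d k)) := by
      intro d
      rw [← measure_iUnion, ← preimage_iUnion, pc_union hf0 hft]
      · exact fun k l hkl => (pc_disj f (Uq X o) d hkl).preimage _
      · exact fun k => g.symm.measurable (hpm d k)
    have e2 : ∀ d, ∫⁻ x in Uq X o, f x ∂μ = ∑' k, ∫⁻ x in pc f (Uq X o) d k, f x ∂μ := by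
      intro d
      rw [← lintegral_iUnion (hpm d) (pc_disj f (Uq X o) d), pc_union hf0 hft]
    apply le_antisymm
    · refine dl_lim fun d => ?_
      rw [e1 d, e2 d, ← ENNReal.tsum_mul_left]
      refine ENNReal.tsum_le_tsum fun k => (h2 o d k).trans ?_
      rw [zpow_dl, mul_assoc]
      refine mul_le_mul_right ?_ _
      rw [← setLIntegral_const]
      exact setLIntegral_mono' (hpm d k) fun x hx => hx.2.1
    · refine dl_lim fun d => ?_
      rw [e1 d, e2 d, ← ENNReal.tsum_mul_left]
      refine ENNReal.tsum_le_tsum fun k => ?_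
      refine le_trans ?_ (mul_le_mul_right (h1 o d k) _)
      rw [← mul_assoc, ← zpow_dl, ← setLIntegral_const]
      exact setLIntegral_mono' (hpm d k) fun x hx => hx.2.2.le
  have := congrArg (fun ν : Measure X => ν B) key
  rwa [Measure.map_apply g.symm.measurable hB, withDensity_apply _ hB] at this

namespace Sys
variable {X : Type*} [MeasurableSpace X] [StandardBorelSpace X] (s : Sys X)

theorem inv_of_G {μ : Measure X} (h : ∀ n B, MeasurableSet B →
    μ ((s.G n).symm ⁻¹' B) = ∫⁻ x in B, s.w x (s.G n x) ∂μ) : IsInvariant s.E s.ρ μ := by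
  intro T hT B hB
  have hmeq : ∀ n, MeasurableSet {x | s.G n x = T x} := fun n =>
    measurableSet_eq_fun (s.G n).measurable T.measurable
  set P : ℕ → Set X := fun n => B ∩ disjointed (fun n => {x | s.G n x = T x}) n with hP
  have hPm : ∀ n, MeasurableSet (P n) := fun n => hB.inter (MeasurableSet.disjointed hmeq n)
  have hPd : Pairwise (Function.onFun Disjoint P) := fun k l hkl =>
    (disjoint_disjointed (fun n => {x | s.G n x = T x}) hkl).mono inter_subset_right inter_subset_right
  have hPU : ⋃ n, P n = B := by
    rw [hP, ← inter_iUnion, iUnion_disjointed, inter_eq_left]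
    intro x _
    obtain ⟨n, hn⟩ := (s.hG x (T x)).1 (s.symm (hT x))
    exact mem_iUnion.2 ⟨n, hn⟩
  have hPT : ∀ n, ∀ x ∈ P n, s.G n x = T x := fun n x hx =>
    disjointed_subset (fun n => {x | s.G n x = T x}) n hx.2
  have e1 : μ (T '' B) = ∑' n, μ (T '' P n) := by
    conv_lhs => rw [← hPU]
    rw [image_iUnion, measure_iUnion]
    · exact fun k l hkl => (disjoint_image_iff T.injective).2 (hPd hkl)
    · exact fun n => T.measurableEmbedding.measurableSet_image.2 (hPm n)
  have e2 : ∫⁻ x in B, ENNReal.ofReal (s.ρ (T x) x) ∂μ =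
      ∑' n, ∫⁻ x in P n, ENNReal.ofReal (s.ρ (T x) x) ∂μ := by
    rw [← lintegral_iUnion hPm hPd, hPU]
  rw [e1, e2]
  refine tsum_congr fun n => ?_
  have e3 : T '' P n = (s.G n).symm ⁻¹' (P n) := by
    rw [← MeasurableEquiv.image_eq_preimage_symm]
    exact image_congr fun x hx => (hPT n x hx).symm
  rw [e3, h n _ (hPm n)]
  refine setLIntegral_congr_fun (hPm n) fun x hx => ?_
  simp only [w, hPT n x hx]

end Sys
end CocycleNadkarni
end

section
set_option linter.unusedSectionVars false
set_option linter.style.haveILetI false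
open MeasureTheory Set ENNReal
namespace CocycleNadkarni

theorem nnrat_btwn {a b : ℝ≥0∞} (h : a < b) :
    ∃ q : NNRat, a < ((q : NNReal) : ℝ≥0∞) ∧ ((q : NNReal) : ℝ≥0∞) < b := by
  obtain ⟨q, hq, h1, h2⟩ := ENNReal.lt_iff_exists_rat_btwn.1 h
  let p : NNRat := ⟨q, hq⟩
  have e : Real.toNNReal (q : ℝ) = (p : NNReal) := by
    apply NNReal.eq
    rw [Real.coe_toNNReal _ (by exact_mod_cast hq)]
    rfl
  rw [e] at h1 h2
  exact ⟨p, h1, h2⟩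

theorem nnrat_lt {a b : NNRat} (h : ((a : NNReal) : ℝ≥0∞) < ((b : NNReal) : ℝ≥0∞)) : a < b := by
  exact_mod_cast h

namespace Sys
variable {X : Type*} [MeasurableSpace X] [StandardBorelSpace X] (s : Sys X)

theorem Comp.iUnionC {s : Sys X} {ι : Type} [Countable ι] {C : ι → Set X} (h : ∀ i, s.Comp (C i))
    {D : Set X} (hD : s.Comp D) : s.Comp (D ∪ ⋃ i, C i) := by
  rcases isEmpty_or_nonempty ι with hι | hι
  · simpa using hD
  · obtain ⟨e, he⟩ := exists_surjective_nat ι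
    rw [← he.iUnion_comp]
    exact hD.union (Comp.iUnion fun n => h (e n))

theorem exists_m {F : ℕ → X → X → Prop} (hF : ∀ n, IsFinSubequiv s.E (F n)) (x0 : X) :
    ∃ m : Set X → ℝ≥0∞, FA m ∧ ∀ A, Filter.Tendsto (fun n => s.av (F n) A x0)
      (Filter.hyperfilter ℕ : Filter ℕ) (nhds (m A)) := by
  have h : ∀ A : Set X, ∃ l, Filter.Tendsto (fun n => s.av (F n) A x0)
      (Filter.hyperfilter ℕ : Filter ℕ) (nhds l) := by
    intro A
    obtain ⟨l, -, hl⟩ := isCompact_univ.ultrafilter_le_nhds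
      ((Filter.hyperfilter ℕ).map (fun n => s.av (F n) A x0)) (by simp)
    exact ⟨l, hl⟩
  choose m hm using h
  refine ⟨m, ⟨?_, ?_⟩, hm⟩
  · refine tendsto_nhds_unique (hm univ) ?_
    have : (fun n => s.av (F n) univ x0) = fun _ => 1 := by
      funext n
      rw [av, univ_inter, ENNReal.div_self (s.fpos (hF n) x0) (s.ftop (hF n) x0 x0)]
    rw [this]
    exact tendsto_const_nhds
  · intro A B hAB
    refine tendsto_nhds_unique (hm (A ∪ B)) ?_
    have : (fun n => s.av (F n) (A ∪ B) x0) = fun n => s.av (F n) A x0 + s.av (F n) B x0 := by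
      funext n
      rw [av, av, av, ENNReal.div_add_div_same, union_inter_distrib_right, sz, sm_union]
      exact hAB.mono inter_subset_left inter_subset_left
    rw [this]
    exact (hm A).add (hm B)

/-- the densities of `A` are asymptotically equalized on the class of `x` -/
def Good (F : ℕ → X → X → Prop) (x : X) (A : Set X) : Prop :=
  ∀ a b : NNRat, a < b →
    (∃ N, ∀ n, N ≤ n → ∀ y, s.E x y → ((a : NNReal) : ℝ≥0∞) ≤ s.av (F n) A y) ∨
    (∃ N, ∀ n, N ≤ n → ∀ y, s.E x y → s.av (F n) A y ≤ ((b : NNReal) : ℝ≥0∞))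

theorem ev_hyper {P : ℕ → Prop} {N : ℕ} (h : ∀ n, N ≤ n → P n) :
    ∀ᶠ n in (Filter.hyperfilter ℕ : Filter ℕ), P n := by
  have : ∀ᶠ n in Filter.atTop, P n := Filter.eventually_atTop.2 ⟨N, h⟩
  rw [← Nat.cofinite_eq_atTop] at this
  exact this.filter_mono Filter.hyperfilter_le_cofinite

theorem good_low {F : ℕ → X → X → Prop} {x0 : X} {A : Set X} (hg : s.Good F x0 A) {l c : ℝ≥0∞}
    (hl : Filter.Tendsto (fun n => s.av (F n) A x0) (Filter.hyperfilter ℕ : Filter ℕ) (nhds l))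
    (hc : c < l) : ∃ N, ∀ n, N ≤ n → ∀ y, s.E x0 y → c ≤ s.av (F n) A y := by
  obtain ⟨a, ha1, ha2⟩ := nnrat_btwn hc
  obtain ⟨b, hb1, hb2⟩ := nnrat_btwn ha2
  rcases hg a b (nnrat_lt hb1) with ⟨N, h⟩ | ⟨N, h⟩
  · exact ⟨N, fun n hn y hy => ha1.le.trans (h n hn y hy)⟩
  · exact absurd (le_of_tendsto hl (ev_hyper fun n hn => h n hn x0 (s.refl x0))) (not_le.2 hb2)

theorem good_up {F : ℕ → X → X → Prop} {x0 : X} {A : Set X} (hg : s.Good F x0 A) {l c : ℝ≥0∞}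
    (hl : Filter.Tendsto (fun n => s.av (F n) A x0) (Filter.hyperfilter ℕ : Filter ℕ) (nhds l))
    (hc : l < c) : ∃ N, ∀ n, N ≤ n → ∀ y, s.E x0 y → s.av (F n) A y ≤ c := by
  obtain ⟨b, hb1, hb2⟩ := nnrat_btwn hc
  obtain ⟨a, ha1, ha2⟩ := nnrat_btwn hb1
  rcases hg a b (nnrat_lt ha2) with ⟨N, h⟩ | ⟨N, h⟩
  · exact absurd (ge_of_tendsto hl (ev_hyper fun n hn => h n hn x0 (s.refl x0))) (not_le.2 ha1)
  · exact ⟨N, fun n hn y hy => (h n hn y hy).trans hb2.le⟩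

theorem good_inv {F : ℕ → X → X → Prop} (hF : ∀ n, IsFinSubequiv s.E (F n)) {x0 : X} {A : Set X}
    (g : X ≃ᵐ X) (hg : ∀ x, s.E x (g x))
    (h1 : s.Good F x0 A) (h2 : s.Good F x0 (g.symm ⁻¹' A)) {m : Set X → ℝ≥0∞}
    (hm : ∀ A, Filter.Tendsto (fun n => s.av (F n) A x0)
      (Filter.hyperfilter ℕ : Filter ℕ) (nhds (m A)))
    (hx : ∀ n, x0 ∉ {x | ∀ y, s.E x y → s.sz {z | z ∈ g.symm ⁻¹' A ∧ F n z y} y <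
      s.sz {z | z ∈ g.symm ⁻¹' A ∧ F n (g.symm z) y} y}) {c : ℝ≥0∞}
    (hc : ∀ a ∈ A, c ≤ s.w a (g a)) : c * m A ≤ m (g.symm ⁻¹' A) := by
  refine ENNReal.mul_le_of_forall_lt fun c' hc' a ha => ?_
  refine le_of_forall_gt_imp_ge_of_dense fun b hb => ?_
  obtain ⟨N1, hN1⟩ := s.good_low h1 (hm A) ha
  obtain ⟨N2, hN2⟩ := s.good_up h2 (hm _) hb
  obtain ⟨y, hy, h⟩ := s.inv_use g hg (hF (max N1 N2)) hc (hx _)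
  calc c' * a ≤ c * s.av (F (max N1 N2)) A y :=
        mul_le_mul' hc'.le (hN1 _ (le_max_left _ _) y hy)
    _ ≤ _ := h
    _ ≤ b := hN2 _ (le_max_right _ _) y hy

theorem good_sa {F : ℕ → X → X → Prop} {x0 : X} {B : ℕ → Set X} (hB : Van B)
    (h1 : ∀ k, s.Good F x0 (B k)) (h2 : ∀ k, s.Good F x0 (B k \ B (k + 1))) {m : Set X → ℝ≥0∞}
    (hFA : FA m)
    (hm : ∀ A, Filter.Tendsto (fun n => s.av (F n) A x0)
      (Filter.hyperfilter ℕ : Filter ℕ) (nhds (m A)))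
    (hbig : ∀ k : ℕ, ∃ N, ∀ n, N ≤ n → ∀ y, s.E x0 y → 2 ^ k ≤ s.sz {z | F n z y} y)
    (hx : ∀ (J : ℕ) (r : NNRat), r ≠ 0 → x0 ∉ {x | (∃ n, ∀ y, s.E x y →
      ((r : NNReal) : ℝ≥0∞) ≤ s.av (F n) (B (0 + J)) y) ∧
      (4 * ∑' k, s.ub F (B (k + J) \ B (k + 1 + J)) x ≤ ((r : NNReal) : ℝ≥0∞)) ∧
      ∀ k : ℕ, ∃ n, ∀ y, s.E x y → 2 ^ k ≤ s.sz {z | F n z y} y}) :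
    Filter.Tendsto (fun k => m (B k)) Filter.atTop (nhds 0) := by
  have hanti : Antitone fun k => m (B k) := fun k l hkl => hFA.mono (hB.1 hkl)
  have ht := tendsto_atTop_iInf hanti
  rcases eq_or_ne (⨅ k, m (B k)) 0 with h0 | h0
  · rwa [h0] at ht
  exfalso
  obtain ⟨r, hr0, hr⟩ := nnrat_btwn (pos_iff_ne_zero.2 h0)
  have hrne : r ≠ 0 := by
    rintro rfl
    simp at hr0
  have hub : ∀ k, s.ub F (B k \ B (k + 1)) x0 ≤ m (B k \ B (k + 1)) := by
    intro k
    refine le_of_forall_gt_imp_ge_of_dense fun c hc => ?_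
    obtain ⟨N, hN⟩ := s.good_up (h2 k) (hm _) hc
    exact s.ub_le (hN N le_rfl)
  have hsum : ∀ K, ∑ k ∈ Finset.range K, m (B k \ B (k + 1)) + m (B K) = m (B 0) := by
    intro K
    induction K with
    | zero => simp
    | succ K ih =>
      rw [← ih, Finset.sum_range_succ, add_assoc, ← hFA.add _ _ disjoint_sdiff_left,
        sdiff_union_of_subset (hB.1 (Nat.le_succ K))]
  have hts : ∑' k, m (B k \ B (k + 1)) ≠ ⊤ := by
    refine ne_top_of_le_ne_top one_ne_top ?_
    refine ENNReal.tsum_le_of_sum_range_le fun K => ?_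
    exact le_self_add.trans ((hsum K).le.trans (hFA.le_one _))
  have htail := ENNReal.tendsto_sum_nat_add _ hts
  have hr4 : (0 : ℝ≥0∞) < ((r : NNReal) : ℝ≥0∞) / 4 := ENNReal.div_pos hr0.ne' (by simp)
  obtain ⟨J, hJ⟩ := ((tendsto_order.1 htail).2 _ hr4).exists
  refine hx J r hrne ⟨?_, ?_, fun k => ?_⟩
  · obtain ⟨N, hN⟩ := s.good_low (h1 (0 + J)) (hm _) (hr.trans_le (iInf_le _ (0 + J)))
    exact ⟨N, hN N le_rfl⟩
  · have h3 : ∑' k, s.ub F (B (k + J) \ B (k + 1 + J)) x0 ≤ ∑' k, m (B (k + J) \ B (k + J + 1)) := by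
      refine ENNReal.tsum_le_tsum fun k => ?_
      rw [show k + 1 + J = k + J + 1 by omega]
      exact hub (k + J)
    calc _ ≤ 4 * (((r : NNReal) : ℝ≥0∞) / 4) := mul_le_mul_right (h3.trans hJ.le) _
      _ = _ := ENNReal.mul_div_cancel (by simp) (by simp)
  · obtain ⟨N, hN⟩ := hbig k
    exact ⟨N, hN N le_rfl⟩

end Sys
end CocycleNadkarni
end

section
set_option linter.unusedSectionVars false
set_option linter.style.haveILetI false
open MeasureTheory Set ENNReal
namespace CocycleNadkarni
namespace Sys
variable {X : Type*} [MeasurableSpace X] [StandardBorelSpace X] (s : Sys X)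

theorem w_inv {a b : X} (h : s.E a b) : s.w b a = (s.w a b)⁻¹ := by
  have h1 := s.w_mul h (s.symm h)
  rw [s.w_self] at h1
  exact ENNReal.eq_inv_of_mul_eq_one_left h1.symm

theorem exists_measure (hinf : s.Inf) (hnc : ¬ s.Comp univ) :
    ∃ μ : Measure X, IsProbabilityMeasure μ ∧ IsInvariant s.E s.ρ μ := by
  have hfm : ∀ n, Measurable fun x => s.w x (s.G n x) := fun n =>
    s.meas_w measurable_id (s.G n).measurable
  let Q : ℕ × Option ℚ × ℕ × ℤ → Set X := fun t =>
    pc (fun x => s.w x (s.G t.1 x)) (Uq X t.2.1) t.2.2.1 t.2.2.2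
  have hQm : ∀ t, MeasurableSet (Q t) := fun t => pc_meas (hfm t.1) (Uq_meas t.2.1) _ _
  let Q' : ℕ × Option ℚ × ℕ × ℤ → Set X := fun t => (s.G t.1).symm ⁻¹' (Q t)
  have hQ'm : ∀ t, MeasurableSet (Q' t) := fun t => (s.G t.1).symm.measurable (hQm t)
  obtain ⟨ι, hι, D, hD, htest⟩ := test_thm (Sum.elim Q Q')
    (by rintro (t | t); exacts [hQm t, hQ'm t])
  let L : ((ℕ × Option ℚ × ℕ × ℤ) ⊕ (ℕ × Option ℚ × ℕ × ℤ)) ⊕ ((ι × ℕ) ⊕ (ι × ℕ)) → Set X :=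
    Sum.elim (Sum.elim Q Q') (Sum.elim (fun p => D p.1 p.2) (fun p => D p.1 p.2 \ D p.1 (p.2 + 1)))
  have hLm : ∀ i, MeasurableSet (L i) := by
    rintro ((t | t) | (p | p))
    · exact hQm t
    · exact hQ'm t
    · exact (hD p.1).2.1 p.2
    · exact ((hD p.1).2.1 p.2).diff ((hD p.1).2.1 _)
  obtain ⟨e, he⟩ := exists_surjective_nat
    (((ℕ × Option ℚ × ℕ × ℤ) ⊕ (ℕ × Option ℚ × ℕ × ℤ)) ⊕ ((ι × ℕ) ⊕ (ι × ℕ)))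
  obtain ⟨F, C, hF, hFm, hC, hCx⟩ := s.exists_seq hinf (fun i => L (e i)) (fun i => hLm _)
  have hgs : ∀ n x, s.E x ((s.G n).symm x) := fun n x => by
    have := s.EG n ((s.G n).symm x); rw [MeasurableEquiv.apply_symm_apply] at this
    exact s.symm this
  have c1 := fun p : ℕ × (ℕ × Option ℚ × ℕ × ℤ) => s.inv_comp (s.G p.2.1) (s.EG p.2.1) (hF p.1) (hQm p.2)
  have c2 := fun p : ℕ × (ℕ × Option ℚ × ℕ × ℤ) =>
    s.inv_comp (s.G p.2.1).symm (hgs p.2.1) (hF p.1) (hQ'm p.2)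
  have c3 := fun p : ι × ℕ × {r : NNRat // r ≠ 0} => s.sa_comp hF hFm (B := fun k => D p.1 (k + p.2.1))
    (fun k => (hD p.1).2.1 _) (fun a b h => (hD p.1).1 (by omega))
    (by
      refine eq_empty_of_forall_notMem fun x hx => ?_
      have h2 := (hD p.1).2.2
      refine eq_empty_iff_forall_notMem.1 h2 x (mem_iInter.2 fun k => ?_)
      exact (hD p.1).1 (Nat.le_add_right k p.2.1) (mem_iInter.1 hx k))
    (r := ((p.2.2.1 : NNReal) : ℝ≥0∞)) (by have := p.2.2.2; simpa using this) ENNReal.coe_ne_top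
  have hbad := Comp.iUnionC c3 (Comp.iUnionC c2 (Comp.iUnionC c1 hC))
  obtain ⟨x0, hx0⟩ : ∃ x0, x0 ∉ (((C ∪ _) ∪ _) ∪ _ : Set X) := by
    by_contra hcon
    push Not at hcon
    rw [eq_univ_of_forall hcon] at hbad
    exact hnc hbad
  simp only [mem_union, not_or] at hx0
  obtain ⟨⟨⟨hx1, hx2⟩, hx3⟩, hx4⟩ := hx0
  rw [mem_iUnion, not_exists] at hx2 hx3 hx4
  obtain ⟨hbig, hgood⟩ := hCx x0 hx1
  have hG : ∀ i, s.Good F x0 (L i) := by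
    intro i
    obtain ⟨n, rfl⟩ := he i
    exact hgood n
  obtain ⟨m, hm, hlim⟩ := s.exists_m hF x0
  obtain ⟨μ, hμ, hμm⟩ := htest m hm fun i => s.good_sa (hD i)
    (fun k => hG (Sum.inr (Sum.inl (i, k)))) (fun k => hG (Sum.inr (Sum.inr (i, k)))) hm hlim hbig
    (fun J r hr => hx4 (i, J, ⟨r, hr⟩))
  refine ⟨μ, hμ, s.inv_of_G fun n B hB => ?_⟩
  refine inv_of_tests (s.G n) (hfm n) (fun x => (s.w_pos (s.EG n x)).ne') (fun x => s.w_ne_top _ _)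
    ?_ ?_ B hB
  · intro o d k
    have e1 : μ (Q (n, o, d, k)) = m (Q (n, o, d, k)) := hμm (Sum.inl (n, o, d, k))
    have e2 : μ (Q' (n, o, d, k)) = m (Q' (n, o, d, k)) := hμm (Sum.inr (n, o, d, k))
    change dl d ^ k * μ (Q (n, o, d, k)) ≤ μ (Q' (n, o, d, k))
    rw [e1, e2]
    exact s.good_inv hF (s.G n) (s.EG n) (hG (Sum.inl (Sum.inl (n, o, d, k))))
      (hG (Sum.inl (Sum.inr (n, o, d, k)))) hlim (fun i => hx2 (i, n, o, d, k))
      (fun a ha => ha.2.1)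
  · intro o d k
    have e1 : μ (Q (n, o, d, k)) = m (Q (n, o, d, k)) := hμm (Sum.inl (n, o, d, k))
    have e2 : μ (Q' (n, o, d, k)) = m (Q' (n, o, d, k)) := hμm (Sum.inr (n, o, d, k))
    change μ (Q' (n, o, d, k)) ≤ dl d ^ (k + 1) * μ (Q (n, o, d, k))
    rw [e1, e2]
    have e3 : (s.G n).symm.symm ⁻¹' (Q' (n, o, d, k)) = Q (n, o, d, k) := by
      ext x
      simp [Q']
    have h := s.good_inv hF (A := Q' (n, o, d, k)) (s.G n).symm (hgs n)
      (hG (Sum.inl (Sum.inr (n, o, d, k))))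
      (by rw [e3]; exact hG (Sum.inl (Sum.inl (n, o, d, k)))) hlim (fun i => hx3 (i, n, o, d, k))
      (c := (dl d ^ (k + 1))⁻¹) (fun a ha => by
        rw [s.w_inv (s.symm (hgs n a)), ENNReal.inv_le_inv]
        have h2 : s.w ((s.G n).symm a) (s.G n ((s.G n).symm a)) < dl d ^ (k + 1) := ha.2.2
        rw [MeasurableEquiv.apply_symm_apply] at h2
        exact h2.le)
    rw [e3] at h
    have hz0 : dl d ^ (k + 1) ≠ 0 := (ENNReal.zpow_pos (dl_zero d) (dl_top d) _).ne'
    have hzt : dl d ^ (k + 1) ≠ ⊤ := (ENNReal.zpow_lt_top (dl_zero d) (dl_top d) _).ne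
    calc m (Q' (n, o, d, k)) = dl d ^ (k + 1) * ((dl d ^ (k + 1))⁻¹ * m (Q' (n, o, d, k))) := by
          rw [← mul_assoc, ENNReal.mul_inv_cancel hz0 hzt, one_mul]
      _ ≤ _ := mul_le_mul_right h _

end Sys

theorem dichotomy {X : Type*} [MeasurableSpace X] [StandardBorelSpace X]
    (E : X → X → Prop) (hE : IsCBER E)
    (ρ : X → X → ℝ) (hρ : IsCocycle E ρ) :
    Xor'
      (∃ φ : X → X, Measurable φ ∧ (∀ x : X, (φ ⁻¹' {x}).Finite) ∧
        ∃ F : X → X → Prop, IsFinSubequiv E F ∧ CompressionOver E F ρ φ)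
      (∃ μ : Measure X, IsProbabilityMeasure μ ∧ IsInvariant E ρ μ) := by
  obtain ⟨G, hG⟩ := feldman_moore hE
  have he := measurableEmbedding_embeddingReal X
  let s : Sys X := ⟨E, ρ, hE, hρ, G, hG, embeddingReal X, he.measurable, he.injective⟩
  by_cases h2 : ∃ μ : Measure X, IsProbabilityMeasure μ ∧ IsInvariant E ρ μ
  · refine Or.inr ⟨h2, ?_⟩
    rintro ⟨φ, hφ, -, F, hF, hc⟩
    obtain ⟨μ, hμ, hi⟩ := h2
    exact s.not_both hφ hF hc hi
  · refine Or.inl ⟨?_, h2⟩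
    by_cases hc : s.Comp univ
    · exact hc.compression
    · exfalso
      apply h2
      by_cases hinf : s.Inf
      · exact s.exists_measure hinf hc
      · simp only [Sys.Inf, not_forall] at hinf
        obtain ⟨x0, hx0⟩ := hinf
        exact s.measure_of_finite_class x0 hx0

end CocycleNadkarni
end

open MeasureTheory Set ENNReal

namespace CocycleNadkarni

variable {X : Type*} {Γ : Type*}

/-- Nadkarni's theorem for Borel cocycles: either there is a finite-to-one Borel compression
of `ρ` over a finite Borel subequivalence relation of `E`, or there is a `ρ`-invariant
Borel probability measure -- and not both. -/
theorem stmt0 [MeasurableSpace X] [StandardBorelSpace X]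
    (E : X → X → Prop) (hE : IsCBER E)
    (ρ : X → X → ℝ) (hρ : IsCocycle E ρ) :
    Xor'
      (∃ φ : X → X, Measurable φ ∧ (∀ x : X, (φ ⁻¹' {x}).Finite) ∧
        ∃ F : X → X → Prop, IsFinSubequiv E F ∧ CompressionOver E F ρ φ)
      (∃ μ : Measure X, IsProbabilityMeasure μ ∧ IsInvariant E ρ μ) := by
  exact dichotomy E hE ρ hρ

end CocycleNadkarni
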